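/- For every integer k ≥ 2 there exist constants c₀, c, C > 0 (with c₀ an absolute constant and c, C depending only on k) such that the following holds for all sufficiently large N. Set Q := exp((log N)^{1/10}) and P(Q) := ∏_{p < Q, p prime} p. Suppose χ is a primitive real (quadratic) Dirichlet character of conductor q < Q and β is a real number with 1 − c₀/log Q < β < 1 satisfying L(β, χ) = 0 and L'(β, χ) ≠ 0, where L(s, χ) is the Dirichlet L-function of χ and L' its derivative in s. Define α := (1/L'(β, χ))·∏_{p < Q} (1 − 1/p)^{−1}·(1 − χ(p)/p^β)^{−1} and μ_Siegel(n) := ∑_{d | n, d | P(Q)} μ(d)·α·(n/d)^{β−1}·χ(n/d)·1_{gcd(n/d, P(Q)) = 1}, where μ is the Möbius function. Then ‖μ_Siegel‖_{U^k([N])} ≤ C·q^{−c}. -/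

import Mathlib

open scoped Classical

noncomputable section

/-- The product of conjugated shifts appearing in the Gowers norm over an additive group. -/
def gowersProd {G : Type*} [AddCommGroup G] (k : ℕ) (f : G → ℂ) (n : G) (h : Fin k → G) : ℂ :=
  ∏ ω : Fin k → Bool,
    (⇑(starRingEnd ℂ))^[(Finset.univ.filter fun i => ω i = true).card]
      (f (n + ∑ i, if ω i then h i else 0))

/-- The unnormalized Gowers norm `‖f‖_{Ũ^k(G)}`. -/
def gowersTildeU {G : Type*} [AddCommGroup G] (k : ℕ) (f : G → ℂ) : ℝ :=
  (∑' nh : G × (Fin k → G), gowersProd k f nh.1 nh.2).re ^ ((1 : ℝ) / 2 ^ k)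

/-- The restriction `f·1_{[N]}` of `f : ℤ → ℂ` to `[N] = {n ∈ ℕ : 1 ≤ n ≤ N}`. -/
def truncN (N : ℝ) (f : ℤ → ℂ) : ℤ → ℂ := fun n => if 1 ≤ n ∧ (n : ℝ) ≤ N then f n else 0

/-- The local (normalized) Gowers norm `‖f‖_{U^k([N])}`. -/
def gowersUN (k : ℕ) (N : ℝ) (f : ℤ → ℂ) : ℝ :=
  gowersTildeU k (truncN N f) / gowersTildeU k (truncN N fun _ => 1)

/-- The quantity `Q = exp((log N)^{1/10})`. -/
def Qparam (N : ℝ) : ℝ := Real.exp (Real.log N ^ ((1 : ℝ) / 10))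

/-- The primorial `P(w) = ∏_{p < w, p prime} p`. -/
def primorialLT (w : ℝ) : ℕ :=
  ∏ p ∈ (Finset.range (⌈w⌉₊ + 1)).filter fun p => Nat.Prime p ∧ (p : ℝ) < w, p

/-- The Siegel model for the Möbius function:
`μ_Siegel(n) = ∑_{d ∣ n, d ∣ P(Q)} μ(d)·α·(n/d)^{β-1}·χ(n/d)·1_{gcd(n/d, P(Q)) = 1}`. -/
def muSiegelFun (q : ℕ) (χ : DirichletCharacter ℂ q) (β : ℝ) (α : ℂ) (PQ : ℕ) (n : ℕ) : ℂ :=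
  ∑ d ∈ n.divisors.filter fun d => d ∣ PQ,
    (ArithmeticFunction.moebius d : ℂ) * α *
      ((((n / d : ℕ) : ℝ) ^ (β - 1) : ℝ) : ℂ) * χ ((n / d : ℕ) : ZMod q) *
      (if Nat.gcd (n / d) PQ = 1 then 1 else 0)

end


open Polynomial in
noncomputable def stOp {F : Type*} [Field F] (f : F[X]) (h : F) : ℕ → (F[X] →ₗ[F] F[X])
  | 0 => LinearMap.id
  | i + 1 => (LinearMap.mulLeft F f) ∘ₗ derivative ∘ₗ stOp f h i
      + (LinearMap.mulLeft F (C (h - i) * derivative f)) ∘ₗ stOp f h i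

open Polynomial in
lemma stOp_succ {F : Type*} [Field F] (f : F[X]) (h : F) (i : ℕ) (s : F[X]) :
    stOp f h (i+1) s = f * derivative (stOp f h i s) + C (h - i) * derivative f * stOp f h i s := by
  simp [stOp, mul_assoc]

open Polynomial in
lemma stOp_degree {F : Type*} [Field F] (f : F[X]) (h : F) (i : ℕ) (s : F[X]) (B : ℕ)
    (hs : s.natDegree ≤ B) : (stOp f h i s).natDegree ≤ B + i * f.natDegree := by
  induction i with
  | zero => simpa [stOp] using hs
  | succ i ih =>
    rw [stOp_succ]
    refine (natDegree_add_le _ _).trans (max_le ?_ ?_)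
    · refine natDegree_mul_le.trans ?_
      have := natDegree_derivative_le (stOp f h i s)
      rw [add_mul]; omega
    · refine natDegree_mul_le.trans ?_
      have h1 := natDegree_mul_le (p := C (h - (i:F))) (q := derivative f)
      have := natDegree_derivative_le f
      rw [natDegree_C] at h1
      rw [add_mul]; omega

open Polynomial in
lemma stOp_deriv {F : Type*} [Field F] (f : F[X]) (h : ℕ) (s w : F[X]) (hw : derivative w = 0)
    (i : ℕ) : f ^ i * derivative^[i] (s * f ^ h * w) = stOp f (h : F) i s * f ^ h * w := by
  induction i with
  | zero => simp [stOp]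
  | succ i ih =>
    have h1 := congrArg (fun P => f * derivative P) ih
    simp only [derivative_mul, hw, mul_zero, add_zero, derivative_pow] at h1
    rw [Function.iterate_succ_apply', stOp_succ]
    set u := derivative^[i] (s * f ^ h * w)
    set S := stOp f (h : F) i s
    have e1 : f * (C (i:F) * f ^ (i-1) * derivative f * u) = C (i:F) * derivative f * (f^i*u) := by
      rcases i with _ | i
      · simp
      · rw [Nat.add_sub_cancel]; ring
    have e2 : f * (C (h:F) * f ^ (h-1) * derivative f) = C (h:F) * derivative f * f^h := by
      rcases h with _ | h
      · simp
      · rw [Nat.add_sub_cancel]; ring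
    rw [ih] at e1
    have h3 : f ^ (i+1) * derivative u = f * (C (i:F) * f ^ (i-1) * derivative f * u + f ^ i * derivative u)
       - f * (C (i:F) * f ^ (i-1) * derivative f * u) := by ring
    rw [h3, h1, e1]
    have h4 : f * ((derivative S * f ^ h + S * (C (h:F) * f ^ (h - 1) * derivative f)) * w)
      = f * derivative S * f^h * w + S * w * (f * (C (h:F) * f ^ (h-1) * derivative f)) := by ring
    rw [h4, e2, C_sub]
    ring

open Polynomial in
/-- nonvanishing -/
lemma st_nonvanish {p : ℕ} [Fact p.Prime] (hp2 : p ≠ 2) (f : (ZMod p)[X]) (hf0 : f.eval 0 ≠ 0)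
    (t : ZMod p) (hft : f.rootMultiplicity t = 1) (B : ℕ) (hB : 2 * B + f.natDegree ≤ p)
    (J : ℕ) : ∀ (r s : ℕ → (ZMod p)[X]), (∀ j, (r j).degree < B) → (∀ j, (s j).degree < B) →
    ∑ j ∈ Finset.range J, (r j + s j * f ^ (p / 2)) * X ^ (p * j) = 0 →
    ∀ j < J, r j = 0 ∧ s j = 0 := by
  have hf : f ≠ 0 := by rintro rfl; simp at hf0
  have hpodd : 2 * (p/2) + 1 = p := by
    have := (Fact.out : p.Prime).eq_two_or_odd; omega
  have hp0 : 0 < p := (Fact.out : p.Prime).pos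
  have key : ∀ r s : (ZMod p)[X], r.degree < B → s.degree < B → X ^ p ∣ r + s * f ^ (p/2) → r = 0 ∧ s = 0 := by
    intro r s hr hs hd
    have hB0 : s ≠ 0 → 0 < B := by
      intro h; rw [degree_eq_natDegree h] at hs
      have := Nat.cast_lt.mp hs; omega
    have h1 : X ^ p ∣ r ^ 2 * f - s ^ 2 * f ^ p := by
      have : r ^ 2 * f - s ^ 2 * f ^ p = (r + s * f ^ (p/2)) * ((r - s * f^(p/2)) * f) := by
        have hfp : f ^ p = f ^ (p/2) * f ^ (p/2) * f := by
          rw [← pow_add, ← pow_succ]; congr 1; omega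
        rw [hfp]; ring
      rw [this]; exact Dvd.dvd.mul_right hd _
    have h2 : X ^ p ∣ f ^ p - C (f.eval 0) := by
      have h3 : f ^ p = expand (ZMod p) p f := (ZMod.expand_card f).symm
      have h4 : X ∣ f - C (f.eval 0) := by
        rw [X_dvd_iff]; simp [coeff_zero_eq_eval_zero]
      have h5 := map_dvd (expand (ZMod p) p) h4
      rw [map_sub, expand_X, expand_C] at h5
      rwa [h3]
    have h3 : X ^ p ∣ r ^ 2 * f - C (f.eval 0) * s ^ 2 := by
      have : r ^ 2 * f - C (f.eval 0) * s ^ 2 = (r ^ 2 * f - s ^ 2 * f ^ p) + s^2 * (f ^ p - C (f.eval 0)) := by ring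
      rw [this]; exact dvd_add h1 (Dvd.dvd.mul_left h2 _)
    have h4 : r ^ 2 * f - C (f.eval 0) * s ^ 2 = 0 := by
      refine eq_zero_of_dvd_of_degree_lt h3 ?_
      rw [degree_X_pow]
      by_cases hB : B = 0
      · subst hB
        have hr0 : r = 0 := by simpa using hr
        have hs0 : s = 0 := by simpa using hs
        simp [hr0, hs0]
      · have d : ∀ r : (ZMod p)[X], r.degree < B → r.natDegree ≤ B - 1 := by
          intro r hr
          have := natDegree_le_of_degree_le (n := B-1) (p := r) (Order.le_of_lt_succ (by
            refine lt_of_lt_of_le hr ?_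
            have : ((B:ℕ) : WithBot ℕ) = ((B-1+1 : ℕ) : WithBot ℕ) := by congr 1; omega
            rw [this]; rfl))
          exact this
        have n1 := d r hr
        have n2 := d s hs
        have : (r ^ 2 * f - C (f.eval 0) * s ^ 2).natDegree ≤ 2 * (B-1) + f.natDegree := by
          refine (natDegree_sub_le _ _).trans (max_le ?_ ?_)
          · refine natDegree_mul_le.trans ?_
            have := natDegree_pow_le_of_le 2 n1
            omega
          · refine (natDegree_C_mul_le _ _).trans ?_
            have := natDegree_pow_le_of_le 2 n2
            omega
        refine lt_of_le_of_lt (degree_le_of_natDegree_le this) ?_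
        exact_mod_cast (by omega : 2 * (B-1) + f.natDegree < p)
    by_cases hs0 : s = 0
    · subst hs0
      simp [hf] at h4
      exact ⟨h4, rfl⟩
    exfalso
    have hr0 : r ≠ 0 := by
      rintro rfl
      simp [hf0, hs0] at h4
    have h5 := congrArg (rootMultiplicity t) (sub_eq_zero.mp h4)
    rw [rootMultiplicity_mul (mul_ne_zero (pow_ne_zero _ hr0) hf), rootMultiplicity_mul
      (mul_ne_zero (by simpa using hf0) (pow_ne_zero _ hs0)), rootMultiplicity_C, pow_two, pow_two,
      rootMultiplicity_mul (mul_ne_zero hr0 hr0), rootMultiplicity_mul (mul_ne_zero hs0 hs0), hft] at h5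
    omega
  induction J with
  | zero => intro r s _ _ _ j hj; omega
  | succ J ih =>
    intro r s hr hs hsum
    rw [Finset.sum_range_succ'] at hsum
    have e : ∑ j ∈ Finset.range J, (r (j+1) + s (j+1) * f ^ (p / 2)) * X ^ (p * (j+1))
        = X ^ p * ∑ j ∈ Finset.range J, (r (j+1) + s (j+1) * f ^ (p / 2)) * X ^ (p * j) := by
      rw [Finset.mul_sum]
      refine Finset.sum_congr rfl fun j _ => ?_
      rw [mul_add, pow_add]; ring
    rw [e] at hsum
    simp only [mul_zero, pow_zero, mul_one] at hsum
    have h0 := key (r 0) (s 0) (hr 0) (hs 0) (by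
      rw [add_comm] at hsum
      rw [eq_neg_of_add_eq_zero_left hsum]
      exact (dvd_mul_right _ _).neg_right)
    rw [h0.1, h0.2] at hsum
    have h1 := ih (fun j => r (j+1)) (fun j => s (j+1)) (fun j => hr _) (fun j => hs _) (by
      simpa using hsum)
    intro j hj
    rcases j with _ | j
    · exact h0
    · exact h1 j (by omega)

open Polynomial in
lemma st_bound {p : ℕ} [Fact p.Prime] (hp2 : p ≠ 2) (f : (ZMod p)[X]) (hf0 : f.eval 0 ≠ 0)
    (t : ZMod p) (hft : f.rootMultiplicity t = 1) (B J l : ℕ) (hB : 2 * B + f.natDegree ≤ p)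
    (hl : l * (B + l * f.natDegree + J) < 2 * (J * B)) (hl0 : 0 < l) (hlp : l < p)
    (ε : ZMod p) (hε : ε ≠ 0) (A : Finset (ZMod p)) (hA : ∀ x ∈ A, (f.eval x) ^ (p/2) = ε) :
    l * A.card ≤ B + f.natDegree * (p / 2) + p * J := by
  classical
  set m := f.natDegree with hm
  set n := B + l * m + J with hn
  let V := (Fin J → degreeLT (ZMod p) B) × (Fin J → degreeLT (ZMod p) B)
  have hfinD : Module.finrank (ZMod p) (degreeLT (ZMod p) B) = B := by
    rw [(degreeLTEquiv (ZMod p) B).finrank_eq]; simp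
  have : FiniteDimensional (ZMod p) (degreeLT (ZMod p) B) :=
    Module.Finite.equiv (degreeLTEquiv (ZMod p) B).symm
  let P : ℕ → (V →ₗ[ZMod p] (ZMod p)[X]) := fun i =>
    ∑ j : Fin J, (LinearMap.mulRight (ZMod p) (X ^ (j:ℕ))) ∘ₗ
      (stOp f ((0:ℕ) : ZMod p) i ∘ₗ (degreeLT (ZMod p) B).subtype ∘ₗ LinearMap.proj j ∘ₗ LinearMap.fst _ _ _
       + ε • (stOp f ((p/2 : ℕ) : ZMod p) i ∘ₗ (degreeLT (ZMod p) B).subtype ∘ₗ LinearMap.proj j ∘ₗ LinearMap.snd _ _ _))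
  let Φ : V →ₗ[ZMod p] (Fin l → Fin n → ZMod p) :=
    LinearMap.pi fun i => LinearMap.pi fun c => lcoeff (ZMod p) (c:ℕ) ∘ₗ P (i:ℕ)
  have hker : LinearMap.ker Φ ≠ ⊥ := by
    apply LinearMap.ker_ne_bot_of_finrank_lt
    simp only [V, Module.finrank_prod, Module.finrank_pi_fintype, hfinD, Module.finrank_self]
    simp only [Finset.sum_const, Finset.card_univ, Fintype.card_fin, smul_eq_mul, mul_one]
    omega
  obtain ⟨v, hv, hv0⟩ := (Submodule.ne_bot_iff _).mp hker
  let r : ℕ → (ZMod p)[X] := fun j => if h : j < J then (v.1 ⟨j, h⟩ : (ZMod p)[X]) else 0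
  let s : ℕ → (ZMod p)[X] := fun j => if h : j < J then (v.2 ⟨j, h⟩ : (ZMod p)[X]) else 0
  have hr : ∀ j, (r j).degree < B := by
    intro j; simp only [r]; split_ifs with h
    · exact mem_degreeLT.mp (v.1 ⟨j, h⟩).2
    · simp
  have hs : ∀ j, (s j).degree < B := by
    intro j; simp only [s]; split_ifs with h
    · exact mem_degreeLT.mp (v.2 ⟨j, h⟩).2
    · simp
  have dle : ∀ r : (ZMod p)[X], r.degree < B → r.natDegree ≤ B := fun r hr =>
    natDegree_le_of_degree_le hr.le
  have hPeq : ∀ i, P i v = ∑ j ∈ Finset.range J,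
      (stOp f ((0:ℕ) : ZMod p) i (r j) + ε • stOp f ((p/2 : ℕ) : ZMod p) i (s j)) * X ^ j := by
    intro i
    rw [Finset.sum_range]
    simp [P, r, s]
    rfl
  have hP0 : ∀ i < l, P i v = 0 := by
    intro i hi
    have hdeg : (P i v).natDegree < n ∨ P i v = 0 := by
      by_cases hJ : J = 0
      · right; rw [hPeq, hJ]; simp
      left
      rw [hPeq]
      refine lt_of_le_of_lt (natDegree_sum_le_of_forall_le (n := n - 1) _ _ ?_) (by omega)
      intro j hj
      have hj := Finset.mem_range.mp hj
      refine natDegree_mul_le.trans ?_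
      have h1 := stOp_degree f ((0:ℕ) : ZMod p) i (r j) B (dle _ (hr j))
      have h2 := stOp_degree f ((p/2:ℕ) : ZMod p) i (s j) B (dle _ (hs j))
      have h3 := (natDegree_smul_le ε (stOp f ((p/2:ℕ) : ZMod p) i (s j))).trans h2
      have h4 := (natDegree_add_le _ _).trans (max_le h1 h3)
      rw [natDegree_X_pow]
      rw [← hm] at h4
      have h5 : i * m ≤ l * m := Nat.mul_le_mul_right _ hi.le
      omega
    rcases hdeg with hdeg | h
    swap
    · exact h
    ext c
    by_cases hc : c < n
    · have := congrFun (congrFun (LinearMap.mem_ker.mp hv) ⟨i, hi⟩) ⟨c, hc⟩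
      simpa [Φ] using this
    · rw [coeff_eq_zero_of_natDegree_lt (by omega)]; simp
  set F := ∑ j ∈ Finset.range J, (r j + s j * f ^ (p / 2)) * X ^ (p * j) with hF
  have hFne : F ≠ 0 := by
    intro h0
    have := st_nonvanish hp2 f hf0 t hft B hB J r s hr hs h0
    apply hv0
    ext j
    · have := (this j j.2).1
      simp only [r, j.2, dif_pos] at this
      simp [this]
    · have := (this j j.2).2
      simp only [s, j.2, dif_pos] at this
      simp [this]
  have hp0 : 0 < p := (Fact.out : p.Prime).pos
  have hp3 : p / 2 ≠ 0 := by have := (Fact.out : p.Prime).two_le; omega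
  have hmult : ∀ x ∈ A, l ≤ F.rootMultiplicity x := by
    intro x hx
    have hfx : f.eval x ≠ 0 := by
      intro h; have := hA x hx; rw [h, zero_pow hp3] at this; exact hε this.symm
    have hfac : ((l-1).factorial : ZMod p) ∈ nonZeroDivisors (ZMod p) := by
      rw [mem_nonZeroDivisors_iff_ne_zero]
      intro h
      rw [ZMod.natCast_eq_zero_iff] at h
      rw [(Fact.out : p.Prime).dvd_factorial] at h
      omega
    have := (lt_rootMultiplicity_iff_isRoot_iterate_derivative_of_mem_nonZeroDivisors (t := x) hFne hfac).mpr ?_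
    · omega
    intro i hi
    have hw : ∀ j : ℕ, derivative (X ^ (p * j) : (ZMod p)[X]) = 0 := by
      intro j; rw [derivative_X_pow]; simp
    have h1 : f ^ i * derivative^[i] F = ∑ j ∈ Finset.range J,
        (stOp f ((0:ℕ) : ZMod p) i (r j) + stOp f ((p/2 : ℕ) : ZMod p) i (s j) * f ^ (p/2)) * X ^ (p*j) := by
      rw [hF, iterate_derivative_sum, Finset.mul_sum]
      refine Finset.sum_congr rfl fun j _ => ?_
      have a1 := stOp_deriv f 0 (r j) (X ^ (p*j)) (hw j) i
      have a2 := stOp_deriv f (p/2) (s j) (X ^ (p*j)) (hw j) i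
      rw [pow_zero, mul_one, mul_one] at a1
      rw [add_mul, iterate_map_add, mul_add, a1, a2]; ring
    have h2 := congrArg (eval x) h1
    have h3 := congrArg (eval x) ((hPeq i).symm.trans (hP0 i (by omega)))
    have h4 : eval x (∑ j ∈ Finset.range J,
        (stOp f ((0:ℕ) : ZMod p) i (r j) + stOp f ((p/2 : ℕ) : ZMod p) i (s j) * f ^ (p/2)) * X ^ (p*j)) = 0 := by
      rw [← eval_zero (x := x), ← h3, eval_finsetSum, eval_finsetSum]
      refine Finset.sum_congr rfl fun j _ => ?_
      simp only [eval_mul, eval_add, eval_pow, eval_X, eval_smul, hA x hx, pow_mul, ZMod.pow_card, smul_eq_mul]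
      ring
    rw [h4, eval_mul, eval_pow] at h2
    exact (mul_eq_zero.mp h2).resolve_left (pow_ne_zero _ hfx)
  have hdegF : F.natDegree ≤ B + m * (p/2) + p * J := by
    refine natDegree_sum_le_of_forall_le _ _ ?_
    intro j hj
    have hj := Finset.mem_range.mp hj
    refine natDegree_mul_le.trans ?_
    rw [natDegree_X_pow]
    have h1 : (s j * f ^ (p/2)).natDegree ≤ B + m * (p/2) := by
      refine natDegree_mul_le.trans ?_
      have h3 := natDegree_pow_le (p := f) (n := p/2)
      have := dle _ (hs j)
      rw [← hm] at h3
      rw [mul_comm m]; omega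
    have h2 : (r j + s j * f ^ (p/2)).natDegree ≤ B + m * (p/2) :=
      (natDegree_add_le _ _).trans (max_le ((dle _ (hr j)).trans (by omega)) h1)
    have : p * j ≤ p * J := Nat.mul_le_mul_left _ hj.le
    omega
  calc l * A.card = ∑ x ∈ A, l := by rw [Finset.sum_const, smul_eq_mul, mul_comm]
    _ ≤ ∑ x ∈ A, F.roots.count x := Finset.sum_le_sum fun x hx => by rw [count_roots]; exact hmult x hx
    _ ≤ ∑ x ∈ F.roots.toFinset, F.roots.count x := by
        refine Finset.sum_le_sum_of_ne_zero fun x _ h => ?_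
        rw [Multiset.mem_toFinset]; exact Multiset.count_ne_zero.mp h
    _ = F.roots.card := Multiset.toFinset_sum_count_eq _
    _ ≤ F.natDegree := card_roots' _
    _ ≤ _ := hdegF

open Polynomial in
lemma weil_aux (m p : ℕ) [Fact p.Prime] (hp : 16 * (m+1) < p) (s : Finset (ZMod p))
    (hs : s.Nonempty) (hsm : s.card ≤ m) (h0 : ∀ a ∈ s, a ≠ 0) :
    |((∑ x : ZMod p, ∏ a ∈ s, quadraticChar (ZMod p) (x + a) : ℤ) : ℝ)|
      ≤ (2 * √(16 * (m+1)) * (m+2) + m) * √p := by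
  have hp2 : p ≠ 2 := by omega
  set f : (ZMod p)[X] := ∏ a ∈ s, (X + C a) with hf
  have hfe : ∀ x, f.eval x = ∏ a ∈ s, (x + a) := by
    intro x; rw [hf, eval_prod]; simp
  have hdeg : f.natDegree = s.card := by
    rw [hf, natDegree_prod_of_monic _ _ (fun a _ => monic_X_add_C a)]; simp
  have hf0 : f.eval 0 ≠ 0 := by
    rw [hfe]; simpa [Finset.prod_ne_zero_iff] using h0
  obtain ⟨a, ha⟩ := hs
  have hft : f.rootMultiplicity (-a) = 1 := by
    have hfne : f ≠ 0 := by rintro h; rw [h] at hf0; simp at hf0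
    have e : f = (X - C (-a)) * ∏ b ∈ s.erase a, (X + C b) := by
      rw [hf, ← Finset.mul_prod_erase s _ ha]; simp
    rw [e] at hfne ⊢
    rw [rootMultiplicity_mul hfne, rootMultiplicity_X_sub_C_self, rootMultiplicity_eq_zero]
    rw [IsRoot.def, eval_prod, Finset.prod_eq_zero_iff]
    rintro ⟨b, hb, h⟩
    simp only [eval_add, eval_X, eval_C] at h
    exact (Finset.mem_erase.mp hb).1 (by linear_combination h)
  set J := Nat.sqrt (p / (16 * (m+1))) with hJ
  have hJ1 : J * J ≤ p / (16 * (m+1)) := Nat.sqrt_le _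
  have hJ2 : p / (16*(m+1)) < (J+1)*(J+1) := by simpa using Nat.lt_succ_sqrt (p / (16*(m+1)))
  have hJ0 : 0 < J := Nat.sqrt_pos.mpr (Nat.div_pos hp.le (by omega))
  have hJ3 : J * J * (16 * (m+1)) ≤ p := (Nat.le_div_iff_mul_le (by omega)).mp hJ1
  have hbound : ∀ ε : ZMod p, ε ≠ 0 → ∀ A : Finset (ZMod p), (∀ x ∈ A, (f.eval x) ^ (p/2) = ε) →
      (A.card : ℝ) ≤ p / 2 + √(16*(m+1)) * (m+2) * √p := by
    intro ε hε A hA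
    have hb := st_bound hp2 f hf0 (-a) hft ((p - s.card)/2) J (2*J-1) (by rw [hdeg]; omega) (by
      rw [hdeg]
      obtain ⟨j, hj⟩ : ∃ j, J = j + 1 := ⟨J-1, by omega⟩
      set B := (p - s.card)/2 with hB
      have hB4 : p < 4 * B := by omega
      have e : 2 * J - 1 = 2 * j + 1 := by omega
      rw [e]
      have h1 : (2*j+1) * s.card ≤ (2*j+1) * m := Nat.mul_le_mul_left _ hsm
      have h2 : (2*j+1) * (B + (2*j+1) * s.card + J) ≤ (2*j+1) * (B + (2*j+1) * m + J) := by gcongr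
      refine lt_of_le_of_lt h2 ?_
      rw [hj] at hJ3 ⊢
      nlinarith) (by omega) (by
      have h9 : J * 2 ≤ J * (J * (16 * (m+1))) := Nat.mul_le_mul_left _ (by nlinarith)
      have h10 : J * (J * (16 * (m+1))) ≤ p := by rw [← mul_assoc]; exact hJ3
      omega) ε hε A hA
    rw [hdeg] at hb
    have hb' : (2*J-1) * A.card * 2 ≤ p + m * p + 2 * p * J := by
      have h1 : s.card * (p/2) ≤ m * (p/2) := Nat.mul_le_mul_right _ hsm
      have h2 : m * (p/2) * 2 ≤ m * p := by rw [mul_assoc]; exact Nat.mul_le_mul_left _ (by omega)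
      have h3 : (p - s.card)/2 * 2 ≤ p := by omega
      nlinarith
    have hb2 : (2*(J:ℝ)-1) * A.card * 2 ≤ p + m * p + 2 * p * J := by
      have : ((2*J-1 : ℕ) : ℝ) = 2*(J:ℝ)-1 := by rw [Nat.cast_sub (by omega)]; push_cast; ring
      rw [← this]; exact_mod_cast hb'
    have hJr : (1:ℝ) ≤ J := by exact_mod_cast hJ0
    have hpos : (0:ℝ) < p := by exact_mod_cast (by omega : 0 < p)
    have hsq : √(p:ℝ) ≤ √(16*((m:ℝ)+1)) * (2 * J) := by
      apply Real.sqrt_le_iff.mpr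
      refine ⟨by positivity, ?_⟩
      rw [mul_pow, Real.sq_sqrt (by positivity)]
      have : p < (J+1)*(J+1) * (16*(m+1)) := (Nat.div_lt_iff_lt_mul (by omega)).mp hJ2
      have : (p:ℝ) < (J+1)*(J+1) * (16*(m+1)) := by exact_mod_cast this
      have h2 : ((J:ℝ)+1)*(J+1) ≤ (2*J)^2 := by nlinarith
      nlinarith [mul_le_mul_of_nonneg_right h2 (by positivity : (0:ℝ) ≤ 16*(m+1))]
    have hA1 : ((A.card : ℝ) - p/2) * (2*(2*J-1)) ≤ p * (m+2) := by nlinarith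
    have hpp : (p:ℝ) = √p * √p := (Real.mul_self_sqrt hpos.le).symm
    by_contra hcon
    push Not at hcon
    have hE : √(16*((m:ℝ)+1)) * (m+2) * √p < (A.card:ℝ) - p/2 := by linarith
    have h5 : √(16*((m:ℝ)+1)) * (m+2) * √p * (2*(2*J-1)) < p * (m+2) :=
      lt_of_lt_of_le (mul_lt_mul_of_pos_right hE (by linarith)) hA1
    have h6 : √(p:ℝ) * ((m+2) * √p) ≤ √(16*((m:ℝ)+1)) * (2 * J) * ((m+2) * √p) :=
      mul_le_mul_of_nonneg_right hsq (by positivity)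
    have h7 : (0:ℝ) ≤ √(16*((m:ℝ)+1)) * (m+2) * √p := by positivity
    nlinarith
  have hchar : ringChar (ZMod p) ≠ 2 := by rwa [ZMod.ringChar_zmod_n]
  set A1 := Finset.univ.filter fun x : ZMod p => quadraticChar (ZMod p) (f.eval x) = 1 with hA1
  set A2 := Finset.univ.filter fun x : ZMod p => quadraticChar (ZMod p) (f.eval x) = -1 with hA2
  have hc1 := hbound 1 one_ne_zero A1 (fun x hx => by
    have h1 := (Finset.mem_filter.mp hx).2
    have h2 := quadraticChar_eq_pow_of_char_ne_two' hchar (f.eval x)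
    rw [h1, ZMod.card] at h2; simpa using h2.symm)
  have hc2 := hbound (-1) (neg_ne_zero.mpr one_ne_zero) A2 (fun x hx => by
    have h1 := (Finset.mem_filter.mp hx).2
    have h2 := quadraticChar_eq_pow_of_char_ne_two' hchar (f.eval x)
    rw [h1, ZMod.card] at h2; simpa using h2.symm)
  have hsum : (∑ x : ZMod p, ∏ a ∈ s, quadraticChar (ZMod p) (x + a) : ℤ) = A1.card - A2.card := by
    rw [Finset.card_filter, Finset.card_filter]
    push_cast
    rw [← Finset.sum_sub_distrib]
    refine Finset.sum_congr rfl fun x _ => ?_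
    rw [← map_prod, ← hfe]
    by_cases h : f.eval x = 0
    · simp [h]
    · rcases quadraticChar_dichotomy h with h | h <;> rw [h] <;> simp
  have htot : (p:ℝ) - m ≤ A1.card + A2.card := by
    have : p ≤ A1.card + A2.card + (s.image fun a => -a).card := by
      calc p = (Finset.univ : Finset (ZMod p)).card := by rw [Finset.card_univ, ZMod.card]
        _ ≤ (A1 ∪ A2 ∪ (s.image fun a => -a)).card := by
          apply Finset.card_le_card
          intro x _
          simp only [Finset.mem_union, hA1, hA2, Finset.mem_filter, Finset.mem_univ, true_and, Finset.mem_image]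
          by_cases h : f.eval x = 0
          · right
            rw [hfe, Finset.prod_eq_zero_iff] at h
            obtain ⟨b, hb, h⟩ := h
            exact ⟨b, hb, by linear_combination -h⟩
          · left; exact quadraticChar_dichotomy h
        _ ≤ _ := (Finset.card_union_le _ _).trans (Nat.add_le_add_right (Finset.card_union_le _ _) _)
    have h2 : (s.image fun a => -a).card ≤ m := Finset.card_image_le.trans hsm
    have : p ≤ A1.card + A2.card + m := by omega
    have : (p:ℝ) ≤ A1.card + A2.card + m := by exact_mod_cast this
    linarith
  rw [hsum]
  push_cast
  have h1 : (m:ℝ) ≤ m * √p := by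
    have : (1:ℝ) ≤ √p := Real.one_le_sqrt.mpr (by exact_mod_cast (by omega : 1 ≤ p))
    nlinarith [(Nat.cast_nonneg m : (0:ℝ) ≤ m)]
  rw [abs_le]
  constructor <;> nlinarith

lemma weil_bound (m : ℕ) : ∃ C : ℝ, 0 < C ∧ ∀ (p : ℕ) [Fact p.Prime] (s : Finset (ZMod p)),
    s.Nonempty → s.card ≤ m →
    |((∑ x : ZMod p, ∏ a ∈ s, quadraticChar (ZMod p) (x + a) : ℤ) : ℝ)| ≤ C * √p := by
  refine ⟨max (2 * √(16 * (m+1)) * (m+2) + m) (√(16*(m+1))), by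
    apply lt_max_of_lt_right; positivity, ?_⟩
  intro p _ s hs hsm
  have hp0 := (Fact.out : p.Prime).pos
  by_cases hp : 16 * (m+1) < p
  · obtain ⟨c, hc⟩ : ∃ c : ZMod p, c ∉ s.image fun a => -a := by
      by_contra h
      push Not at h
      have h1 : (Finset.univ : Finset (ZMod p)).card ≤ (s.image fun a => -a).card :=
        Finset.card_le_card fun x _ => h x
      rw [Finset.card_univ, ZMod.card] at h1
      have := (Finset.card_image_le (s := s) (f := fun a => -a))
      omega
    have hinj : Function.Injective (fun a : ZMod p => a + c) := add_left_injective c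
    have h1 := weil_aux m p hp (s.image fun a => a + c) (hs.image _) (Finset.card_image_le.trans hsm) (by
      intro a ha h0
      obtain ⟨b, hb, rfl⟩ := Finset.mem_image.mp ha
      exact hc (Finset.mem_image.mpr ⟨b, hb, by linear_combination -h0⟩))
    have h2 : (∑ x : ZMod p, ∏ a ∈ s, quadraticChar (ZMod p) (x + a) : ℤ)
        = ∑ x : ZMod p, ∏ a ∈ s.image (fun a => a + c), quadraticChar (ZMod p) (x + a) := by
      rw [← Equiv.sum_comp (Equiv.addRight c)]
      refine Finset.sum_congr rfl fun x _ => ?_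
      rw [Finset.prod_image (fun a _ b _ h => hinj h)]
      refine Finset.prod_congr rfl fun a _ => ?_
      congr 1
      simp only [Equiv.coe_addRight]; ring
    rw [h2]
    exact h1.trans (mul_le_mul_of_nonneg_right (le_max_left _ _) (Real.sqrt_nonneg _))
  · push Not at hp
    have h1 : |((∑ x : ZMod p, ∏ a ∈ s, quadraticChar (ZMod p) (x + a) : ℤ) : ℝ)| ≤ p := by
      have : |∑ x : ZMod p, ∏ a ∈ s, quadraticChar (ZMod p) (x + a)| ≤ (p:ℤ) := by
        refine (Finset.abs_sum_le_sum_abs _ _).trans ?_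
        calc _ ≤ ∑ x : ZMod p, (1:ℤ) := by
              refine Finset.sum_le_sum fun x _ => ?_
              rw [Finset.abs_prod]
              refine Finset.prod_le_one (fun _ _ => abs_nonneg _) fun a _ => ?_
              by_cases h : x + a = 0
              · simp [h]
              · rcases quadraticChar_dichotomy h with h | h <;> rw [h] <;> simp
          _ = p := by simp [ZMod.card]
      exact_mod_cast this
    refine h1.trans ?_
    have h3 : (p:ℝ) = √p * √p := (Real.mul_self_sqrt (by positivity)).symm
    have h4 : √(p:ℝ) ≤ √(16*((m:ℝ)+1)) := Real.sqrt_le_sqrt (by exact_mod_cast hp)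
    calc (p:ℝ) = √p * √p := h3
      _ ≤ _ := mul_le_mul_of_nonneg_right (h4.trans (le_max_right _ _)) (Real.sqrt_nonneg _)

lemma abel_aux (a g : ℕ → ℝ) (K : ℝ) (m : ℕ) (hA : ∀ j, |∑ i ∈ Finset.Ico m j, a i| ≤ K) (j : ℕ)
    (hg : ∀ i, m ≤ i → i < m + j → g (i+1) ≤ g i) :
    |∑ i ∈ Finset.Ico m (m+j+1), a i * g i - (∑ i ∈ Finset.Ico m (m+j+1), a i) * g (m+j)|
      ≤ K * (g m - g (m+j)) := by
  induction j with
  | zero => simp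
  | succ j ih =>
    have ih := ih (fun i h1 h2 => hg i h1 (by omega))
    have hd := hg (m+j) (by omega) (by omega)
    rw [Finset.sum_Ico_succ_top (by omega), Finset.sum_Ico_succ_top (by omega)]
    have hA' := hA (m+j+1)
    set S := ∑ i ∈ Finset.Ico m (m+j+1), a i * g i
    set B := ∑ i ∈ Finset.Ico m (m+j+1), a i
    have e : S + a (m+j+1) * g (m+j+1) - (B + a (m+j+1)) * g (m+j+1)
      = (S - B * g (m+j)) + B * (g (m+j) - g (m+j+1)) := by ring
    have h2 : |B * (g (m+j) - g (m+j+1))| ≤ K * (g (m+j) - g (m+j+1)) := by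
      rw [abs_mul, abs_of_nonneg (sub_nonneg.mpr hd)]
      exact mul_le_mul_of_nonneg_right hA' (sub_nonneg.mpr hd)
    rw [← add_assoc] at *
    rw [e]
    calc _ ≤ _ := abs_add_le _ _
      _ ≤ K * (g m - g (m+j)) + K * (g (m+j) - g (m+j+1)) := add_le_add ih h2
      _ = _ := by ring

lemma abel_bound (a g : ℕ → ℝ) (K : ℝ) (m n : ℕ) (hA : ∀ j, |∑ i ∈ Finset.Ico m j, a i| ≤ K)
    (hg : ∀ i, m ≤ i → i + 1 < n → g (i+1) ≤ g i) (hg0 : ∀ i, m ≤ i → i < n → 0 ≤ g i)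
    (hm : 0 ≤ g m) :
    |∑ i ∈ Finset.Ico m n, a i * g i| ≤ K * g m := by
  have hK : 0 ≤ K := (abs_nonneg _).trans (hA m)
  rcases le_or_gt n m with h | h
  · rw [Finset.Ico_eq_empty (by omega)]; simpa using mul_nonneg hK hm
  · obtain ⟨j, rfl⟩ : ∃ j, n = m + j + 1 := ⟨n - m - 1, by omega⟩
    have h1 := abel_aux a g K m hA j (fun i h1 h2 => hg i h1 (by omega))
    have h2 : |(∑ i ∈ Finset.Ico m (m+j+1), a i) * g (m+j)| ≤ K * g (m+j) := by
      rw [abs_mul, abs_of_nonneg (hg0 _ (by omega) (by omega))]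
      exact mul_le_mul_of_nonneg_right (hA _) (hg0 _ (by omega) (by omega))
    have h3 := abs_add_le (∑ i ∈ Finset.Ico m (m+j+1), a i * g i - (∑ i ∈ Finset.Ico m (m+j+1), a i) * g (m+j)) ((∑ i ∈ Finset.Ico m (m+j+1), a i) * g (m+j))
    rw [sub_add_cancel] at h3
    linarith

lemma hyperbola (f h : ℕ → ℝ) (X Y : ℕ) (hY : Y ≤ X) :
    ∑ n ∈ Finset.Icc 1 X, (∑ d ∈ n.divisors, f d) * h n =
      ∑ d ∈ Finset.Icc 1 Y, f d * ∑ m ∈ Finset.Icc 1 (X / d), h (d * m) +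
      ∑ m ∈ Finset.Icc 1 X, ∑ d ∈ Finset.Ico (Y+1) (X / m + 1), f d * h (d * m) := by
  have h0 : ∑ n ∈ Finset.Icc 1 X, (∑ d ∈ n.divisors, f d) * h n =
      ∑ d ∈ Finset.Icc 1 X, ∑ m ∈ Finset.Icc 1 (X / d), f d * h (d * m) := by
    simp_rw [Finset.sum_mul]
    rw [Finset.sum_sigma', Finset.sum_sigma']
    refine Finset.sum_bij' (fun x _ => ⟨x.2, x.1 / x.2⟩) (fun x _ => ⟨x.1 * x.2, x.1⟩) ?_ ?_ ?_ ?_ ?_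
    · rintro ⟨n, d⟩ hx
      simp only [Finset.mem_sigma, Finset.mem_Icc, Nat.mem_divisors] at hx ⊢
      obtain ⟨⟨h1, h2⟩, ⟨e, rfl⟩, h3⟩ := hx
      have hd : 0 < d := by rcases Nat.eq_zero_or_pos d with h | h; simp [h] at h3; exact h
      have he : 0 < e := by rcases Nat.eq_zero_or_pos e with h | h; simp [h] at h3; exact h
      rw [Nat.mul_div_cancel_left _ hd]
      refine ⟨⟨hd, ?_⟩, he, (Nat.le_div_iff_mul_le hd).mpr (by linarith [mul_comm e d])⟩
      nlinarith
    · rintro ⟨d, m⟩ hx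
      simp only [Finset.mem_sigma, Finset.mem_Icc, Nat.mem_divisors] at hx ⊢
      obtain ⟨⟨h1, h2⟩, h3, h4⟩ := hx
      have := (Nat.le_div_iff_mul_le h1).mp h4
      refine ⟨⟨Nat.mul_pos h1 h3, by linarith [mul_comm m d]⟩, dvd_mul_right _ _, ?_⟩
      exact (Nat.mul_pos h1 h3).ne'
    · rintro ⟨n, d⟩ hx
      simp only [Finset.mem_sigma, Finset.mem_Icc, Nat.mem_divisors] at hx ⊢
      rw [Nat.mul_div_cancel' hx.2.1]
    · rintro ⟨d, m⟩ hx
      simp only [Finset.mem_sigma, Finset.mem_Icc] at hx ⊢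
      rw [Nat.mul_div_cancel_left _ hx.1.1]
    · rintro ⟨n, d⟩ hx
      simp only [Finset.mem_sigma, Finset.mem_Icc, Nat.mem_divisors] at hx ⊢
      rw [Nat.mul_div_cancel' hx.2.1]
  have h1 : Finset.Icc 1 X = Finset.Icc 1 Y ∪ Finset.Icc (Y+1) X := by
    ext a; simp only [Finset.mem_union, Finset.mem_Icc]; omega
  have h2 : Disjoint (Finset.Icc 1 Y) (Finset.Icc (Y+1) X) := by
    rw [Finset.disjoint_left]; intro a; simp only [Finset.mem_Icc]; omega
  rw [h0]
  conv_lhs => rw [h1, Finset.sum_union h2]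
  congr 1
  · simp_rw [Finset.mul_sum]
  · rw [Finset.sum_comm' (t' := Finset.Icc 1 X) (s' := fun m => Finset.Ico (Y+1) (X / m + 1))]
    intro d m
    simp only [Finset.mem_Icc, Finset.mem_Ico]
    constructor
    · rintro ⟨⟨h1, h2⟩, h3, h4⟩
      have h5 := (Nat.le_div_iff_mul_le (by omega)).mp h4
      have h6 : d ≤ X / m := (Nat.le_div_iff_mul_le (by omega)).mpr (by linarith [mul_comm d m])
      have h7 : m ≤ m * d := Nat.le_mul_of_pos_right _ (by omega)
      omega
    · rintro ⟨⟨h1, h2⟩, h3, h4⟩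
      have h5 := (Nat.le_div_iff_mul_le (by omega)).mp (by omega : d ≤ X / m)
      have h6 : m ≤ X / d := (Nat.le_div_iff_mul_le (by omega)).mpr (by linarith [mul_comm d m])
      have h7 : d ≤ d * m := Nat.le_mul_of_pos_right _ (by omega)
      omega

/-- Euler–Maclaurin type lemma -/
lemma em_lemma (g G g' : ℝ → ℝ) (K : ℝ) (hK : 0 ≤ K) (hG : ∀ u, 1 ≤ u → HasDerivAt G (g u) u)
    (hg : ∀ u, 1 ≤ u → HasDerivAt g (g' u) u) (hg' : ∀ u, 1 ≤ u → |g' u| ≤ K * u ^ (-(3/2) : ℝ))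
    (hgb : ∀ u, 1 ≤ u → |g u| ≤ K * u ^ (-(1/2) : ℝ)) :
    ∃ c : ℝ, ∀ t : ℝ, 1 ≤ t → |∑ m ∈ Finset.Icc 1 ⌊t⌋₊, g m - G t - c| ≤ 14 * K * t ^ (-(1/2) : ℝ) := by
  set a : ℕ → ℝ := fun n => ∑ m ∈ Finset.Icc 1 n, g m - G n with ha
  -- step
  have hMV : ∀ s t : ℝ, 1 ≤ s → s ≤ t → t ≤ s + 1 → |G t - G s| ≤ K * s ^ (-(1/2):ℝ) := by
    intro s t hs hst ht
    have := Convex.norm_image_sub_le_of_norm_hasDerivWithin_le (f := G) (f' := g) (s := Set.Icc s t)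
      (C := K * s ^ (-(1/2):ℝ)) (x := s) (y := t)
      (fun u hu => (hG u (hs.trans hu.1)).hasDerivWithinAt)
      (fun u hu => (hgb u (hs.trans hu.1)).trans (mul_le_mul_of_nonneg_left
        (Real.rpow_le_rpow_of_nonpos (by linarith) hu.1 (by norm_num)) hK)) (convex_Icc s t)
      ⟨le_rfl, hst⟩ ⟨hst, le_rfl⟩
    refine this.trans ?_
    rw [Real.norm_eq_abs, abs_of_nonneg (by linarith)]
    have : 0 ≤ K * s ^ (-(1/2):ℝ) := by positivity
    nlinarith
  have hstep : ∀ n : ℕ, 1 ≤ n → |a (n+1) - a n| ≤ K * (n:ℝ) ^ (-(3/2):ℝ) := by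
    intro n hn
    have hn1 : (1:ℝ) ≤ n := by exact_mod_cast hn
    have e : a (n+1) - a n = -((G (n+1) - g (n+1) * (n+1)) - (G n - g (n+1) * n)) := by
      simp only [ha]; rw [Finset.sum_Icc_succ_top (by omega)]; push_cast; ring
    rw [e, abs_neg]
    have := Convex.norm_image_sub_le_of_norm_hasDerivWithin_le (f := fun u => G u - g (n+1) * u)
      (f' := fun u => g u - g (n+1)) (s := Set.Icc (n:ℝ) (n+1))
      (C := K * (n:ℝ) ^ (-(3/2):ℝ)) (x := (n:ℝ)) (y := n+1)
      (fun u hu => ((hG u (hn1.trans hu.1)).sub (by simpa using (hasDerivAt_id u).const_mul (g (n+1)))).hasDerivWithinAt)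
      (fun u hu => by
        have h2 := Convex.norm_image_sub_le_of_norm_hasDerivWithin_le (f := g)
          (f' := g') (s := Set.Icc (n:ℝ) (n+1))
          (C := K * (n:ℝ) ^ (-(3/2):ℝ)) (x := n+1) (y := u)
          (fun u hu => (hg u (hn1.trans hu.1)).hasDerivWithinAt)
          (fun u hu => (hg' u (hn1.trans hu.1)).trans (mul_le_mul_of_nonneg_left
            (Real.rpow_le_rpow_of_nonpos (by linarith) hu.1 (by norm_num)) hK)) (convex_Icc _ _)
          ⟨by linarith, le_rfl⟩ hu
        refine h2.trans ?_
        have h3 : ‖u - ((n:ℝ)+1)‖ ≤ 1 := by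
          rw [Real.norm_eq_abs, abs_le]; constructor <;> linarith [hu.1, hu.2]
        have : 0 ≤ K * (n:ℝ) ^ (-(3/2):ℝ) := by positivity
        nlinarith) (convex_Icc _ _) ⟨le_rfl, by linarith⟩ ⟨by linarith, le_rfl⟩
    simpa using this
  -- telescoping bound
  have htel : ∀ n : ℕ, 1 ≤ n → (n:ℝ) ^ (-(3/2):ℝ) ≤ 6 * ((n:ℝ) ^ (-(1/2):ℝ) - ((n:ℝ)+1) ^ (-(1/2):ℝ)) := by
    intro n hn
    have hn1 : (1:ℝ) ≤ n := by exact_mod_cast hn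
    have hn0 : (0:ℝ) < n := by linarith
    set b := √(n:ℝ) with hb
    set d := √((n:ℝ)+1) with hd
    have hb2 : b * b = n := Real.mul_self_sqrt hn0.le
    have hd2 : d * d = n + 1 := Real.mul_self_sqrt (by linarith)
    have hb1 : 1 ≤ b := Real.one_le_sqrt.mpr hn1
    have hbd : b ≤ d := Real.sqrt_le_sqrt (by linarith)
    have e1 : (n:ℝ) ^ (-(1/2):ℝ) = 1 / b := by
      rw [Real.rpow_neg hn0.le, ← Real.sqrt_eq_rpow, one_div]
    have e2 : ((n:ℝ)+1) ^ (-(1/2):ℝ) = 1 / d := by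
      rw [Real.rpow_neg (by linarith), ← Real.sqrt_eq_rpow, one_div]
    have e3 : (n:ℝ) ^ (-(3/2):ℝ) = 1 / (b * b * b) := by
      rw [show (-(3/2):ℝ) = -1 + -(1/2) by norm_num, Real.rpow_add hn0, e1, Real.rpow_neg_one, ← hb2]
      field_simp
    rw [e1, e2, e3]
    have hd0 : 0 < d := by linarith
    have hb0 : 0 < b := by linarith
    have h1 : 1 / b - 1 / d = 1 / (b * d * (b + d)) := by
      rw [div_sub_div _ _ hb0.ne' hd0.ne', div_eq_div_iff (by positivity) (by positivity)]
      have : (d - b) * (b + d) = 1 := by nlinarith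
      linear_combination b * d * this
    rw [h1, mul_one_div, div_le_div_iff₀ (by positivity) (by positivity)]
    have h2 : d ≤ 2 * b := by nlinarith
    nlinarith [mul_pos hb0 hb0, mul_pos hb0 hd0, mul_le_mul h2 h2 hd0.le (by positivity), mul_pos (mul_pos hb0 hb0) hb0, mul_le_mul_of_nonneg_left h2 (mul_pos hb0 hb0).le, mul_le_mul_of_nonneg_left (mul_le_mul h2 h2 hd0.le (by positivity)) hb0.le]
  have hdist : ∀ n j : ℕ, 1 ≤ n → |a (n+j) - a n| ≤ 6 * K * ((n:ℝ) ^ (-(1/2):ℝ) - ((n+j:ℕ):ℝ) ^ (-(1/2):ℝ)) := by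
    intro n j hn
    induction j with
    | zero => simp
    | succ j ih =>
      have h1 := hstep (n+j) (by omega)
      have h2 := htel (n+j) (by omega)
      have h3 : a (n+(j+1)) - a n = (a (n+j+1) - a (n+j)) + (a (n+j) - a n) := by
        rw [← add_assoc]; ring
      rw [h3]
      refine (abs_add_le _ _).trans ?_
      have h4 := mul_le_mul_of_nonneg_left h2 hK
      push_cast at *
      rw [← add_assoc]
      linarith
  have hdist2 : ∀ n j : ℕ, 1 ≤ n → n ≤ j → |a j - a n| ≤ 6 * K * ((n:ℝ) ^ (-(1/2):ℝ)) := by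
    intro n j hn hj
    obtain ⟨i, rfl⟩ := Nat.exists_eq_add_of_le hj
    refine (hdist n i hn).trans (mul_le_mul_of_nonneg_left ?_ (by positivity))
    have : 0 ≤ ((n+i:ℕ):ℝ) ^ (-(1/2):ℝ) := by positivity
    linarith
  have hlim0 : Filter.Tendsto (fun n : ℕ => 6 * K * ((n:ℝ) ^ (-(1/2):ℝ))) Filter.atTop (nhds 0) := by
    have := ((tendsto_rpow_neg_atTop (by norm_num : (0:ℝ) < 1/2)).comp tendsto_natCast_atTop_atTop).const_mul (6*K)
    simpa using this
  have hcau : CauchySeq a := by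
    rw [Metric.cauchySeq_iff']
    intro ε hε
    obtain ⟨n, hn⟩ := ((hlim0.eventually_lt_const hε).and (Filter.eventually_ge_atTop 1)).exists
    exact ⟨n, fun j hj => (hdist2 n j hn.2 hj).trans_lt hn.1⟩
  obtain ⟨c, hc⟩ := cauchySeq_tendsto_of_complete hcau
  refine ⟨c, fun t ht => ?_⟩
  set n := ⌊t⌋₊ with hn
  have hn1 : 1 ≤ n := Nat.le_floor (by simpa using ht)
  have hnt : (n:ℝ) ≤ t := Nat.floor_le (by linarith)
  have htn : t < n + 1 := Nat.lt_floor_add_one t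
  have h1 : |a n - c| ≤ 6 * K * ((n:ℝ) ^ (-(1/2):ℝ)) := by
    rw [abs_sub_comm]
    refine le_of_tendsto (hc.sub_const (a n)).abs ?_
    filter_upwards [Filter.eventually_ge_atTop n] with j hj using hdist2 n j hn1 hj
  have h2 := hMV n t (by exact_mod_cast hn1) hnt htn.le
  have h3 : (n:ℝ) ^ (-(1/2):ℝ) ≤ 2 * t ^ (-(1/2):ℝ) := by
    have hn1' : (1:ℝ) ≤ n := by exact_mod_cast hn1
    have h4 : ((n:ℝ)) ^ (-(1/2):ℝ) ≤ (t / 4) ^ (-(1/2):ℝ) :=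
      Real.rpow_le_rpow_of_nonpos (by linarith) (by linarith) (by norm_num)
    refine h4.trans (le_of_eq ?_)
    rw [Real.div_rpow (by linarith) (by norm_num), show (4:ℝ) = 2 ^ (2:ℝ) by norm_num,
      ← Real.rpow_mul (by norm_num), show (2:ℝ) * -(1/2) = -1 by norm_num, Real.rpow_neg_one]
    ring
  have e : ∑ m ∈ Finset.Icc 1 n, g m - G t - c = (a n - c) - (G t - G n) := by
    simp only [ha]; ring
  rw [e]
  have h5 := abs_sub (a n - c) (G t - G n)
  have h6 := mul_le_mul_of_nonneg_left h3 hK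
  linarith

lemma em0 (β : ℝ) (h1 : 9/10 ≤ β) (h2 : β < 1) : ∃ c : ℝ, ∀ t : ℝ, 1 ≤ t →
    |∑ m ∈ Finset.Icc 1 ⌊t⌋₊, (m:ℝ) ^ (-β) - t ^ (1-β) / (1-β) - c| ≤ 14 * t ^ (-(1/2) : ℝ) := by
  have hw : 1 - β ≠ 0 := by linarith
  have := em_lemma (fun u => u ^ (-β)) (fun u => u ^ (1-β) / (1-β)) (fun u => -β * u ^ (-β - 1)) 1
    zero_le_one (fun u hu => by
      have := (Real.hasDerivAt_rpow_const (x := u) (p := 1-β) (Or.inl (by linarith))).div_const (1-β)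
      refine this.congr_deriv ?_
      rw [show 1 - β - 1 = -β by ring]; field_simp)
    (fun u hu => Real.hasDerivAt_rpow_const (Or.inl (by linarith)))
    (fun u hu => by
      rw [abs_mul, abs_neg, abs_of_pos (by linarith : 0 < β), abs_of_nonneg (by positivity)]
      have := Real.rpow_le_rpow_of_exponent_le hu (by linarith : -β-1 ≤ -(3/2))
      have h3 : 0 ≤ u ^ (-β - 1) := by positivity
      nlinarith)
    (fun u hu => by
      rw [abs_of_nonneg (by positivity), one_mul]
      exact Real.rpow_le_rpow_of_exponent_le hu (by linarith))
  simpa using this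

lemma log_le_four {u : ℝ} (hu : 1 ≤ u) : Real.log u ≤ 4 * u ^ (1/4 : ℝ) := by
  have := Real.log_le_rpow_div (x := u) (ε := 1/4) (by linarith) (by norm_num)
  linarith

lemma em1 (β : ℝ) (h1 : 9/10 ≤ β) (h2 : β < 1) : ∃ c : ℝ, ∀ t : ℝ, 1 ≤ t →
    |∑ m ∈ Finset.Icc 1 ⌊t⌋₊, (m:ℝ) ^ (-β) * Real.log m
      - (t ^ (1-β) * Real.log t / (1-β) - t ^ (1-β) / (1-β) ^ 2) - c| ≤ 70 * t ^ (-(1/2) : ℝ) := by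
  have hw : 1 - β ≠ 0 := by linarith
  have hlog : ∀ u : ℝ, 1 ≤ u → Real.log u ≤ 4 * u ^ (1/4 : ℝ) := fun u hu => log_le_four hu
  have := em_lemma (fun u => u ^ (-β) * Real.log u)
    (fun u => u ^ (1-β) * Real.log u / (1-β) - u ^ (1-β) / (1-β) ^ 2)
    (fun u => (-β * u ^ (-β - 1)) * Real.log u + u ^ (-β) * u⁻¹) 5
    (by norm_num) (fun u hu => by
      have h3 := (Real.hasDerivAt_rpow_const (x := u) (p := 1-β) (Or.inl (by linarith)))
      have := ((h3.mul (Real.hasDerivAt_log (by linarith : u ≠ 0))).div_const (1-β)).sub (h3.div_const ((1-β)^2))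
      refine HasDerivAt.congr_deriv (f' := _) this ?_
      have hu0 : u ≠ 0 := by linarith
      have e : u ^ (1-β) * u⁻¹ = u ^ (-β) := by
        rw [show 1 - β = -β + 1 by ring, Real.rpow_add (by linarith), Real.rpow_one]; field_simp
      rw [e, show 1 - β - 1 = -β by ring]; field_simp; ring)
    (fun u hu => (Real.hasDerivAt_rpow_const (Or.inl (by linarith))).mul (Real.hasDerivAt_log (by linarith)))
    (fun u hu => by
      have hu0 : 0 < u := by linarith
      have hl0 := Real.log_nonneg hu
      have e : u ^ (-β) * u⁻¹ = u ^ (-β-1) := by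
        rw [Real.rpow_sub hu0, Real.rpow_one]; rfl
      rw [e]
      have h4 : u ^ (-β-1) ≤ u ^ (-(3/2):ℝ) := Real.rpow_le_rpow_of_exponent_le hu (by linarith)
      have h5 : u ^ (-β-1) * Real.log u ≤ 4 * u ^ (-(3/2):ℝ) := by
        calc u ^ (-β-1) * Real.log u ≤ u ^ (-β-1) * (4 * u ^ (1/4:ℝ)) := by gcongr; exact hlog u hu
          _ = 4 * u ^ (-β-1+1/4) := by rw [Real.rpow_add hu0]; ring
          _ ≤ _ := by gcongr; linarith
      have h6 : 0 ≤ u ^ (-β-1) * Real.log u := by positivity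
      have h7 : 0 ≤ u ^ (-β-1) := by positivity
      have h8 : 0 ≤ u ^ (-(3/2):ℝ) := by positivity
      rw [abs_le]; constructor <;> nlinarith)
    (fun u hu => by
      have hu0 : 0 < u := by linarith
      have hl0 := Real.log_nonneg hu
      rw [abs_of_nonneg (by positivity)]
      calc u ^ (-β) * Real.log u ≤ u ^ (-β) * (4 * u ^ (1/4:ℝ)) := by gcongr; exact hlog u hu
          _ = 4 * u ^ (-β+1/4) := by rw [Real.rpow_add hu0]; ring
          _ ≤ 5 * u ^ (-(1/2):ℝ) := by gcongr; norm_num; linarith)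
  convert this using 6
  norm_num

lemma second_part (χ h : ℕ → ℝ) (q β H : ℝ) (X Y : ℕ) (hY : 1 ≤ Y) (h1 : 9/10 ≤ β) (h2 : β < 1)
    (hsum : ∀ a b, |∑ i ∈ Finset.Ico a b, χ i| ≤ q)
    (hanti : ∀ a b, 1 ≤ a → a ≤ b → b ≤ X → h b ≤ h a) (h0 : ∀ a, 1 ≤ a → a ≤ X → 0 ≤ h a)
    (hH : ∀ a : ℕ, 1 ≤ a → a ≤ X → h a ≤ H * (a:ℝ) ^ (-β)) (hH0 : 0 ≤ H)
    (hX : (X:ℝ) ^ (1-β) ≤ 2) :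
    |∑ m ∈ Finset.Icc 1 X, ∑ d ∈ Finset.Ico (Y+1) (X / m + 1), χ d * h (d * m)| ≤
      2 * q * H * (Y:ℝ) ^ (-(3/4):ℝ) * (1 + Real.log X) := by
  have hq : 0 ≤ q := (abs_nonneg _).trans (hsum 0 0)
  have hY1 : (1:ℝ) ≤ Y := by exact_mod_cast hY
  have key : ∀ m ∈ Finset.Icc 1 X, |∑ d ∈ Finset.Ico (Y+1) (X / m + 1), χ d * h (d * m)| ≤
      2 * q * H * (Y:ℝ) ^ (-(3/4):ℝ) * (m:ℝ)⁻¹ := by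
    intro m hm
    obtain ⟨hm1, hm2⟩ := Finset.mem_Icc.mp hm
    have hm0 : (0:ℝ) < m := by exact_mod_cast hm1
    rcases le_or_gt (X / m + 1) (Y + 1) with hle | hlt
    · rw [Finset.Ico_eq_empty (by omega)]; simp; positivity
    · have hle : ∀ d, d < X / m + 1 → d * m ≤ X := fun d hd =>
        (Nat.le_div_iff_mul_le hm1).mp (by omega)
      have := abel_bound χ (fun d => h (d * m)) q (Y+1) (X / m + 1) (fun j => hsum _ _)
        (fun i hi hi2 => hanti _ _ (Nat.mul_pos (by omega) hm1) (Nat.mul_le_mul_right _ (by omega)) (hle _ hi2))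
        (fun i hi hi2 => h0 _ (Nat.mul_pos (by omega) hm1) (hle _ hi2))
        (h0 _ (Nat.mul_pos (by omega) hm1) (hle _ hlt))
      refine this.trans ?_
      have h3 := hH ((Y+1)*m) (Nat.mul_pos (by omega) hm1) (hle _ hlt)
      have h4 : ((((Y+1)*m : ℕ)):ℝ) ^ (-β) ≤ (Y:ℝ) ^ (-(3/4):ℝ) * (2 * (m:ℝ)⁻¹) := by
        push_cast
        rw [Real.mul_rpow (by positivity) (by positivity)]
        have h5 : ((Y:ℝ)+1) ^ (-β) ≤ (Y:ℝ) ^ (-(3/4):ℝ) :=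
          (Real.rpow_le_rpow_of_nonpos (by linarith) (by linarith) (by linarith)).trans
            (Real.rpow_le_rpow_of_exponent_le hY1 (by linarith))
        have h6 : (m:ℝ) ^ (-β) ≤ 2 * (m:ℝ)⁻¹ := by
          rw [show -β = (1-β) + (-1) by ring, Real.rpow_add hm0, Real.rpow_neg_one]
          gcongr
          refine le_trans ?_ hX
          gcongr
        gcongr
      calc q * h ((Y+1)*m) ≤ q * (H * ((Y:ℝ) ^ (-(3/4):ℝ) * (2 * (m:ℝ)⁻¹))) := by
            gcongr; exact h3.trans (by gcongr)
        _ = _ := by ring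
  calc _ ≤ ∑ m ∈ Finset.Icc 1 X, |∑ d ∈ Finset.Ico (Y+1) (X / m + 1), χ d * h (d * m)| :=
        Finset.abs_sum_le_sum_abs _ _
    _ ≤ ∑ m ∈ Finset.Icc 1 X, 2 * q * H * (Y:ℝ) ^ (-(3/4):ℝ) * (m:ℝ)⁻¹ := Finset.sum_le_sum key
    _ = 2 * q * H * (Y:ℝ) ^ (-(3/4):ℝ) * ∑ m ∈ Finset.Icc 1 X, (m:ℝ)⁻¹ := by rw [Finset.mul_sum]
    _ ≤ _ := by
      gcongr
      have := harmonic_le_one_add_log X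
      rw [harmonic_eq_sum_Icc] at this
      push_cast at this
      exact this

lemma tail_limit (χ g : ℕ → ℝ) (q : ℕ) (hq : 1 ≤ q) (D : ℝ) (Y : ℕ)
    (hsum : ∀ a b, |∑ i ∈ Finset.Ico a b, χ i| ≤ q) (hg00 : χ 0 * g 0 = 0)
    (hg : ∀ i, Y + 1 ≤ i → g (i+1) ≤ g i) (hg0 : ∀ i, Y + 1 ≤ i → 0 ≤ g i)
    (hlim : Filter.Tendsto (fun N : ℕ => ∑ n ∈ Finset.range (q * N), χ n * g n) Filter.atTop (nhds D)) :
    |∑ d ∈ Finset.Icc 1 Y, χ d * g d - D| ≤ q * g (Y+1) := by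
  rw [abs_sub_comm]
  refine le_of_tendsto (hlim.sub_const _).abs ?_
  filter_upwards [Filter.eventually_ge_atTop (Y+1)] with N hN
  have h1 : Y + 1 ≤ q * N := hN.trans (Nat.le_mul_of_pos_left _ hq)
  have e : ∑ n ∈ Finset.range (q * N), χ n * g n = ∑ d ∈ Finset.Icc 1 Y, χ d * g d
      + ∑ n ∈ Finset.Ico (Y+1) (q*N), χ n * g n := by
    rw [Finset.range_eq_Ico, ← Finset.sum_Ico_consecutive _ (Nat.zero_le (Y+1)) h1]
    congr 1
    rw [Finset.sum_eq_sum_Ico_succ_bot (by omega), hg00, zero_add]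
    rfl
  rw [e, add_sub_cancel_left]
  exact abel_bound χ g q (Y+1) (q*N) (fun j => hsum _ _) (fun i hi _ => hg i hi)
    (fun i hi _ => hg0 i hi) (hg0 _ le_rfl)

lemma se_final (w δ Λ M S T c c1 Lb DY D : ℝ) (hw0 : 0 < w) (hw : 14 * w ≤ 1/4) (hδ0 : 0 ≤ δ) (hΛ1 : 1 ≤ Λ)
    (hwl : w * (Λ - 1) ≤ 1/4) (hε : 1000 * (δ * Λ^2) ≤ w^2)
    (hS : |S - (M + c * Lb)| ≤ 16 * δ * Λ)
    (hT : |T - (M / w + c * (Λ - 1) * Lb - c * DY - c1 * Lb)| ≤ 86 * δ * Λ^2)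
    (hTS : T ≤ (Λ - 1) * S) (hS1 : 1 ≤ S) (hc : |c| ≤ 2 / w) (hc1 : |c1| ≤ 2 / w^2)
    (hLb : |Lb| ≤ δ) (hDY : |DY - D| ≤ δ * Λ) : S ≤ 16 * |D| := by
  set ε := δ * Λ^2 with hεd
  have hδΛ : δ * Λ ≤ ε := by rw [hεd]; nlinarith [mul_nonneg hδ0 (by linarith : 0 ≤ Λ)]
  have hδε : δ ≤ δ * Λ := by nlinarith
  have hε0 : 0 ≤ ε := by positivity
  have hεw : ε / w ≤ w / 1000 := by rw [div_le_iff₀ hw0]; nlinarith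
  have hεw2 : ε / w^2 ≤ 1 / 1000 := by rw [div_le_iff₀ (by positivity)]; linarith
  have hεs : ε ≤ 1/1000 := by nlinarith
  have a1 : |c * Lb| ≤ 2 * (ε / w) := by
    rw [abs_mul]
    calc |c| * |Lb| ≤ (2 / w) * ε := mul_le_mul hc (by linarith) (abs_nonneg _) (by positivity)
      _ = _ := by ring
  have a2 : |c * (Λ - 1) * Lb| ≤ 2 * (ε / w) := by
    rw [abs_mul, abs_mul, abs_of_nonneg (by linarith : 0 ≤ Λ - 1), mul_assoc]
    have : (Λ - 1) * |Lb| ≤ ε := by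
      calc (Λ - 1) * |Lb| ≤ Λ * δ := mul_le_mul (by linarith) hLb (abs_nonneg _) (by linarith)
        _ ≤ ε := by linarith
    calc |c| * ((Λ-1)* |Lb|) ≤ (2 / w) * ε := mul_le_mul hc this (mul_nonneg (by linarith) (abs_nonneg _)) (by positivity)
      _ = _ := by ring
  have a3 : |c * (DY - D)| ≤ 2 * (ε / w) := by
    rw [abs_mul]
    calc |c| * |DY - D| ≤ (2 / w) * ε := mul_le_mul hc (by linarith) (abs_nonneg _) (by positivity)
      _ = _ := by ring
  have a4 : |c1 * Lb| ≤ 2 * (ε / w^2) := by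
    rw [abs_mul]
    calc |c1| * |Lb| ≤ (2 / w^2) * ε := mul_le_mul hc1 (by linarith) (abs_nonneg _) (by positivity)
      _ = _ := by ring
  have a5 : c * D ≤ 2 / w * |D| := by
    refine (le_abs_self _).trans ?_
    rw [abs_mul]; exact mul_le_mul_of_nonneg_right hc (abs_nonneg _)
  rw [abs_le] at hS hT a1 a2 a3 a4
  have b1 : S ≤ M + 1/50 := by nlinarith
  have b2 : c * DY = c * (DY - D) + c * D := by ring
  have b4 : M / w - 1/8 ≤ (Λ - 1) * S + 2 / w * |D| := by nlinarith
  have b5 : w * (M / w - 1/8) ≤ w * ((Λ - 1) * S + 2 / w * |D|) := mul_le_mul_of_nonneg_left b4 hw0.le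
  have b6 : w * (M / w - 1/8) = M - w/8 := by field_simp
  have b7 : w * ((Λ - 1) * S + 2 / w * |D|) = w * (Λ - 1) * S + 2 * |D| := by field_simp
  rw [b6, b7] at b5
  nlinarith [mul_le_mul_of_nonneg_right hwl (by linarith : 0 ≤ S)]

set_option maxHeartbeats 1000000 in
lemma se_S (χ : ℕ → ℝ) (q : ℕ) (hq : 1 ≤ q) (β c c1 : ℝ) (X Y : ℕ) (hY : 8 ≤ Y) (hX : X = Y^4)
    (h1 : 9/10 ≤ β) (h2 : β < 1) (hχ : ∀ n, |χ n| ≤ 1)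
    (hsum : ∀ a b, |∑ i ∈ Finset.Ico a b, χ i| ≤ q) (w : ℝ) (hwdef : w = 1 - β)
    (hc : ∀ t : ℝ, 1 ≤ t → |∑ m ∈ Finset.Icc 1 ⌊t⌋₊, (m:ℝ) ^ (-β) - t ^ w / w - c| ≤ 14 * t ^ (-(1/2) : ℝ))
    (hc1 : ∀ t : ℝ, 1 ≤ t → |∑ m ∈ Finset.Icc 1 ⌊t⌋₊, (m:ℝ) ^ (-β) * Real.log m
      - (t ^ w * Real.log t / w - t ^ w / w ^ 2) - c1| ≤ 70 * t ^ (-(1/2) : ℝ))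
    (hXw : (X:ℝ) ^ w ≤ 2) :
    |(∑ n ∈ Finset.Icc 1 X, (∑ d ∈ n.divisors, χ d) * (n:ℝ) ^ (-β)) - (X ^ w * (∑ d ∈ Finset.Icc 1 Y, χ d * (d:ℝ)⁻¹) / w + c * (∑ d ∈ Finset.Icc 1 Y, χ d * (d:ℝ) ^ (-β)))| ≤ 16 * (q * (Y:ℝ) ^ (-(3/4):ℝ)) * (1 + Real.log X) := by
  have hw0 : 0 < w := by linarith
  have hY1 : (1:ℝ) ≤ Y := by exact_mod_cast (by omega : 1 ≤ Y)
  have hY0 : (0:ℝ) < Y := by linarith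
  have hXr : (X:ℝ) = (Y:ℝ)^4 := by rw [hX]; push_cast; rfl
  set Λ := 1 + Real.log X with hΛ
  have hX1 : (1:ℝ) ≤ X := by rw [hXr]; exact one_le_pow₀ hY1
  have hX0 : (0:ℝ) < X := by linarith
  have hlX : 0 ≤ Real.log X := Real.log_nonneg hX1
  have hΛ1 : 1 ≤ Λ := by linarith
  set δ := q * (Y:ℝ) ^ (-(3/4):ℝ) with hδ
  have hδ0 : 0 ≤ δ := by positivity
  have hYX : Y ≤ X := by rw [hX]; exact Nat.le_self_pow (by norm_num) Y
  set ℓ := ∑ d ∈ Finset.Icc 1 Y, χ d * (d:ℝ)⁻¹ with hℓ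
  set Lb := ∑ d ∈ Finset.Icc 1 Y, χ d * (d:ℝ) ^ (-β) with hLb
  set DY := ∑ d ∈ Finset.Icc 1 Y, χ d * ((d:ℝ) ^ (-β) * Real.log d) with hDYd
  -- error helper
  have herr : ∀ (e : ℕ → ℝ) (K : ℝ), 0 ≤ K → (∀ d ∈ Finset.Icc 1 Y, |e d| ≤ K * ((X:ℝ)/d) ^ (-(1/2):ℝ)) →
      |∑ d ∈ Finset.Icc 1 Y, χ d * ((d:ℝ) ^ (-β) * e d)| ≤ K * δ := by
    intro e K hK he
    have hb : ∀ d ∈ Finset.Icc 1 Y, |χ d * ((d:ℝ) ^ (-β) * e d)| ≤ K * (Y:ℝ) ^ (-2:ℝ) := by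
      intro d hd
      obtain ⟨hd1, hd2⟩ := Finset.mem_Icc.mp hd
      have hd1' : (1:ℝ) ≤ d := by exact_mod_cast hd1
      rw [abs_mul, abs_mul, abs_of_nonneg (by positivity : 0 ≤ (d:ℝ) ^ (-β))]
      calc |χ d| * ((d:ℝ) ^ (-β) * |e d|) ≤ 1 * ((d:ℝ) ^ (-(1/2):ℝ) * (K * ((X:ℝ)/d) ^ (-(1/2):ℝ))) := by
            gcongr
            · exact hχ d
            · linarith
            · exact he d hd
        _ = K * ((d:ℝ) * (X/d)) ^ (-(1/2):ℝ) := by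
            rw [Real.mul_rpow (by positivity) (by positivity)]; ring
        _ = K * (Y:ℝ) ^ (-2:ℝ) := by
            rw [mul_div_cancel₀ _ (by linarith : (d:ℝ) ≠ 0), hXr, ← Real.rpow_natCast (Y:ℝ) 4, ← Real.rpow_mul hY0.le]
            norm_num
    calc _ ≤ ∑ d ∈ Finset.Icc 1 Y, |χ d * ((d:ℝ) ^ (-β) * e d)| := Finset.abs_sum_le_sum_abs _ _
      _ ≤ ∑ d ∈ Finset.Icc 1 Y, K * (Y:ℝ) ^ (-2:ℝ) := Finset.sum_le_sum hb
      _ = K * (Y:ℝ) ^ (-1:ℝ) := by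
        rw [Finset.sum_const, Nat.card_Icc, nsmul_eq_mul, Nat.add_sub_cancel, show (-1:ℝ) = 1 + -2 by norm_num, Real.rpow_add hY0, Real.rpow_one]
        ring
      _ ≤ K * δ := by
        have hq1 : (1:ℝ) ≤ q := by exact_mod_cast hq
        have : (Y:ℝ) ^ (-1:ℝ) ≤ (Y:ℝ) ^ (-(3/4):ℝ) := Real.rpow_le_rpow_of_exponent_le hY1 (by norm_num)
        have h3 : 0 ≤ (Y:ℝ) ^ (-(3/4):ℝ) := by positivity
        refine mul_le_mul_of_nonneg_left ?_ hK
        nlinarith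
  have hfl : ∀ d : ℕ, ⌊(X:ℝ)/d⌋₊ = X / d := fun d => by
    rw [Nat.floor_div_natCast, Nat.floor_natCast]
  have ht1 : ∀ d ∈ Finset.Icc 1 Y, 1 ≤ (X:ℝ)/d := by
    intro d hd
    obtain ⟨hd1, hd2⟩ := Finset.mem_Icc.mp hd
    rw [le_div_iff₀ (by exact_mod_cast hd1), one_mul]
    exact_mod_cast hd2.trans hYX
  have hpw : ∀ d ∈ Finset.Icc 1 Y, (d:ℝ) ^ (-β) * ((X:ℝ)/d) ^ w = X ^ w * (d:ℝ)⁻¹ := by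
    intro d hd
    have hd0 : (0:ℝ) < d := by exact_mod_cast (Finset.mem_Icc.mp hd).1
    rw [Real.div_rpow hX0.le hd0.le, show -β = w + -1 by rw [hwdef]; ring, Real.rpow_add hd0, Real.rpow_neg_one]
    have := (Real.rpow_pos_of_pos hd0 w).ne'
    field_simp
  -- S
  set S := ∑ n ∈ Finset.Icc 1 X, (∑ d ∈ n.divisors, χ d) * (n:ℝ) ^ (-β) with hS
  set e0 : ℕ → ℝ := fun d => ∑ m ∈ Finset.Icc 1 (X/d), (m:ℝ) ^ (-β) - ((X:ℝ)/d) ^ w / w - c with he0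
  set e1 : ℕ → ℝ := fun d => ∑ m ∈ Finset.Icc 1 (X/d), (m:ℝ) ^ (-β) * Real.log m
      - (((X:ℝ)/d) ^ w * Real.log ((X:ℝ)/d) / w - ((X:ℝ)/d) ^ w / w ^ 2) - c1 with he1
  have he0b : ∀ d ∈ Finset.Icc 1 Y, |e0 d| ≤ 14 * ((X:ℝ)/d) ^ (-(1/2):ℝ) := by
    intro d hd
    have := hc _ (ht1 d hd)
    rwa [hfl] at this
  have he1b : ∀ d ∈ Finset.Icc 1 Y, |e1 d| ≤ 70 * ((X:ℝ)/d) ^ (-(1/2):ℝ) := by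
    intro d hd
    have := hc1 _ (ht1 d hd)
    rwa [hfl] at this
  have hh := hyperbola χ (fun n => (n:ℝ) ^ (-β)) X Y hYX
  have h2nd := second_part χ (fun n => (n:ℝ) ^ (-β)) q β 1 X Y (by omega) h1 h2 hsum
    (fun a b ha hab _ => Real.rpow_le_rpow_of_nonpos (by exact_mod_cast ha) (by exact_mod_cast hab) (by linarith))
    (fun a _ _ => by positivity) (fun a _ _ => by simp) zero_le_one (hwdef ▸ hXw)
  have hfirst : ∑ d ∈ Finset.Icc 1 Y, χ d * ∑ m ∈ Finset.Icc 1 (X / d), ((d * m : ℕ):ℝ) ^ (-β)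
      = X ^ w * ℓ / w + c * Lb + ∑ d ∈ Finset.Icc 1 Y, χ d * ((d:ℝ) ^ (-β) * e0 d) := by
    rw [hℓ, hLb, Finset.mul_sum, Finset.sum_div, Finset.mul_sum, ← Finset.sum_add_distrib, ← Finset.sum_add_distrib]
    refine Finset.sum_congr rfl fun d hd => ?_
    have : ∑ m ∈ Finset.Icc 1 (X / d), ((d * m : ℕ):ℝ) ^ (-β) = (d:ℝ) ^ (-β) * ∑ m ∈ Finset.Icc 1 (X / d), (m:ℝ) ^ (-β) := by
      rw [Finset.mul_sum]
      refine Finset.sum_congr rfl fun m _ => ?_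
      rw [Nat.cast_mul, Real.mul_rpow (by positivity) (by positivity)]
    rw [this, he0]
    simp only
    linear_combination (χ d / w) * (hpw d hd)
  have h3 := herr e0 14 (by norm_num) he0b
  rw [hS, hh, hfirst]
  have : ∀ a b z : ℝ, a + b + z - a = b + z := fun a b z => by ring
  rw [this]
  refine (abs_add_le _ _).trans ?_
  have h4 : 14 * δ ≤ 14 * δ * Λ := by nlinarith
  have h5 : 2 * (q:ℝ) * 1 * (Y:ℝ) ^ (-(3/4):ℝ) * Λ = 2 * δ * Λ := by rw [hδ]; ring
  rw [h5] at h2nd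
  linarith

set_option maxHeartbeats 1000000 in
lemma se_T (χ : ℕ → ℝ) (q : ℕ) (hq : 1 ≤ q) (β c c1 : ℝ) (X Y : ℕ) (hY : 8 ≤ Y) (hX : X = Y^4)
    (h1 : 9/10 ≤ β) (h2 : β < 1) (hχ : ∀ n, |χ n| ≤ 1)
    (hsum : ∀ a b, |∑ i ∈ Finset.Ico a b, χ i| ≤ q) (w : ℝ) (hwdef : w = 1 - β)
    (hc : ∀ t : ℝ, 1 ≤ t → |∑ m ∈ Finset.Icc 1 ⌊t⌋₊, (m:ℝ) ^ (-β) - t ^ w / w - c| ≤ 14 * t ^ (-(1/2) : ℝ))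
    (hc1 : ∀ t : ℝ, 1 ≤ t → |∑ m ∈ Finset.Icc 1 ⌊t⌋₊, (m:ℝ) ^ (-β) * Real.log m
      - (t ^ w * Real.log t / w - t ^ w / w ^ 2) - c1| ≤ 70 * t ^ (-(1/2) : ℝ))
    (hXw : (X:ℝ) ^ w ≤ 2) :
    |(∑ n ∈ Finset.Icc 1 X, (∑ d ∈ n.divisors, χ d) * ((n:ℝ) ^ (-β) * (Real.log X - Real.log n))) - (X ^ w * (∑ d ∈ Finset.Icc 1 Y, χ d * (d:ℝ)⁻¹) / w^2 + c * Real.log X * (∑ d ∈ Finset.Icc 1 Y, χ d * (d:ℝ) ^ (-β)) - c * (∑ d ∈ Finset.Icc 1 Y, χ d * ((d:ℝ) ^ (-β) * Real.log d)) - c1 * (∑ d ∈ Finset.Icc 1 Y, χ d * (d:ℝ) ^ (-β)))| ≤ 86 * (q * (Y:ℝ) ^ (-(3/4):ℝ)) * (1 + Real.log X)^2 := by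
  have hw0 : 0 < w := by linarith
  have hY1 : (1:ℝ) ≤ Y := by exact_mod_cast (by omega : 1 ≤ Y)
  have hY0 : (0:ℝ) < Y := by linarith
  have hXr : (X:ℝ) = (Y:ℝ)^4 := by rw [hX]; push_cast; rfl
  set Λ := 1 + Real.log X with hΛ
  have hX1 : (1:ℝ) ≤ X := by rw [hXr]; exact one_le_pow₀ hY1
  have hX0 : (0:ℝ) < X := by linarith
  have hlX : 0 ≤ Real.log X := Real.log_nonneg hX1
  have hΛ1 : 1 ≤ Λ := by linarith
  set δ := q * (Y:ℝ) ^ (-(3/4):ℝ) with hδ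
  have hδ0 : 0 ≤ δ := by positivity
  have hYX : Y ≤ X := by rw [hX]; exact Nat.le_self_pow (by norm_num) Y
  set ℓ := ∑ d ∈ Finset.Icc 1 Y, χ d * (d:ℝ)⁻¹ with hℓ
  set Lb := ∑ d ∈ Finset.Icc 1 Y, χ d * (d:ℝ) ^ (-β) with hLb
  set DY := ∑ d ∈ Finset.Icc 1 Y, χ d * ((d:ℝ) ^ (-β) * Real.log d) with hDYd
  -- error helper
  have herr : ∀ (e : ℕ → ℝ) (K : ℝ), 0 ≤ K → (∀ d ∈ Finset.Icc 1 Y, |e d| ≤ K * ((X:ℝ)/d) ^ (-(1/2):ℝ)) →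
      |∑ d ∈ Finset.Icc 1 Y, χ d * ((d:ℝ) ^ (-β) * e d)| ≤ K * δ := by
    intro e K hK he
    have hb : ∀ d ∈ Finset.Icc 1 Y, |χ d * ((d:ℝ) ^ (-β) * e d)| ≤ K * (Y:ℝ) ^ (-2:ℝ) := by
      intro d hd
      obtain ⟨hd1, hd2⟩ := Finset.mem_Icc.mp hd
      have hd1' : (1:ℝ) ≤ d := by exact_mod_cast hd1
      rw [abs_mul, abs_mul, abs_of_nonneg (by positivity : 0 ≤ (d:ℝ) ^ (-β))]
      calc |χ d| * ((d:ℝ) ^ (-β) * |e d|) ≤ 1 * ((d:ℝ) ^ (-(1/2):ℝ) * (K * ((X:ℝ)/d) ^ (-(1/2):ℝ))) := by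
            gcongr
            · exact hχ d
            · linarith
            · exact he d hd
        _ = K * ((d:ℝ) * (X/d)) ^ (-(1/2):ℝ) := by
            rw [Real.mul_rpow (by positivity) (by positivity)]; ring
        _ = K * (Y:ℝ) ^ (-2:ℝ) := by
            rw [mul_div_cancel₀ _ (by linarith : (d:ℝ) ≠ 0), hXr, ← Real.rpow_natCast (Y:ℝ) 4, ← Real.rpow_mul hY0.le]
            norm_num
    calc _ ≤ ∑ d ∈ Finset.Icc 1 Y, |χ d * ((d:ℝ) ^ (-β) * e d)| := Finset.abs_sum_le_sum_abs _ _
      _ ≤ ∑ d ∈ Finset.Icc 1 Y, K * (Y:ℝ) ^ (-2:ℝ) := Finset.sum_le_sum hb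
      _ = K * (Y:ℝ) ^ (-1:ℝ) := by
        rw [Finset.sum_const, Nat.card_Icc, nsmul_eq_mul, Nat.add_sub_cancel, show (-1:ℝ) = 1 + -2 by norm_num, Real.rpow_add hY0, Real.rpow_one]
        ring
      _ ≤ K * δ := by
        have hq1 : (1:ℝ) ≤ q := by exact_mod_cast hq
        have : (Y:ℝ) ^ (-1:ℝ) ≤ (Y:ℝ) ^ (-(3/4):ℝ) := Real.rpow_le_rpow_of_exponent_le hY1 (by norm_num)
        have h3 : 0 ≤ (Y:ℝ) ^ (-(3/4):ℝ) := by positivity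
        refine mul_le_mul_of_nonneg_left ?_ hK
        nlinarith
  have hfl : ∀ d : ℕ, ⌊(X:ℝ)/d⌋₊ = X / d := fun d => by
    rw [Nat.floor_div_natCast, Nat.floor_natCast]
  have ht1 : ∀ d ∈ Finset.Icc 1 Y, 1 ≤ (X:ℝ)/d := by
    intro d hd
    obtain ⟨hd1, hd2⟩ := Finset.mem_Icc.mp hd
    rw [le_div_iff₀ (by exact_mod_cast hd1), one_mul]
    exact_mod_cast hd2.trans hYX
  have hpw : ∀ d ∈ Finset.Icc 1 Y, (d:ℝ) ^ (-β) * ((X:ℝ)/d) ^ w = X ^ w * (d:ℝ)⁻¹ := by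
    intro d hd
    have hd0 : (0:ℝ) < d := by exact_mod_cast (Finset.mem_Icc.mp hd).1
    rw [Real.div_rpow hX0.le hd0.le, show -β = w + -1 by rw [hwdef]; ring, Real.rpow_add hd0, Real.rpow_neg_one]
    have := (Real.rpow_pos_of_pos hd0 w).ne'
    field_simp
  -- S
  set S := ∑ n ∈ Finset.Icc 1 X, (∑ d ∈ n.divisors, χ d) * (n:ℝ) ^ (-β) with hS
  set e0 : ℕ → ℝ := fun d => ∑ m ∈ Finset.Icc 1 (X/d), (m:ℝ) ^ (-β) - ((X:ℝ)/d) ^ w / w - c with he0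
  set e1 : ℕ → ℝ := fun d => ∑ m ∈ Finset.Icc 1 (X/d), (m:ℝ) ^ (-β) * Real.log m
      - (((X:ℝ)/d) ^ w * Real.log ((X:ℝ)/d) / w - ((X:ℝ)/d) ^ w / w ^ 2) - c1 with he1
  have he0b : ∀ d ∈ Finset.Icc 1 Y, |e0 d| ≤ 14 * ((X:ℝ)/d) ^ (-(1/2):ℝ) := by
    intro d hd
    have := hc _ (ht1 d hd)
    rwa [hfl] at this
  have he1b : ∀ d ∈ Finset.Icc 1 Y, |e1 d| ≤ 70 * ((X:ℝ)/d) ^ (-(1/2):ℝ) := by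
    intro d hd
    have := hc1 _ (ht1 d hd)
    rwa [hfl] at this
  -- T
  set T := ∑ n ∈ Finset.Icc 1 X, (∑ d ∈ n.divisors, χ d) * ((n:ℝ) ^ (-β) * (Real.log X - Real.log n)) with hT
  have hh := hyperbola χ (fun n => (n:ℝ) ^ (-β) * (Real.log X - Real.log n)) X Y hYX
  have hlogn : ∀ a : ℕ, 1 ≤ a → a ≤ X → 0 ≤ Real.log X - Real.log a := by
    intro a ha haX
    have := Real.log_le_log (by exact_mod_cast ha : (0:ℝ) < a) (by exact_mod_cast haX : (a:ℝ) ≤ X)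
    linarith
  have h2nd := second_part χ (fun n => (n:ℝ) ^ (-β) * (Real.log X - Real.log n)) q β Λ X Y (by omega) h1 h2 hsum
    (fun a b ha hab hb => by
      have h5 := Real.log_le_log (by exact_mod_cast ha : (0:ℝ) < a) (by exact_mod_cast hab : (a:ℝ) ≤ b)
      refine mul_le_mul (Real.rpow_le_rpow_of_nonpos (by exact_mod_cast ha) (by exact_mod_cast hab) (by linarith)) (by linarith) (hlogn b (by omega) hb) (by positivity))
    (fun a ha hb => mul_nonneg (by positivity) (hlogn a ha hb)) (fun a ha _ => by
      rw [mul_comm]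
      refine mul_le_mul_of_nonneg_right ?_ (by positivity)
      have := Real.log_natCast_nonneg a
      linarith) (by linarith) (hwdef ▸ hXw)
  have hfirst : ∑ d ∈ Finset.Icc 1 Y, χ d * ∑ m ∈ Finset.Icc 1 (X / d), (((d * m : ℕ):ℝ) ^ (-β) * (Real.log X - Real.log (d*m:ℕ)))
      = X ^ w * ℓ / w^2 + c * Real.log X * Lb - c * DY - c1 * Lb + ∑ d ∈ Finset.Icc 1 Y, χ d * ((d:ℝ) ^ (-β) * (Real.log (X/d) * e0 d - e1 d)) := by
    rw [hℓ, hLb, hDYd, Finset.mul_sum, Finset.sum_div, Finset.mul_sum, Finset.mul_sum, Finset.mul_sum, ← Finset.sum_add_distrib, ← Finset.sum_sub_distrib, ← Finset.sum_sub_distrib, ← Finset.sum_add_distrib]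
    refine Finset.sum_congr rfl fun d hd => ?_
    have hd0 : (0:ℝ) < d := by exact_mod_cast (Finset.mem_Icc.mp hd).1
    have hld : Real.log ((X:ℝ)/d) = Real.log X - Real.log d := Real.log_div hX0.ne' hd0.ne'
    have : ∑ m ∈ Finset.Icc 1 (X / d), (((d * m : ℕ):ℝ) ^ (-β) * (Real.log X - Real.log (d*m:ℕ))) = (d:ℝ) ^ (-β) * (Real.log ((X:ℝ)/d) * ∑ m ∈ Finset.Icc 1 (X / d), (m:ℝ) ^ (-β) - ∑ m ∈ Finset.Icc 1 (X / d), (m:ℝ) ^ (-β) * Real.log m) := by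
      rw [Finset.mul_sum, ← Finset.sum_sub_distrib, Finset.mul_sum]
      refine Finset.sum_congr rfl fun m hm => ?_
      have hm0 : (0:ℝ) < m := by exact_mod_cast (Finset.mem_Icc.mp hm).1
      rw [Nat.cast_mul, Real.mul_rpow (by positivity) (by positivity), Real.log_mul hd0.ne' hm0.ne', hld]
      ring
    rw [this, he0, he1]
    simp only
    rw [hld]
    linear_combination (χ d / w^2) * (hpw d hd)
  have h3 := herr (fun d => Real.log (X/d) * e0 d - e1 d) (84 * Λ) (by linarith) (fun d hd => by
    have h4 := he0b d hd
    have h5 := he1b d hd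
    have hd0 : (0:ℝ) < d := by exact_mod_cast (Finset.mem_Icc.mp hd).1
    have h6 : 0 ≤ Real.log (X/d) := Real.log_nonneg (ht1 d hd)
    have h7 : Real.log (X/d) ≤ Λ := by
      rw [Real.log_div hX0.ne' hd0.ne']; have := Real.log_natCast_nonneg d; linarith
    have h8 : 0 ≤ ((X:ℝ)/d) ^ (-(1/2):ℝ) := by positivity
    calc _ ≤ |Real.log (X/d) * e0 d| + |e1 d| := abs_sub _ _
      _ ≤ Λ * (14 * ((X:ℝ)/d) ^ (-(1/2):ℝ)) + Λ * (70 * ((X:ℝ)/d) ^ (-(1/2):ℝ)) := by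
        rw [abs_mul, abs_of_nonneg h6]
        refine add_le_add (mul_le_mul h7 h4 (abs_nonneg _) (by linarith)) (h5.trans ?_)
        nlinarith
      _ = _ := by ring)
  rw [hT, hh, hfirst]
  have : ∀ a b z : ℝ, a + b + z - a = b + z := fun a b z => by ring
  rw [this]
  refine (abs_add_le _ _).trans ?_
  have h4 : 84 * Λ * δ ≤ 84 * δ * Λ ^ 2 := by nlinarith [mul_nonneg hδ0 (by linarith : 0 ≤ Λ)]
  have h5 : 2 * (q:ℝ) * Λ * (Y:ℝ) ^ (-(3/4):ℝ) * Λ = 2 * δ * Λ^2 := by rw [hδ]; ring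
  rw [h5] at h2nd
  linarith

set_option maxHeartbeats 1000000 in
lemma siegel_elem (χ : ℕ → ℝ) (q : ℕ) (hq : 1 ≤ q) (β D : ℝ) (Y : ℕ) (hY : 8 ≤ Y)
    (h1 : 9/10 ≤ β) (h2 : β < 1) (hχ : ∀ n, |χ n| ≤ 1) (hχ1 : χ 1 = 1)
    (hsum : ∀ a b, |∑ i ∈ Finset.Ico a b, χ i| ≤ q)
    (hr : ∀ n : ℕ, 0 ≤ ∑ d ∈ n.divisors, χ d)
    (hL : Filter.Tendsto (fun N : ℕ => ∑ n ∈ Finset.range (q * N), χ n * (n:ℝ) ^ (-β)) Filter.atTop (nhds 0))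
    (hD : Filter.Tendsto (fun N : ℕ => ∑ n ∈ Finset.range (q * N), χ n * ((n:ℝ) ^ (-β) * Real.log n)) Filter.atTop (nhds D))
    (hw : 14 * (1 - β) ≤ 1 / 4)
    (hwl : (1 - β) * Real.log ((Y:ℝ)^4) ≤ 1/4)
    (hε : 1000 * (q * (Y:ℝ) ^ (-(3/4):ℝ) * (1 + Real.log ((Y:ℝ)^4)) ^ 2) ≤ (1-β)^2) :
    ∑ n ∈ Finset.Icc 1 (Y^4), (∑ d ∈ n.divisors, χ d) * (n:ℝ) ^ (-β) ≤ 16 * |D| := by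
  set w := 1 - β with hwdef
  have hw0 : 0 < w := by linarith
  have hY1 : (1:ℝ) ≤ Y := by exact_mod_cast (by omega : 1 ≤ Y)
  have hY0 : (0:ℝ) < Y := by linarith
  set X := Y ^ 4 with hX
  have hXr : (X:ℝ) = (Y:ℝ)^4 := by rw [hX]; push_cast; rfl
  rw [← hXr] at hwl hε
  set Λ := 1 + Real.log X with hΛ
  have hX1 : (1:ℝ) ≤ X := by rw [hXr]; exact one_le_pow₀ hY1
  have hX0 : (0:ℝ) < X := by linarith
  have hlX : 0 ≤ Real.log X := Real.log_nonneg hX1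
  have hΛ1 : 1 ≤ Λ := by linarith
  set δ := q * (Y:ℝ) ^ (-(3/4):ℝ) with hδ
  have hδ0 : 0 ≤ δ := by positivity
  have hYX : Y ≤ X := by rw [hX]; exact Nat.le_self_pow (by norm_num) Y
  have hXw : (X:ℝ) ^ w ≤ 2 := by
    rw [Real.rpow_def_of_pos hX0, mul_comm]
    calc Real.exp (w * Real.log X) ≤ Real.exp (Real.log 2) := by
          rw [Real.exp_le_exp]; linarith [Real.log_two_gt_d9]
      _ = 2 := Real.exp_log (by norm_num)
  have hYb : ((Y:ℝ)+1) ^ (-β) ≤ (Y:ℝ) ^ (-(3/4):ℝ) :=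
    (Real.rpow_le_rpow_of_nonpos (by linarith) (by linarith) (by linarith)).trans
      (Real.rpow_le_rpow_of_exponent_le hY1 (by linarith))
  -- tails
  have hLY : |∑ d ∈ Finset.Icc 1 Y, χ d * (d:ℝ) ^ (-β)| ≤ δ := by
    have := tail_limit χ (fun n => (n:ℝ) ^ (-β)) q hq 0 Y hsum
      (by simp [Real.zero_rpow (by linarith : -β ≠ 0)])
      (fun i hi => Real.rpow_le_rpow_of_nonpos (by exact_mod_cast (by omega)) (by push_cast; linarith) (by linarith))
      (fun i _ => by positivity) hL
    rw [sub_zero] at this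
    refine this.trans ?_
    push_cast
    exact mul_le_mul_of_nonneg_left hYb (by positivity)
  have hDY : |∑ d ∈ Finset.Icc 1 Y, χ d * ((d:ℝ) ^ (-β) * Real.log d) - D| ≤ δ * Λ := by
    have hge : ∀ i : ℕ, Y + 1 ≤ i → Real.exp (1/β) ≤ (i:ℝ) := by
      intro i hi
      have h3 : Real.exp (1/β) ≤ Real.exp 2 := by
        rw [Real.exp_le_exp, div_le_iff₀ (by linarith)]; linarith
      have h4 : Real.exp 2 ≤ 8 := by
        rw [show (2:ℝ) = 1 + 1 by norm_num, Real.exp_add]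
        nlinarith [Real.exp_one_lt_d9, Real.exp_pos 1]
      have h5 : (8:ℝ) ≤ i := by exact_mod_cast (by omega)
      linarith
    have := tail_limit χ (fun n => (n:ℝ) ^ (-β) * Real.log n) q hq D Y hsum
      (by simp)
      (fun i hi => by
        have h3 : Real.log ((i+1:ℕ):ℝ) / ((i+1:ℕ):ℝ) ^ β ≤ Real.log (i:ℝ) / (i:ℝ) ^ β :=
          Real.log_div_self_rpow_antitoneOn (by linarith : 0 < β) (Set.mem_Ici.mpr (by simpa using hge i hi))
          (Set.mem_Ici.mpr (by simpa using hge (i+1) (by omega))) (by push_cast; linarith)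
        rw [Real.rpow_neg (by positivity), Real.rpow_neg (by positivity), mul_comm, ← div_eq_mul_inv, mul_comm _ (Real.log _), ← div_eq_mul_inv]
        exact h3)
      (fun i hi => mul_nonneg (by positivity) (Real.log_natCast_nonneg _)) hD
    refine this.trans ?_
    push_cast
    rw [hδ, mul_assoc]
    refine mul_le_mul_of_nonneg_left ?_ (by positivity)
    refine mul_le_mul hYb ?_ (Real.log_nonneg (by linarith)) (by positivity)
    have : Real.log ((Y:ℝ)+1) ≤ Real.log X := by
      apply Real.log_le_log (by linarith)
      have : Y + 1 ≤ X := by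
        rw [hX]
        calc Y + 1 ≤ Y * 8 := by omega
          _ ≤ Y * Y^3 := Nat.mul_le_mul_left _ (hY.trans (Nat.le_self_pow (by norm_num) Y))
          _ = Y^4 := by ring
      exact_mod_cast this
    linarith
  obtain ⟨c, hc⟩ := em0 β h1 h2
  obtain ⟨c1, hc1⟩ := em1 β h1 h2
  rw [← hwdef] at hc hc1
  have hcb : |c| ≤ 2 / w := by
    have := hc 1 le_rfl
    simp only [Nat.floor_one, Finset.Icc_self, Finset.sum_singleton, Nat.cast_one, Real.one_rpow] at this
    rw [abs_le] at this ⊢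
    have h3 : 15 ≤ 1 / w := by rw [le_div_iff₀ hw0]; linarith
    have h4 : 2 / w = 2 * (1 / w) := by ring
    rw [h4]
    constructor <;> linarith
  have hc1b : |c1| ≤ 2 / w^2 := by
    have := hc1 1 le_rfl
    simp only [Nat.floor_one, Finset.Icc_self, Finset.sum_singleton, Nat.cast_one, Real.one_rpow, Real.log_one] at this
    rw [abs_le] at this ⊢
    have h3 : 70 ≤ 1 / w^2 := by rw [le_div_iff₀ (by positivity)]; nlinarith
    have h4 : 2 / w^2 = 2 * (1 / w^2) := by ring
    rw [h4]
    simp only [mul_zero, zero_div, zero_sub, mul_one] at this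
    constructor <;> linarith
  have hSest := se_S χ q hq β c c1 X Y hY rfl h1 h2 hχ hsum w hwdef hc hc1 hXw
  have hTest := se_T χ q hq β c c1 X Y hY rfl h1 h2 hχ hsum w hwdef hc hc1 hXw
  set S := ∑ n ∈ Finset.Icc 1 X, (∑ d ∈ n.divisors, χ d) * (n:ℝ) ^ (-β) with hS
  -- T
  set T := ∑ n ∈ Finset.Icc 1 X, (∑ d ∈ n.divisors, χ d) * ((n:ℝ) ^ (-β) * (Real.log X - Real.log n)) with hT
  have hTS : T ≤ Real.log X * S := by
    rw [hT, hS, Finset.mul_sum]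
    refine Finset.sum_le_sum fun n _ => ?_
    have h3 := hr n
    have h4 := Real.log_natCast_nonneg n
    have h5 : 0 ≤ (n:ℝ) ^ (-β) := by positivity
    nlinarith [mul_nonneg h3 h5, mul_nonneg (mul_nonneg h3 h5) h4]
  have hS1 : 1 ≤ S := by
    have := Finset.single_le_sum (f := fun n : ℕ => (∑ d ∈ n.divisors, χ d) * (n:ℝ) ^ (-β)) (s := Finset.Icc 1 X)
      (fun n _ => mul_nonneg (hr n) (by positivity)) (a := 1) (Finset.mem_Icc.mpr ⟨le_rfl, by omega⟩)
    simpa [hχ1] using this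
  refine se_final w δ Λ _ S T c c1 _ _ D hw0 hw hδ0 hΛ1 (by rw [hΛ, add_sub_cancel_left]; exact hwl) hε hSest ?_
    (by rw [hΛ, add_sub_cancel_left]; exact hTS) hS1 hcb hc1b hLY hDY
  rw [hΛ, add_sub_cancel_left, div_div, ← sq]
  exact hTest

lemma mertens_upper (n : ℕ) (hn : 1 ≤ n) :
    ∑ p ∈ Nat.primesLE n, Real.log p / p ≤ Real.log n + Real.log 4 := by
  have hn0 : (0:ℝ) < n := by exact_mod_cast hn
  have hdvd : ∏ p ∈ Nat.primesLE n, p ^ (n / p) ∣ n.factorial := by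
    refine Finset.prod_dvd_of_isRelPrime ?_ ?_
    · intro p hp q hq hpq
      have h1 := (Nat.mem_primesLE.mp hp).2
      have h2 := (Nat.mem_primesLE.mp hq).2
      exact Nat.coprime_iff_isRelPrime.mp (Nat.Coprime.pow _ _ ((Nat.coprime_primes h1 h2).mpr hpq))
    · intro p hp
      have h1 := (Nat.mem_primesLE.mp hp).2
      rw [h1.pow_dvd_factorial_iff (b := Nat.log p n + 1) (by omega)]
      have := Nat.mem_primesLE.mp hp
      calc n / p = n / p ^ 1 := by rw [pow_one]
        _ ≤ _ := Finset.single_le_sum (f := fun i => n / p ^ i) (fun _ _ => Nat.zero_le _)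
          (Finset.mem_Ico.mpr ⟨le_rfl, by have := Nat.log_pos h1.one_lt this.1; omega⟩)
  have h1 : ((∏ p ∈ Nat.primesLE n, p ^ (n / p) : ℕ):ℝ) ≤ (n:ℝ)^n := by
    exact_mod_cast (Nat.le_of_dvd (Nat.factorial_pos n) hdvd).trans (Nat.factorial_le_pow n)
  have hpos : ∀ p ∈ Nat.primesLE n, (0:ℝ) < p := fun p hp => by exact_mod_cast (Nat.mem_primesLE.mp hp).2.pos
  push_cast at h1
  have h2 := Real.log_le_log (Finset.prod_pos fun p hp => pow_pos (hpos p hp) _) h1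
  rw [Real.log_prod (fun p hp => (pow_pos (hpos p hp) _).ne'), Real.log_pow] at h2
  have h3 := Chebyshev.theta_le_log4_mul_x (x := n) hn0.le
  rw [Chebyshev.theta_eq_sum_primesLE_log] at h3
  have h4 : ∀ p ∈ Nat.primesLE n, n * (Real.log p / p) ≤ Real.log (p ^ (n/p)) + Real.log p := by
    intro p hp
    rw [Real.log_pow]
    have h5 : (n:ℝ) / p ≤ (n / p : ℕ) + 1 := by
      have := (Nat.lt_floor_add_one ((n:ℝ)/p)).le
      rwa [Nat.floor_div_natCast, Nat.floor_natCast] at this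
    have h6 : 0 ≤ Real.log p := Real.log_natCast_nonneg p
    calc n * (Real.log p / p) = n / p * Real.log p := by ring
      _ ≤ ((n / p : ℕ) + 1) * Real.log p := mul_le_mul_of_nonneg_right h5 h6
      _ = _ := by ring
  have h5 := Finset.sum_le_sum h4
  rw [← Finset.mul_sum, Finset.sum_add_distrib] at h5
  have : n * ∑ p ∈ Nat.primesLE n, Real.log p / p ≤ n * (Real.log n + Real.log 4) := by linarith
  exact le_of_mul_le_mul_left this hn0

/-- Euler product for `r = 1 * χ` over smooth numbers. -/
lemma r_euler (χ : ℕ →*₀ ℝ) (hχ : ∀ n, |χ n| ≤ 1) (s : ℝ) (hs : 0 < s) (N : ℕ) :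
    Summable (fun m : N.smoothNumbers ↦ (∑ d ∈ (m:ℕ).divisors, χ d) * ((m:ℕ):ℝ) ^ (-s)) ∧
      HasSum (fun m : N.smoothNumbers ↦ (∑ d ∈ (m:ℕ).divisors, χ d) * ((m:ℕ):ℝ) ^ (-s))
        (∏ p ∈ N.primesBelow, ((1 - (p:ℝ) ^ (-s))⁻¹ * (1 - χ p * (p:ℝ) ^ (-s))⁻¹)) := by
  have hx : ∀ {p : ℕ}, p.Prime → (p:ℝ) ^ (-s) < 1 ∧ 0 ≤ (p:ℝ) ^ (-s) := fun {p} hp =>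
    ⟨Real.rpow_lt_one_of_one_lt_of_neg (by exact_mod_cast hp.one_lt) (by linarith), by positivity⟩
  have hy : ∀ {p : ℕ}, p.Prime → |χ p * (p:ℝ) ^ (-s)| < 1 := fun {p} hp => by
    rw [abs_mul, abs_of_nonneg (hx hp).2]
    calc _ ≤ 1 * (p:ℝ) ^ (-s) := mul_le_mul_of_nonneg_right (hχ p) (hx hp).2
      _ < 1 := by rw [one_mul]; exact (hx hp).1
  set f : ℕ → ℝ := fun n => (∑ d ∈ n.divisors, χ d) * (n:ℝ) ^ (-s) with hf
  have hloc : ∀ p : ℕ, p.Prime → ∀ e : ℕ, f (p ^ e) = ∑ kl ∈ Finset.HasAntidiagonal.antidiagonal e,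
      ((p:ℝ) ^ (-s)) ^ kl.1 * (χ p * (p:ℝ) ^ (-s)) ^ kl.2 := by
    intro p hp e
    simp only [hf]
    rw [Nat.sum_divisors_prime_pow hp, Finset.sum_mul]
    rw [← Finset.Nat.sum_antidiagonal_eq_sum_range_succ (fun a _ => χ (p ^ a) * ((p^e:ℕ):ℝ) ^ (-s)), ← Finset.Nat.sum_antidiagonal_swap]
    refine Finset.sum_congr rfl fun kl hkl => ?_
    rw [Finset.HasAntidiagonal.mem_antidiagonal] at hkl
    simp only [Prod.fst_swap, map_pow]
    rw [← hkl, Nat.cast_pow, mul_pow, ← Real.rpow_natCast (p:ℝ), ← Real.rpow_mul (by positivity), mul_comm _ (-s), Real.rpow_mul (by positivity), Real.rpow_natCast, pow_add]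
    ring
  have hs1 : ∀ {p : ℕ}, p.Prime → Summable (fun n : ℕ => ‖((p:ℝ) ^ (-s)) ^ n‖) := fun {p} hp => by
    have := (summable_geometric_of_lt_one (hx hp).2 (hx hp).1).norm
    exact this
  have hs2 : ∀ {p : ℕ}, p.Prime → Summable (fun n : ℕ => ‖(χ p * (p:ℝ) ^ (-s)) ^ n‖) := fun {p} hp =>
    (summable_geometric_of_abs_lt_one (hy hp)).norm
  have h1 : f 1 = 1 := by simp [hf]
  have hmul : ∀ {m n : ℕ}, m.Coprime n → f (m * n) = f m * f n := by
    intro m n hmn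
    obtain ⟨g, hg⟩ : ∃ g : ArithmeticFunction ℝ, ∀ n, g n = χ n := ⟨⟨χ, map_zero χ⟩, fun _ => rfl⟩
    have h3 : ((ArithmeticFunction.zeta : ArithmeticFunction ℝ) * g).IsMultiplicative :=
      ArithmeticFunction.IsMultiplicative.mul ArithmeticFunction.isMultiplicative_zeta.natCast
        ⟨by rw [hg, map_one], fun {a b} _ => by rw [hg, hg, hg, map_mul]⟩
    have h4 := h3.2 hmn
    simp only [ArithmeticFunction.coe_zeta_mul_apply, hg] at h4
    simp only [hf]
    rw [h4, Nat.cast_mul, Real.mul_rpow (by positivity) (by positivity)]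
    ring
  have hsum : ∀ {p : ℕ}, p.Prime → Summable (fun n : ℕ ↦ ‖f (p ^ n)‖) := fun {p} hp => by
    have := summable_norm_sum_mul_antidiagonal_of_summable_norm (hs1 hp) (hs2 hp)
    refine this.congr fun n => ?_
    rw [hloc p hp n]
  have key := EulerProduct.summable_and_hasSum_smoothNumbers_prod_primesBelow_tsum h1 hmul hsum N
  refine ⟨key.2.summable, ?_⟩
  have hprod : ∏ p ∈ N.primesBelow, ((1 - (p:ℝ) ^ (-s))⁻¹ * (1 - χ p * (p:ℝ) ^ (-s))⁻¹) = ∏ p ∈ N.primesBelow, ∑' n : ℕ, f (p ^ n) := by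
    refine Finset.prod_congr rfl fun p hp => ?_
    have hp := Nat.prime_of_mem_primesBelow hp
    rw [← tsum_geometric_of_lt_one (hx hp).2 (hx hp).1, ← tsum_geometric_of_abs_lt_one (hy hp),
      tsum_mul_tsum_eq_tsum_sum_antidiagonal_of_summable_norm (hs1 hp) (hs2 hp)]
    exact tsum_congr fun n => (hloc p hp n).symm
  rw [hprod]
  exact key.2

lemma rankin_local (β σ : ℝ) (h1 : 9/10 ≤ β) (hσ : 0 ≤ σ) (hσ' : σ ≤ 1/10) (p : ℕ) (hp : p.Prime)
    (hpσ : σ * Real.log p ≤ 1) (hpβ : (1-β) * Real.log p ≤ 1) (x : ℝ) (hx : x = 0 ∨ x = 1 ∨ x = -1) :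
    (1 - (p:ℝ) ^ (-(β-σ)))⁻¹ * (1 - x * (p:ℝ) ^ (-(β-σ)))⁻¹ ≤
      Real.exp (45 * σ * (Real.log p / p)) * ((1 - (p:ℝ) ^ (-β))⁻¹ * (1 - x * (p:ℝ) ^ (-β))⁻¹) := by
  have hp2 : (2:ℝ) ≤ p := by exact_mod_cast hp.two_le
  have hp0 : (0:ℝ) < p := by linarith
  have hlp : 0 ≤ Real.log p := Real.log_natCast_nonneg p
  set u := (p:ℝ) ^ (-β) with hu
  set v := (p:ℝ) ^ (-(β-σ)) with hv
  have hu0 : 0 < u := by positivity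
  have hv0 : 0 < v := by positivity
  have huv : u ≤ v := Real.rpow_le_rpow_of_exponent_le (by linarith) (by linarith)
  have hv6 : v ≤ 3/5 := by
    calc v ≤ (p:ℝ) ^ (-(4/5):ℝ) := Real.rpow_le_rpow_of_exponent_le (by linarith) (by linarith)
      _ ≤ 2 ^ (-(4/5):ℝ) := Real.rpow_le_rpow_of_nonpos (by norm_num) hp2 (by norm_num)
      _ ≤ 3/5 := by
        rw [Real.rpow_neg (by norm_num), inv_le_comm₀ (by positivity) (by norm_num)]
        have : ((5/3:ℝ)^(5:ℝ)) ^ (1/5:ℝ) ≤ ((2:ℝ)^(4:ℝ)) ^ (1/5:ℝ) :=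
          Real.rpow_le_rpow (by positivity) (by norm_num) (by norm_num)
        rw [← Real.rpow_mul (by norm_num), ← Real.rpow_mul (by norm_num)] at this
        norm_num at this ⊢
        exact this
  have hd : v - u ≤ 9 * σ * (Real.log p / p) := by
    have e1 : v = u * (p:ℝ) ^ σ := by rw [hv, hu, ← Real.rpow_add hp0]; ring_nf
    have e2 : (p:ℝ) ^ σ - 1 ≤ σ * Real.log p * 3 := by
      have h3 : (p:ℝ)^σ = Real.exp (σ * Real.log p) := by rw [Real.rpow_def_of_pos hp0, mul_comm]
      have h4 := Real.add_one_le_exp (-(σ * Real.log p))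
      rw [Real.exp_neg] at h4
      have h5 : Real.exp (σ * Real.log p) ≤ 3 := by
        have := Real.exp_le_exp.mpr hpσ
        linarith [Real.exp_one_lt_d9]
      have h6 := Real.exp_pos (σ * Real.log p)
      have h7 : Real.exp (σ * Real.log p) - 1 ≤ (σ * Real.log p) * Real.exp (σ * Real.log p) := by
        have := mul_le_mul_of_nonneg_left h4 h6.le
        rw [mul_inv_cancel₀ h6.ne'] at this
        linarith
      rw [h3]
      exact h7.trans (mul_le_mul_of_nonneg_left h5 (by positivity))
    have e3 : u ≤ 3 / p := by
      have : u = (p:ℝ)^(1-β) / p := by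
        rw [hu, show -β = (1-β) - 1 by ring, Real.rpow_sub_one hp0.ne']
      rw [this]
      apply div_le_div_of_nonneg_right _ hp0.le
      rw [Real.rpow_def_of_pos hp0, mul_comm]
      have := Real.exp_le_exp.mpr hpβ
      linarith [Real.exp_one_lt_d9]
    calc v - u = u * ((p:ℝ)^σ - 1) := by rw [e1]; ring
      _ ≤ u * (σ * Real.log p * 3) := mul_le_mul_of_nonneg_left e2 hu0.le
      _ ≤ 3 / p * (σ * Real.log p * 3) := mul_le_mul_of_nonneg_right e3 (by positivity)
      _ = _ := by ring
  set t := 9 * σ * (Real.log p / p) with ht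
  have ht0 : 0 ≤ t := by positivity
  have hE : 1 + (5/2) * t ≤ Real.exp ((5/2) * t) := by linarith [Real.add_one_le_exp ((5/2)*t)]
  have key1 : (1 - v)⁻¹ ≤ Real.exp ((5/2)*t) * (1-u)⁻¹ := by
    rw [← div_eq_mul_inv, inv_le_comm₀ (by linarith) (by apply div_pos (Real.exp_pos _); linarith), inv_div,
      div_le_iff₀ (Real.exp_pos _)]
    nlinarith
  have key2 : (1 - x * v)⁻¹ ≤ Real.exp ((5/2)*t) * (1- x * u)⁻¹ := by
    have hE1 : 1 ≤ Real.exp ((5/2)*t) := by linarith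
    rcases hx with rfl | rfl | rfl
    · simpa using hE1
    · simpa using key1
    · calc (1 - -1 * v)⁻¹ ≤ (1 - -1 * u)⁻¹ := by
            apply inv_anti₀ <;> linarith
        _ ≤ _ := le_mul_of_one_le_left (by rw [inv_nonneg]; linarith) hE1
  have hxv : 0 ≤ (1 - x * v)⁻¹ := by
    rw [inv_nonneg]; rcases hx with rfl | rfl | rfl <;> linarith
  calc _ ≤ (Real.exp ((5/2)*t) * (1-u)⁻¹) * (Real.exp ((5/2)*t) * (1- x * u)⁻¹) :=
        mul_le_mul key1 key2 hxv (mul_nonneg (Real.exp_pos _).le (by rw [inv_nonneg]; linarith))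
    _ = (Real.exp ((5/2)*t) * Real.exp ((5/2)*t)) * ((1-u)⁻¹ * (1- x * u)⁻¹) := by ring
    _ = _ := by
      rw [← Real.exp_add, ht]
      congr 2
      ring

lemma rankin (χ : ℕ →*₀ ℝ) (hχ : ∀ n, χ n = 0 ∨ χ n = 1 ∨ χ n = -1)
    (hr : ∀ n : ℕ, 0 ≤ ∑ d ∈ n.divisors, χ d) (Q β : ℝ) (hQ1 : 1 ≤ Q) (hQ : 10 ≤ Real.log Q) (X : ℕ)
    (hX : Q ^ (100:ℕ) ≤ X) (h1 : 9/10 ≤ β) (h2 : β < 1) (hβ : (1-β) * Real.log Q ≤ 1) :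
    ∏ p ∈ (⌈Q⌉₊).primesBelow, ((1 - 1 / (p:ℝ))⁻¹ * (1 - χ p / (p:ℝ) ^ β)⁻¹)
      ≤ 2 * ∑ n ∈ Finset.Icc 1 X, (∑ d ∈ n.divisors, χ d) * (n:ℝ) ^ (-β) := by
  have hQ0 : 0 < Q := by linarith
  set σ := 1 / Real.log Q with hσ
  have hσ0 : 0 < σ := by positivity
  have hσ1 : σ ≤ 1/10 := by rw [hσ]; apply one_div_le_one_div_of_le <;> linarith
  have hσQ : σ * Real.log Q = 1 := by rw [hσ]; field_simp
  have hχ' : ∀ n, |χ n| ≤ 1 := fun n => by rcases hχ n with h | h | h <;> rw [h] <;> simp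
  have hpQ : ∀ p ∈ (⌈Q⌉₊).primesBelow, p.Prime ∧ Real.log p ≤ Real.log Q := fun p hp => by
    have h3 := Nat.prime_of_mem_primesBelow hp
    have h4 := Nat.lt_of_mem_primesBelow hp
    exact ⟨h3, Real.log_le_log (by exact_mod_cast h3.pos) (Nat.lt_ceil.mp h4).le⟩
  obtain ⟨hs1, hs2⟩ := r_euler χ hχ' β (by linarith) ⌈Q⌉₊
  obtain ⟨ht1, ht2⟩ := r_euler χ hχ' (β - σ) (by linarith) ⌈Q⌉₊
  set F := ∏ p ∈ (⌈Q⌉₊).primesBelow, ((1 - (p:ℝ) ^ (-β))⁻¹ * (1 - χ p * (p:ℝ) ^ (-β))⁻¹) with hF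
  set F' := ∏ p ∈ (⌈Q⌉₊).primesBelow, ((1 - (p:ℝ) ^ (-(β-σ)))⁻¹ * (1 - χ p * (p:ℝ) ^ (-(β-σ)))⁻¹) with hF'
  have hfac : ∀ p : ℕ, p.Prime → ∀ s : ℝ, 0 < s → 0 < 1 - (p:ℝ)^(-s) ∧ 0 < 1 - χ p * (p:ℝ) ^(-s) := by
    intro p hp s hs
    have h3 : (p:ℝ) ^ (-s) < 1 := Real.rpow_lt_one_of_one_lt_of_neg (by exact_mod_cast hp.one_lt) (by linarith)
    have h4 : 0 ≤ (p:ℝ) ^ (-s) := by positivity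
    refine ⟨by linarith, ?_⟩
    rcases hχ p with h | h | h <;> rw [h] <;> linarith
  have hFF : F' ≤ Real.exp 54 * F := by
    have hm : ∑ p ∈ (⌈Q⌉₊).primesBelow, Real.log p / p ≤ Real.log Q + Real.log 4 := by
      have hf1 : 1 ≤ ⌊Q⌋₊ := Nat.le_floor (by simpa using hQ1)
      have h3 := mertens_upper ⌊Q⌋₊ hf1
      have h4 : Real.log ⌊Q⌋₊ ≤ Real.log Q := Real.log_le_log (by exact_mod_cast hf1) (Nat.floor_le hQ0.le)
      refine (Finset.sum_le_sum_of_subset_of_nonneg ?_ ?_).trans (h3.trans (by linarith))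
      · intro p hp
        have h5 := Nat.lt_ceil.mp (Nat.lt_of_mem_primesBelow hp)
        exact Nat.mem_primesLE.mpr ⟨Nat.le_floor h5.le, (hpQ p hp).1⟩
      · intro p _ _
        exact div_nonneg (Real.log_natCast_nonneg p) (by positivity)
    calc F' ≤ ∏ p ∈ (⌈Q⌉₊).primesBelow, (Real.exp (45 * σ * (Real.log p / p)) * ((1 - (p:ℝ) ^ (-β))⁻¹ * (1 - χ p * (p:ℝ) ^ (-β))⁻¹)) := by
          refine Finset.prod_le_prod (fun p hp => ?_) (fun p hp => ?_)
          · have := hfac p (hpQ p hp).1 (β-σ) (by linarith)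
            have h3 := this.1; have h4 := this.2
            positivity
          · exact rankin_local β σ h1 hσ0.le hσ1 p (hpQ p hp).1
              (by rw [← hσQ]; exact mul_le_mul_of_nonneg_left (hpQ p hp).2 hσ0.le)
              (le_trans (mul_le_mul_of_nonneg_left (hpQ p hp).2 (by linarith)) hβ) _ (hχ p)
      _ = Real.exp (45 * σ * ∑ p ∈ (⌈Q⌉₊).primesBelow, Real.log p / p) * F := by
          rw [Finset.prod_mul_distrib, ← Real.exp_sum, Finset.mul_sum]
      _ ≤ Real.exp 54 * F := by
          refine mul_le_mul_of_nonneg_right (Real.exp_le_exp.mpr ?_) ?_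
          · have h4 : Real.log 4 ≤ 2 := by
              rw [show (4:ℝ) = 2 * 2 by norm_num, Real.log_mul (by norm_num) (by norm_num)]; linarith [Real.log_two_lt_d9]
            calc 45 * σ * _ ≤ 45 * σ * (Real.log Q + 2) := mul_le_mul_of_nonneg_left (by linarith) (by positivity)
              _ = 45 * (σ * Real.log Q) + 90 * σ := by ring
              _ ≤ 54 := by rw [hσQ]; linarith
          · refine Finset.prod_nonneg fun p hp => ?_
            have := hfac p (hpQ p hp).1 β (by linarith)
            have h3 := this.1; have h4 := this.2
            positivity
  have hPF : ∏ p ∈ (⌈Q⌉₊).primesBelow, ((1 - 1 / (p:ℝ))⁻¹ * (1 - χ p / (p:ℝ) ^ β)⁻¹) ≤ F := by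
    have hx : ∀ p ∈ (⌈Q⌉₊).primesBelow, (1 - χ p / (p:ℝ) ^ β) = (1 - χ p * (p:ℝ) ^ (-β)) := fun p hp => by
      rw [Real.rpow_neg (by positivity), div_eq_mul_inv]
    have h1p : ∀ p ∈ (⌈Q⌉₊).primesBelow, (0:ℝ) < (1 - 1 / (p:ℝ)) := fun p hp => by
      have : (1:ℝ) < p := by exact_mod_cast (hpQ p hp).1.one_lt
      rw [sub_pos, div_lt_one (by linarith)]; exact this
    refine Finset.prod_le_prod (fun p hp => ?_) (fun p hp => ?_)
    · have h3 := (hfac p (hpQ p hp).1 β (by linarith)).2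
      have h4 := h1p p hp
      rw [hx p hp]; positivity
    · have h3 := (hfac p (hpQ p hp).1 β (by linarith))
      rw [hx p hp]
      refine mul_le_mul_of_nonneg_right (inv_anti₀ h3.1 ?_) (inv_nonneg.mpr h3.2.le)
      have : (1:ℝ) ≤ p := by exact_mod_cast (hpQ p hp).1.one_lt.le
      have h5 := Real.rpow_le_rpow_of_exponent_le this (by linarith : (-1:ℝ) ≤ -β)
      rw [Real.rpow_neg_one] at h5
      rw [one_div]; linarith
  refine hPF.trans ?_
  -- split
  have hX1 : (1:ℝ) ≤ X := (one_le_pow₀ hQ1).trans hX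
  set S := ∑ n ∈ Finset.Icc 1 X, (∑ d ∈ n.divisors, χ d) * (n:ℝ) ^ (-β) with hS
  have hXσ : (X:ℝ) ^ (-σ) ≤ Real.exp (-100) := by
    rw [Real.rpow_def_of_pos (by linarith), Real.exp_le_exp]
    have := Real.log_le_log (by positivity) hX
    rw [Real.log_pow] at this
    push_cast at this
    nlinarith
  have hbound : F ≤ S + (X:ℝ) ^ (-σ) * F' := by
    have h3 : ∀ m : (⌈Q⌉₊).smoothNumbers, (∑ d ∈ (m:ℕ).divisors, χ d) * ((m:ℕ):ℝ) ^ (-β) ≤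
        (if (m:ℕ) ∈ Finset.Icc 1 X then (∑ d ∈ (m:ℕ).divisors, χ d) * ((m:ℕ):ℝ) ^ (-β) else 0) +
        (X:ℝ) ^ (-σ) * ((∑ d ∈ (m:ℕ).divisors, χ d) * ((m:ℕ):ℝ) ^ (-(β-σ))) := by
      intro m
      have hr' := hr m
      split_ifs with hm
      · have : 0 ≤ (X:ℝ) ^ (-σ) * ((∑ d ∈ (m:ℕ).divisors, χ d) * ((m:ℕ):ℝ) ^ (-(β-σ))) := by positivity
        linarith
      · have hm0 : (m:ℕ) ≠ 0 := Nat.ne_zero_of_mem_smoothNumbers m.2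
        have hmX : (X:ℝ) ≤ (m:ℕ) := by
          rw [Finset.mem_Icc] at hm
          exact_mod_cast (by omega : X ≤ (m:ℕ))
        rw [zero_add]
        have h5 : ((m:ℕ):ℝ) ^ (-β) = ((m:ℕ):ℝ) ^ (-σ) * ((m:ℕ):ℝ) ^ (-(β-σ)) := by
          rw [← Real.rpow_add (by exact_mod_cast Nat.pos_of_ne_zero hm0)]; ring_nf
        have h6 : ((m:ℕ):ℝ) ^ (-σ) ≤ (X:ℝ) ^ (-σ) := Real.rpow_le_rpow_of_nonpos (by linarith) hmX (by linarith)
        rw [h5]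
        calc _ = ((m:ℕ):ℝ) ^ (-σ) * ((∑ d ∈ (m:ℕ).divisors, χ d) * ((m:ℕ):ℝ) ^ (-(β-σ))) := by ring
          _ ≤ _ := mul_le_mul_of_nonneg_right h6 (by positivity)
    set g : ℕ → ℝ := fun n => if n ∈ Finset.Icc 1 X then (∑ d ∈ n.divisors, χ d) * (n:ℝ) ^ (-β) else 0 with hg
    have hgs : Summable g := summable_of_ne_finset_zero (s := Finset.Icc 1 X) (fun n hn => by simp only [hg]; rw [if_neg hn])
    have hg0 : ∀ n, 0 ≤ g n := fun n => by
      simp only [hg]; have := hr n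
      split_ifs <;> positivity
    have hgS : ∑' m : (⌈Q⌉₊).smoothNumbers, g m ≤ S := by
      have h4 : ∑' m : (⌈Q⌉₊).smoothNumbers, g m ≤ ∑' n, g n := hgs.tsum_subtype_le g _ hg0
      rw [tsum_eq_sum (s := Finset.Icc 1 X) (fun n hn => by simp only [hg]; rw [if_neg hn])] at h4
      refine h4.trans (le_of_eq (Finset.sum_congr rfl fun n hn => by simp only [hg]; rw [if_pos hn]))
    have hgs' : Summable (fun m : (⌈Q⌉₊).smoothNumbers => g m) := hgs.subtype _
    have h5 : ∑' m : (⌈Q⌉₊).smoothNumbers, (∑ d ∈ (m:ℕ).divisors, χ d) * ((m:ℕ):ℝ) ^ (-β) ≤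
        ∑' m : (⌈Q⌉₊).smoothNumbers, (g m + (X:ℝ) ^ (-σ) * ((∑ d ∈ (m:ℕ).divisors, χ d) * ((m:ℕ):ℝ) ^ (-(β-σ)))) :=
      hs1.tsum_le_tsum h3 (hgs'.add (ht1.mul_left _))
    rw [hs2.tsum_eq, Summable.tsum_add hgs' (ht1.mul_left _), tsum_mul_left, ht2.tsum_eq] at h5
    refine h5.trans (add_le_add hgS le_rfl)
  have hF0 : 0 ≤ F := by
    rw [← hs2.tsum_eq]
    exact tsum_nonneg fun m => mul_nonneg (hr _) (by positivity)
  have hF0' : 0 ≤ F' := by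
    rw [← ht2.tsum_eq]
    exact tsum_nonneg fun m => mul_nonneg (hr _) (by positivity)
  have h6 : (X:ℝ) ^ (-σ) * F' ≤ Real.exp (-46) * F := by
    calc _ ≤ Real.exp (-100) * (Real.exp 54 * F) := mul_le_mul hXσ hFF hF0' (Real.exp_pos _).le
      _ = _ := by rw [← mul_assoc, ← Real.exp_add]; norm_num
  have h7 : Real.exp (-46) ≤ 1/2 := by
    rw [Real.exp_neg, inv_le_comm₀ (Real.exp_pos _) (by norm_num)]
    have := Real.add_one_le_exp (46:ℝ)
    norm_num; linarith
  nlinarith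

lemma sum_range_mul_block {M : Type*} [AddCommMonoid M] (f : ℕ → M) (q N : ℕ) :
    ∑ n ∈ Finset.range (q * N), f n = ∑ j ∈ Finset.range N, ∑ a ∈ Finset.range q, f (j * q + a) := by
  induction N with
  | zero => simp
  | succ N ih =>
    rw [Finset.sum_range_succ, ← ih, Nat.mul_succ, Finset.sum_range_add, mul_comm N q]

lemma sum_range_char (q : ℕ) [NeZero q] (f : ZMod q → ℂ) :
    ∑ a ∈ Finset.range q, f (a : ZMod q) = ∑ x : ZMod q, f x := by
  refine Finset.sum_bij (fun a _ => (a : ZMod q)) (fun _ _ => Finset.mem_univ _) ?_ ?_ (fun _ _ => rfl)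
  · intro a ha b hb hab
    have := (ZMod.natCast_eq_natCast_iff' a b q).mp hab
    rwa [Nat.mod_eq_of_lt (Finset.mem_range.mp ha), Nat.mod_eq_of_lt (Finset.mem_range.mp hb)] at this
  · intro x _
    exact ⟨x.val, Finset.mem_range.mpr x.val_lt, ZMod.natCast_zmod_val x⟩

lemma cpow_diff_bound (s : ℂ) (hs : 0 ≤ s.re) (x y : ℝ) (hy : 0 < y) (hxy : y ≤ x) :
    ‖(x:ℂ) ^ (-s) - (y:ℂ) ^ (-s)‖ ≤ ‖s‖ * y ^ (-s.re - 1) * (x - y) := by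
  have hd : ∀ t ∈ Set.Icc y x, HasDerivWithinAt (fun t : ℝ => (t:ℂ) ^ (-s)) (-s * (t:ℂ) ^ (-s - 1)) (Set.Icc y x) t := by
    intro t ht
    by_cases h0 : s = 0
    · subst h0
      simp only [neg_zero, Complex.cpow_zero, zero_mul]
      exact hasDerivWithinAt_const _ _ _
    · exact (hasDerivAt_ofReal_cpow_const (by linarith [ht.1] : t ≠ 0) (by simpa using h0)).hasDerivWithinAt
  have := (convex_Icc y x).norm_image_sub_le_of_norm_hasDerivWithin_le (C := ‖s‖ * y ^ (-s.re - 1)) hd ?_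
    (Set.left_mem_Icc.mpr hxy) (Set.right_mem_Icc.mpr hxy)
  · rwa [Real.norm_eq_abs, abs_of_nonneg (by linarith : 0 ≤ x - y)] at this
  · intro t ht
    rw [norm_mul, norm_neg, Complex.norm_cpow_eq_rpow_re_of_pos (by linarith [ht.1])]
    refine mul_le_mul_of_nonneg_left ?_ (norm_nonneg _)
    simp only [Complex.sub_re, Complex.neg_re, Complex.one_re]
    exact Real.rpow_le_rpow_of_nonpos hy ht.1 (by linarith)

lemma block_bound (q : ℕ) [NeZero q] (χ : DirichletCharacter ℂ q) (hχ : χ ≠ 1) (s : ℂ) (hs : 1/2 < s.re)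
    (hs4 : ‖s‖ ≤ 4) (j : ℕ) :
    ‖∑ a ∈ Finset.range q, LSeries.term (fun n => χ n) s (j * q + a)‖ ≤
      4 * (q:ℝ)^2 * (j:ℝ) ^ (-(3/2):ℝ) + (if j = 0 then (q:ℝ) else 0) := by
  have hq : 1 ≤ q := Nat.one_le_iff_ne_zero.mpr (NeZero.ne q)
  have hqr : (1:ℝ) ≤ q := by exact_mod_cast hq
  rcases Nat.eq_zero_or_pos j with rfl | hj
  · rw [if_pos rfl]
    have : ∀ a ∈ Finset.range q, ‖LSeries.term (fun n => χ n) s (0 * q + a)‖ ≤ 1 := by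
      intro a _
      rw [zero_mul, zero_add]
      by_cases ha : a = 0
      · rw [ha, LSeries.term_zero]; simp
      · rw [LSeries.term_of_ne_zero ha, norm_div, Complex.norm_natCast_cpow_of_pos (by omega)]
        rw [div_le_one (by positivity)]
        refine (χ.norm_le_one _).trans (Real.one_le_rpow (by exact_mod_cast (by omega : 1 ≤ a)) (by linarith))
    have h2 := norm_sum_le_of_le _ this
    rw [Finset.sum_const, Finset.card_range, nsmul_eq_mul, mul_one] at h2
    have : 0 ≤ 4 * (q:ℝ)^2 * ((0:ℕ):ℝ) ^ (-(3/2):ℝ) := by positivity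
    linarith
  · rw [if_neg (by omega), add_zero]
    have hjq : 0 < j * q := by positivity
    have h0 : ∑ a ∈ Finset.range q, χ (a : ZMod q) * ((j * q : ℕ):ℂ) ^ (-s) = 0 := by
      rw [← Finset.sum_mul, sum_range_char q (fun x => χ x), MulChar.sum_eq_zero_of_ne_one hχ, zero_mul]
    have h1 : ∑ a ∈ Finset.range q, LSeries.term (fun n => χ n) s (j * q + a) =
        ∑ a ∈ Finset.range q, χ (a : ZMod q) * (((j * q + a : ℕ):ℂ) ^ (-s) - ((j * q : ℕ):ℂ) ^ (-s)) := by
      simp_rw [mul_sub]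
      rw [Finset.sum_sub_distrib, h0, sub_zero]
      refine Finset.sum_congr rfl fun a _ => ?_
      rw [LSeries.term_of_ne_zero (by omega), Complex.cpow_neg, div_eq_mul_inv]
      congr 2
      push_cast; simp
    rw [h1]
    have h2 : ∀ a ∈ Finset.range q, ‖χ (a : ZMod q) * (((j * q + a : ℕ):ℂ) ^ (-s) - ((j * q : ℕ):ℂ) ^ (-s))‖ ≤ 4 * q * (j:ℝ) ^ (-(3/2):ℝ) := by
      intro a ha
      rw [norm_mul]
      have h3 := cpow_diff_bound s (by linarith) ((j*q+a:ℕ):ℝ) ((j*q:ℕ):ℝ) (by exact_mod_cast hjq) (by push_cast; linarith)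
      simp only [Complex.ofReal_natCast] at h3
      have h4 : ((j*q:ℕ):ℝ) ^ (-s.re - 1) ≤ (j:ℝ) ^ (-(3/2):ℝ) := by
        have hj1 : (1:ℝ) ≤ j := by exact_mod_cast hj
        calc _ ≤ (j:ℝ) ^ (-s.re - 1) := Real.rpow_le_rpow_of_nonpos (by linarith) (by push_cast; nlinarith) (by linarith)
          _ ≤ _ := Real.rpow_le_rpow_of_exponent_le hj1 (by linarith)
      have h5 : ((j*q+a:ℕ):ℝ) - ((j*q:ℕ):ℝ) ≤ q := by
        have : (a:ℝ) ≤ q := by exact_mod_cast (Finset.mem_range.mp ha).le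
        push_cast; linarith
      have h6 : 0 ≤ ((j*q+a:ℕ):ℝ) - ((j*q:ℕ):ℝ) := by push_cast; linarith [Nat.cast_nonneg (α := ℝ) a]
      calc _ ≤ 1 * (‖s‖ * ((j*q:ℕ):ℝ) ^ (-s.re - 1) * (((j*q+a:ℕ):ℝ) - ((j*q:ℕ):ℝ))) :=
            mul_le_mul (χ.norm_le_one _) h3 (norm_nonneg _) zero_le_one
        _ ≤ 1 * (4 * (j:ℝ) ^ (-(3/2):ℝ) * q) := by gcongr
        _ = _ := by ring
    refine (norm_sum_le_of_le _ h2).trans (le_of_eq ?_)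
    rw [Finset.sum_const, Finset.card_range, nsmul_eq_mul]
    ring

lemma L_limits (q : ℕ) [NeZero q] (χ : DirichletCharacter ℂ q) (hχ : χ ≠ 1) (s : ℂ) (hs : 1/2 < s.re) (hs4 : ‖s‖ < 4) :
    Filter.Tendsto (fun N : ℕ => ∑ n ∈ Finset.range (q * N), LSeries.term (fun n => χ n) s n) Filter.atTop
      (nhds (DirichletCharacter.LFunction χ s)) ∧
    Filter.Tendsto (fun N : ℕ => ∑ n ∈ Finset.range (q * N), -LSeries.term (LSeries.logMul (fun n => χ n)) s n) Filter.atTop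
      (nhds (deriv (DirichletCharacter.LFunction χ) s)) := by
  have hq : 1 ≤ q := Nat.one_le_iff_ne_zero.mpr (NeZero.ne q)
  set F : ℕ → ℂ → ℂ := fun j z => ∑ a ∈ Finset.range q, LSeries.term (fun n => χ n) z (j * q + a) with hF
  set u : ℕ → ℝ := fun j => 4 * (q:ℝ)^2 * (j:ℝ) ^ (-(3/2):ℝ) + (if j = 0 then (q:ℝ) else 0) with hu
  have hus : Summable u := by
    refine Summable.add ((Real.summable_nat_rpow.mpr (by norm_num)).mul_left _) ?_
    exact summable_of_ne_finset_zero (s := {0}) (fun n hn => if_neg (by simpa using hn))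
  set U : Set ℂ := {z | 1/2 < z.re} ∩ Metric.ball 0 4 with hU
  have hUo : IsOpen U := (isOpen_lt continuous_const Complex.continuous_re).inter Metric.isOpen_ball
  have hUc : IsPreconnected U := ((convex_halfSpace_re_gt _).inter (convex_ball _ _)).isPreconnected
  have hsU : s ∈ U := ⟨hs, by simpa using hs4⟩
  have hFu : ∀ (j : ℕ) (z : ℂ), z ∈ U → ‖F j z‖ ≤ u j := fun j z hz =>
    block_bound q χ hχ z hz.1 (by have := hz.2; simp at this; exact this.le) j
  have hFd : ∀ j z, HasDerivAt (F j) (∑ a ∈ Finset.range q, -LSeries.term (LSeries.logMul (fun n => χ n)) z (j * q + a)) z := by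
    intro j z
    have := HasDerivAt.fun_sum (u := Finset.range q) (fun a _ => LSeries.hasDerivAt_term (fun n => χ n) (j * q + a) z)
    exact this
  have hFo : ∀ j, DifferentiableOn ℂ (F j) U := fun j z _ => (hFd j z).differentiableAt.differentiableWithinAt
  have hG := Complex.differentiableOn_tsum_of_summable_norm hus hFo hUo hFu
  have hH := Complex.hasSum_deriv_of_summable_norm hus hFo hUo hFu hsU
  have heq : Set.EqOn (fun z => ∑' j, F j z) (DirichletCharacter.LFunction χ) U := by
    refine AnalyticOnNhd.eqOn_of_preconnected_of_eventuallyEq (z₀ := 2) (hG.analyticOnNhd hUo)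
      ((DirichletCharacter.differentiable_LFunction hχ).differentiableOn.analyticOnNhd hUo) hUc ?_ ?_
    · constructor
      · simp; norm_num
      · simp; norm_num
    · have h2 : {z : ℂ | 1 < z.re} ∩ U ∈ nhds (2:ℂ) := by
        refine IsOpen.mem_nhds ((isOpen_lt continuous_const Complex.continuous_re).inter hUo) ⟨by simp, by simp; norm_num, by simp; norm_num⟩
      filter_upwards [h2] with z hz
      rw [DirichletCharacter.LFunction_eq_LSeries χ hz.1]
      have hsum : LSeriesSummable (fun n => χ n) z := DirichletCharacter.LSeriesSummable_of_one_lt_re χ hz.1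
      have t1 : Filter.Tendsto (fun N : ℕ => ∑ n ∈ Finset.range (q * N), LSeries.term (fun n => χ n) z n) Filter.atTop (nhds (LSeries (fun n => χ n) z)) :=
        hsum.hasSum.tendsto_sum_nat.comp (Filter.tendsto_id.const_mul_atTop' hq)
      have hsF : Summable (fun j => F j z) := Summable.of_norm_bounded hus (fun j => hFu j z hz.2)
      have t2 := hsF.hasSum.tendsto_sum_nat
      refine tendsto_nhds_unique t2 (t1.congr fun N => ?_)
      rw [sum_range_mul_block]
  constructor
  · have hsF : Summable (fun j => F j s) := Summable.of_norm_bounded hus (fun j => hFu j s hsU)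
    have t2 := hsF.hasSum.tendsto_sum_nat
    have e : ∑' j, F j s = DirichletCharacter.LFunction χ s := heq hsU
    rw [e] at t2
    refine t2.congr fun N => ?_
    rw [sum_range_mul_block]
  · have t2 := hH.tendsto_sum_nat
    have e : deriv (fun z => ∑' j, F j z) s = deriv (DirichletCharacter.LFunction χ) s :=
      Filter.EventuallyEq.deriv_eq (Filter.eventuallyEq_of_mem (hUo.mem_nhds hsU) heq)
    rw [e] at t2
    refine t2.congr fun N => ?_
    rw [sum_range_mul_block]
    exact Finset.sum_congr rfl fun j _ => (hFd j s).deriv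

lemma char_sum_bound (χ : ℕ → ℝ) (q : ℕ) (hq : 1 ≤ q) (hχ : ∀ n, |χ n| ≤ 1) (hper : ∀ n, χ (n + q) = χ n)
    (h0 : ∑ i ∈ Finset.range q, χ i = 0) (a b : ℕ) : |∑ i ∈ Finset.Ico a b, χ i| ≤ q := by
  rcases le_or_gt b a with h | h
  · rw [Finset.Ico_eq_empty_of_le h]; simp
  have hf : ∀ j n, ∑ i ∈ Finset.range (q * j + n), χ i = ∑ i ∈ Finset.range n, χ i := by
    intro j
    induction j with
    | zero => intro n; simp
    | succ j ih =>
      intro n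
      rw [show q * (j+1) + n = q * j + (q + n) by ring, ih, Finset.sum_range_add, h0, zero_add]
      exact Finset.sum_congr rfl fun i _ => by rw [add_comm, hper]
  have hgen : ∀ a b : ℕ, a ≤ b → b ≤ q → |∑ i ∈ Finset.range b, χ i - ∑ i ∈ Finset.range a, χ i| ≤ q := by
    intro a b hab hb
    rw [← Finset.sum_Ico_eq_sub _ hab]
    refine (Finset.abs_sum_le_sum_abs _ _).trans ((Finset.sum_le_sum fun i _ => hχ i).trans ?_)
    rw [Finset.sum_const, Nat.card_Ico, nsmul_eq_mul, mul_one]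
    exact_mod_cast (by omega)
  rw [Finset.sum_Ico_eq_sub _ h.le]
  have ha := hf (a / q) (a % q)
  have hb := hf (b / q) (b % q)
  rw [Nat.div_add_mod] at ha hb
  rw [ha, hb]
  have h1 := (Nat.mod_lt a hq).le
  have h2 := (Nat.mod_lt b hq).le
  rcases le_total (a % q) (b % q) with h3 | h3
  · exact hgen _ _ h3 h2
  · rw [abs_sub_comm]; exact hgen _ _ h3 h1

lemma choice_Y (Q w : ℝ) (q : ℕ) (hQ : Real.exp 4000 ≤ Q) (hw0 : 0 < w) (hw : w * Real.log Q ≤ 1/1000) (hq : (q:ℝ) ≤ Q) :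
    ∃ Y : ℕ, 8 ≤ Y ∧ Q ^ (100:ℕ) ≤ ((Y^4:ℕ):ℝ) ∧ w * Real.log ((Y:ℝ)^4) ≤ 1/4 ∧
      1000 * (q * (Y:ℝ) ^ (-(3/4):ℝ) * (1 + Real.log ((Y:ℝ)^4)) ^ 2) ≤ w^2 := by
  have hQ50 : 50 ≤ Q := by linarith [Real.add_one_le_exp (4000:ℝ)]
  have hL : 4000 ≤ Real.log Q := by
    rw [← Real.log_exp 4000]; exact Real.log_le_log (Real.exp_pos _) hQ
  have hw1 : w ≤ 1/4000000 := by nlinarith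
  set R := Q / w with hR
  have hRQ : Q ≤ R := by rw [hR, le_div_iff₀ hw0]; nlinarith
  have hR1 : 1 ≤ R := by linarith
  have hR0 : 0 < R := by linarith
  refine ⟨⌈R ^ 25⌉₊, ?_⟩
  set Y := ⌈R ^ 25⌉₊ with hY
  have hYR : R ^ 25 ≤ (Y:ℝ) := Nat.le_ceil _
  have hY50 : (50:ℝ) ≤ Y := by
    calc (50:ℝ) ≤ R := by linarith
      _ ≤ R ^ 25 := le_self_pow₀ hR1 (by norm_num)
      _ ≤ Y := hYR
  have hYR2 : (Y:ℝ) ≤ 2 * R ^ 25 := by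
    have := Nat.ceil_lt_add_one (by positivity : 0 ≤ R^25)
    have h1 : 1 ≤ R ^ 25 := one_le_pow₀ hR1
    linarith
  have hY0 : (0:ℝ) < Y := by linarith
  have hlogY : Real.log Y ≤ 1 + 25 * (Real.log Q + Real.log (1/w)) := by
    calc Real.log Y ≤ Real.log (2 * R ^ 25) := Real.log_le_log hY0 hYR2
      _ = Real.log 2 + 25 * (Real.log Q + Real.log (1/w)) := by
        rw [Real.log_mul (by norm_num) (by positivity), Real.log_pow, hR, div_eq_mul_one_div,
          Real.log_mul (by positivity) (by positivity)]; norm_num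
      _ ≤ _ := by linarith [Real.log_two_lt_d9]
  refine ⟨?_, ?_, ?_, ?_⟩
  · have : (8:ℝ) ≤ Y := by linarith
    exact_mod_cast this
  · calc Q ^ 100 ≤ R ^ 100 := by gcongr
      _ = (R ^ 25) ^ 4 := by ring
      _ ≤ (Y:ℝ) ^ 4 := by gcongr
      _ = _ := by push_cast; rfl
  · rw [Real.log_pow]
    have h1 : Real.log (1/w) ≤ (1/w) ^ (1/2:ℝ) / (1/2) := Real.log_le_rpow_div (by positivity) (by norm_num)
    rw [← Real.sqrt_eq_rpow] at h1
    have h2 : w * Real.sqrt (1/w) = Real.sqrt w := by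
      rw [Real.sqrt_div zero_le_one, Real.sqrt_one]
      have := Real.mul_self_sqrt hw0.le
      have h3 := Real.sqrt_pos.mpr hw0
      field_simp
      linarith
    have h3 : Real.sqrt w ≤ 1/2000 := by
      rw [Real.sqrt_le_left (by norm_num)]; linarith
    push_cast
    have h4 : w * Real.log (1/w) ≤ 1/1000 := by
      calc w * Real.log (1/w) ≤ w * (Real.sqrt (1/w) / (1/2)) := mul_le_mul_of_nonneg_left h1 hw0.le
        _ = 2 * (w * Real.sqrt (1/w)) := by ring
        _ ≤ _ := by rw [h2]; linarith
    calc w * (4 * Real.log Y) ≤ w * (4 * (1 + 25 * (Real.log Q + Real.log (1/w)))) := by gcongr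
      _ = 4 * w + 100 * (w * Real.log Q) + 100 * (w * Real.log (1/w)) := by ring
      _ ≤ 1/4 := by linarith
  · rw [Real.log_pow]
    push_cast
    have hY1 : (1:ℝ) ≤ Y := by linarith
    have h1 : Real.log Y ≤ (Y:ℝ) ^ (1/16:ℝ) / (1/16) := Real.log_le_rpow_div (by positivity) (by norm_num)
    have h2 : 1 ≤ (Y:ℝ) ^ (1/16:ℝ) := Real.one_le_rpow hY1 (by norm_num)
    have h3 : 0 ≤ Real.log Y := Real.log_nonneg hY1
    have h4 : (1 + 4 * Real.log Y)^2 ≤ 4225 * (Y:ℝ) ^ (1/8:ℝ) := by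
      calc (1 + 4 * Real.log Y)^2 ≤ (65 * (Y:ℝ) ^ (1/16:ℝ))^2 := by gcongr; linarith
        _ = 4225 * ((Y:ℝ) ^ (1/16:ℝ) * (Y:ℝ) ^ (1/16:ℝ)) := by ring
        _ = _ := by rw [← Real.rpow_add hY0]; norm_num
    have h5 : (Y:ℝ) ^ (-(3/4):ℝ) * (Y:ℝ) ^ (1/8:ℝ) ≤ (w/Q)^5 := by
      rw [← Real.rpow_add hY0]
      have h6 : R ^ 8 ≤ (Y:ℝ) := (pow_le_pow_right₀ hR1 (by norm_num)).trans hYR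
      calc (Y:ℝ) ^ (-(3/4) + 1/8 : ℝ) ≤ (R^8) ^ (-(3/4) + 1/8 : ℝ) :=
            Real.rpow_le_rpow_of_nonpos (by positivity) h6 (by norm_num)
        _ = R ^ (-(5:ℝ)) := by rw [← Real.rpow_natCast, ← Real.rpow_mul hR0.le]; norm_num
        _ = (w/Q)^5 := by
          rw [Real.rpow_neg hR0.le, hR]
          norm_cast
          rw [← inv_pow, inv_div]
    calc 1000 * (q * (Y:ℝ) ^ (-(3/4):ℝ) * (1 + 4 * Real.log Y) ^ 2)
        ≤ 1000 * (Q * (Y:ℝ) ^ (-(3/4):ℝ) * (4225 * (Y:ℝ) ^ (1/8:ℝ))) := by gcongr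
      _ = 4225000 * Q * ((Y:ℝ) ^ (-(3/4):ℝ) * (Y:ℝ) ^ (1/8:ℝ)) := by ring
      _ ≤ 4225000 * Q * (w/Q)^5 := by gcongr
      _ = w^2 * (4225000 * w^3 / Q^4) := by field_simp
      _ ≤ w^2 * 1 := by
        refine mul_le_mul_of_nonneg_left ?_ (by positivity)
        rw [div_le_one (by positivity)]
        have h7 : w^3 ≤ 1 := pow_le_one₀ hw0.le (by linarith)
        have h8 : (50:ℝ)^4 ≤ Q^4 := by gcongr
        norm_num at h8
        linarith
      _ = w^2 := mul_one _

lemma alpha_bound (Q : ℝ) (hQ : Real.exp 4000 ≤ Q) (q : ℕ) [NeZero q] (χ : DirichletCharacter ℂ q) (hq : (q:ℝ) < Q)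
    (hχ1 : χ ≠ 1) (hreal : ∀ n : ZMod q, (starRingEnd ℂ) (χ n) = χ n) (β : ℝ)
    (hβ : 1 - (1/1000) / Real.log Q < β) (hβ1 : β < 1) (hL : DirichletCharacter.LFunction χ (β : ℂ) = 0) :
    ‖∏ p ∈ (Finset.range (⌈Q⌉₊ + 1)).filter (fun p => Nat.Prime p ∧ (p : ℝ) < Q),
        ((1 - 1 / (p : ℂ))⁻¹ * (1 - χ ((p : ℕ) : ZMod q) / (((p : ℝ) ^ β : ℝ) : ℂ))⁻¹)‖ ≤
      32 * ‖deriv (fun s : ℂ => DirichletCharacter.LFunction χ s) (β : ℂ)‖ := by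
  have hq1 : 1 ≤ q := Nat.one_le_iff_ne_zero.mpr (NeZero.ne q)
  have hqne : q ≠ 1 := by
    rintro rfl
    exact hχ1 (DirichletCharacter.level_one χ)
  have hQ1 : 1 ≤ Q := by linarith [Real.add_one_le_exp (4000:ℝ)]
  have hLQ : 4000 ≤ Real.log Q := by
    rw [← Real.log_exp 4000]; exact Real.log_le_log (Real.exp_pos _) hQ
  have hre : ∀ x : ZMod q, χ x = ((χ x).re : ℂ) := fun x => (Complex.conj_eq_iff_re.mp (hreal x)).symm
  haveI : Nontrivial (ZMod q) := by
    haveI : Fact (1 < q) := ⟨by omega⟩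
    infer_instance
  obtain ⟨X, hX⟩ : ∃ X : ℕ →*₀ ℝ, ∀ n : ℕ, χ (n : ZMod q) = (X n : ℂ) := by
    refine ⟨⟨⟨fun n => (χ (n : ZMod q)).re, ?_⟩, ?_, ?_⟩, fun n => hre _⟩
    · show (χ ((0:ℕ) : ZMod q)).re = 0
      rw [Nat.cast_zero, MulChar.map_nonunit χ not_isUnit_zero, Complex.zero_re]
    · simp
    · intro a b
      have := hre ((a * b : ℕ) : ZMod q)
      have h2 : ((χ ((a * b : ℕ) : ZMod q)).re : ℂ) = (((χ (a : ZMod q)).re * (χ (b : ZMod q)).re : ℝ) : ℂ) := by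
        rw [← this, Complex.ofReal_mul, ← hre, ← hre, ← map_mul, Nat.cast_mul]
      exact_mod_cast h2
  have hX3 : ∀ n, X n = 0 ∨ X n = 1 ∨ X n = -1 := by
    intro n
    by_cases hu : IsUnit (n : ZMod q)
    · right
      have h1 := DirichletCharacter.unit_norm_eq_one χ hu.unit
      rw [IsUnit.unit_spec, hX, Complex.norm_real, Real.norm_eq_abs] at h1
      exact (abs_eq zero_le_one).mp h1
    · left
      have := hX n
      rw [MulChar.map_nonunit χ hu] at this
      exact_mod_cast this.symm
  have hXb : ∀ n, |X n| ≤ 1 := fun n => by rcases hX3 n with h | h | h <;> rw [h] <;> simp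
  have hsq : χ ^ 2 = 1 := by
    ext u
    rw [MulChar.pow_apply_coe, MulChar.one_apply_coe]
    have h1 := DirichletCharacter.unit_norm_eq_one χ u
    rw [hre (u : ZMod q), Complex.norm_real, Real.norm_eq_abs] at h1
    rw [hre (u : ZMod q)]
    have : (χ (u : ZMod q)).re ^ 2 = 1 := by rw [← sq_abs, h1]; norm_num
    exact_mod_cast this
  have hr : ∀ n : ℕ, 0 ≤ ∑ d ∈ n.divisors, X d := by
    intro n
    have h1 := DirichletCharacter.zetaMul_nonneg hsq n
    have h2 : χ.zetaMul n = ((∑ d ∈ n.divisors, X d : ℝ) : ℂ) := by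
      rw [DirichletCharacter.zetaMul, ArithmeticFunction.coe_zeta_mul_apply, Complex.ofReal_sum]
      refine Finset.sum_congr rfl fun d hd => ?_
      rw [← hX]
      have hd0 : d ≠ 0 := (Nat.pos_of_mem_divisors hd).ne'
      simp [toArithmeticFunction, hd0]
    rw [h2] at h1
    exact_mod_cast h1
  have hsum : ∀ a b, |∑ i ∈ Finset.Ico a b, X i| ≤ q := by
    refine char_sum_bound X q hq1 hXb (fun n => ?_) ?_
    · have h1 := hX (n+q)
      rw [Nat.cast_add, ZMod.natCast_self, add_zero, hX n] at h1
      exact_mod_cast h1.symm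
    · have h1 := sum_range_char q (fun x => χ x)
      rw [MulChar.sum_eq_zero_of_ne_one hχ1] at h1
      simp_rw [hX] at h1
      exact_mod_cast h1
  set w := 1 - β with hw
  have hw0 : 0 < w := by linarith
  have hwQ : w * Real.log Q ≤ 1/1000 := by
    have : w < (1/1000) / Real.log Q := by linarith
    rw [lt_div_iff₀ (by linarith)] at this
    exact this.le
  have hwsmall : 4000 * w ≤ 1/1000 := by nlinarith
  obtain ⟨Y, hY8, hYQ, hYl, hYe⟩ := choice_Y Q w q hQ hw0 hwQ hq.le
  obtain ⟨l1, l2⟩ := L_limits q χ hχ1 (β:ℂ) (by simp; linarith) (by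
    rw [Complex.norm_real, Real.norm_eq_abs, abs_of_nonneg (by linarith)]; linarith)
  rw [hL] at l1
  have hterm : ∀ n : ℕ, LSeries.term (fun n => χ n) (β:ℂ) n = ((X n * (n:ℝ) ^ (-β) : ℝ) : ℂ) := by
    intro n
    by_cases hn : n = 0
    · subst hn; simp
    · rw [LSeries.term_of_ne_zero hn, hX, Complex.ofReal_mul, Complex.ofReal_cpow (by positivity),
        Complex.ofReal_neg, Complex.cpow_neg, div_eq_mul_inv, Complex.ofReal_natCast]
  have hterm2 : ∀ n : ℕ, -LSeries.term (LSeries.logMul (fun n => χ n)) (β:ℂ) n = ((-(X n * ((n:ℝ) ^ (-β) * Real.log n)) : ℝ) : ℂ) := by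
    intro n
    by_cases hn : n = 0
    · subst hn; simp
    · rw [LSeries.term_of_ne_zero hn, LSeries.logMul, hX]
      rw [Complex.ofReal_neg, Complex.ofReal_mul, Complex.ofReal_mul, Complex.ofReal_cpow (by positivity),
        Complex.ofReal_neg, Complex.cpow_neg, Complex.ofReal_natCast, ← Complex.natCast_log]
      ring
  set L' := deriv (DirichletCharacter.LFunction χ) (β:ℂ) with hL'
  have t1 : Filter.Tendsto (fun N : ℕ => ∑ n ∈ Finset.range (q * N), X n * (n:ℝ) ^ (-β)) Filter.atTop (nhds 0) := by
    have := (Complex.continuous_re.tendsto _).comp l1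
    refine this.congr fun N => ?_
    simp only [Function.comp_apply, hterm]
    rw [← Complex.ofReal_sum, Complex.ofReal_re]
  have t2 : Filter.Tendsto (fun N : ℕ => ∑ n ∈ Finset.range (q * N), X n * ((n:ℝ) ^ (-β) * Real.log n)) Filter.atTop (nhds (-L'.re)) := by
    have := ((Complex.continuous_re.tendsto _).comp l2).neg
    refine this.congr fun N => ?_
    simp only [Function.comp_apply, hterm2]
    rw [← Complex.ofReal_sum, Complex.ofReal_re, Finset.sum_neg_distrib, neg_neg]
  have main := siegel_elem X q hq1 β (-L'.re) Y hY8 (by linarith) hβ1 hXb (map_one X) hsum hr t1 t2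
    (by linarith) hYl hYe
  have rk := rankin X hX3 hr Q β hQ1 (by linarith) (Y^4) hYQ (by linarith) hβ1 (by linarith)
  have hset : (Finset.range (⌈Q⌉₊ + 1)).filter (fun p => Nat.Prime p ∧ (p : ℝ) < Q) = (⌈Q⌉₊).primesBelow := by
    ext p
    rw [Finset.mem_filter, Nat.mem_primesBelow, Finset.mem_range, Nat.lt_ceil]
    constructor
    · rintro ⟨_, h2, h3⟩; exact ⟨h3, h2⟩
    · rintro ⟨h1, h2⟩; exact ⟨by have := Nat.lt_ceil.mpr h1; omega, h2, h1⟩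
  have hprod : ∏ p ∈ (⌈Q⌉₊).primesBelow,
        ((1 - 1 / (p : ℂ))⁻¹ * (1 - χ ((p : ℕ) : ZMod q) / (((p : ℝ) ^ β : ℝ) : ℂ))⁻¹) =
      ((∏ p ∈ (⌈Q⌉₊).primesBelow, ((1 - 1 / (p:ℝ))⁻¹ * (1 - X p / (p:ℝ) ^ β)⁻¹) : ℝ) : ℂ) := by
    rw [Complex.ofReal_prod]
    refine Finset.prod_congr rfl fun p _ => ?_
    rw [hX]; push_cast; rfl
  rw [hset, hprod, Complex.norm_real, Real.norm_eq_abs, abs_of_nonneg]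
  · refine rk.trans ?_
    have h5 : |-L'.re| ≤ ‖L'‖ := by rw [abs_neg]; exact Complex.abs_re_le_norm _
    show _ ≤ 32 * ‖L'‖
    linarith
  · refine Finset.prod_nonneg fun p hp => ?_
    have hp1 : (1:ℝ) < p := by exact_mod_cast (Nat.prime_of_mem_primesBelow hp).one_lt
    have h6 : 1 ≤ (p:ℝ) ^ β := Real.one_le_rpow hp1.le (by linarith)
    have h7 : 1 / (p:ℝ) ≤ 1 := by rw [div_le_one (by linarith)]; exact hp1.le
    have h8 : X p / (p:ℝ)^β ≤ 1 := by
      rw [div_le_one (by linarith)]; linarith [(abs_le.mp (hXb p)).2]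
    exact mul_nonneg (inv_nonneg.mpr (by linarith)) (inv_nonneg.mpr (by linarith))

lemma prim_no_factor (q : ℕ) [NeZero q] (χ : DirichletCharacter ℂ q) (hp : χ.IsPrimitive)
    (d : ℕ) (hd : d ∣ q) (hlt : d < q) :
    ∃ u : (ZMod q)ˣ, (ZMod.castHom hd (ZMod d)) (u : ZMod q) = 1 ∧ χ u ≠ 1 := by
  by_contra hcon
  push Not at hcon
  have hf : χ.FactorsThrough d := by
    rw [DirichletCharacter.factorsThrough_iff_ker_unitsMap hd]
    intro u hu
    rw [MonoidHom.mem_ker] at hu ⊢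
    have h1 : (ZMod.castHom hd (ZMod d)) (u : ZMod q) = 1 := by
      have := congrArg Units.val hu
      simpa [ZMod.unitsMap_def] using this
    have h2 := hcon u h1
    ext
    rw [MulChar.coe_toUnitHom, h2, Units.val_one]
  have h3 : χ.conductor ≤ d := Nat.sInf_le hf
  rw [(DirichletCharacter.isPrimitive_def χ).mp hp] at h3
  omega

lemma unit_form (q d : ℕ) [NeZero q] (hd : d ∣ q) (x : ZMod q)
    (hx : (ZMod.castHom hd (ZMod d)) x = 1) : ∃ t : ℤ, x = 1 + (d : ZMod q) * t := by
  obtain ⟨n, rfl⟩ := ZMod.intCast_surjective x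
  rw [map_intCast] at hx
  have : ((n - 1 : ℤ) : ZMod d) = 0 := by push_cast; rw [hx]; ring
  rw [ZMod.intCast_zmod_eq_zero_iff_dvd] at this
  obtain ⟨t, ht⟩ := this
  refine ⟨t, ?_⟩
  have : n = 1 + d * t := by linarith
  rw [this]; push_cast; ring

lemma real_unit_val (q : ℕ) [NeZero q] (χ : DirichletCharacter ℂ q)
    (hreal : ∀ n : ZMod q, (starRingEnd ℂ) (χ n) = χ n) (x : ZMod q) (hu : IsUnit x) :
    χ x = 1 ∨ χ x = -1 := by
  have h1 := DirichletCharacter.unit_norm_eq_one χ hu.unit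
  have h2 := (Complex.conj_eq_iff_re.mp (hreal x)).symm
  rw [IsUnit.unit_spec, h2, Complex.norm_real, Real.norm_eq_abs] at h1
  rcases (abs_eq zero_le_one).mp h1 with h | h <;> rw [h2, h] <;> simp

lemma prim_odd (q : ℕ) [NeZero q] (χ : DirichletCharacter ℂ q) (hp : χ.IsPrimitive)
    (hreal : ∀ n : ZMod q, (starRingEnd ℂ) (χ n) = χ n) (p : ℕ) (hpp : p.Prime) (hp2 : p ≠ 2) :
    ¬ p ^ 2 ∣ q := by
  rintro ⟨s, hs⟩
  have hd : p * s ∣ q := ⟨p, by rw [hs]; ring⟩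
  have hq0 := NeZero.ne q
  have hs0 : 0 < s := Nat.pos_of_ne_zero (by rintro rfl; simp at hs; exact hq0 hs)
  have hlt : p * s < q := by
    rw [hs]; have := hpp.two_le; nlinarith [Nat.mul_pos hpp.pos hs0]
  obtain ⟨u, hu1, hu2⟩ := prim_no_factor q χ hp _ hd hlt
  obtain ⟨t, ht⟩ := unit_form q _ hd _ hu1
  have hz : ((p ^ 2 * s : ℕ) : ZMod q) = 0 := by rw [← hs]; simp
  have hpow : (u : ZMod q) ^ p = 1 := by
    rw [ht]
    obtain ⟨c, hc⟩ := (Commute.one_left ((((p * s : ℕ) : ZMod q)) * t)).exists_add_pow_prime_eq hpp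
    rw [hc]
    push_cast at hz ⊢
    obtain ⟨j, rfl⟩ : ∃ j, p = j + 2 := ⟨p - 2, by have := hpp.two_le; omega⟩
    have e : ((((j + 2 : ℕ) : ZMod q)) * s * t) ^ (j + 2) =
        (((j + 2 : ℕ) : ZMod q) ^ 2 * s) * (s * t ^ 2 * ((((j + 2 : ℕ) : ZMod q)) * s * t) ^ j) := by
      ring
    have e2 : ((j + 2 : ℕ) : ZMod q) * 1 * ((((j + 2 : ℕ) : ZMod q)) * s * t) * c =
        (((j + 2 : ℕ) : ZMod q) ^ 2 * s) * (t * c) := by ring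
    push_cast at e e2 hz ⊢
    rw [e, e2, hz]; ring
  have h1 : χ (u : ZMod q) ^ p = 1 := by rw [← map_pow, hpow, map_one]
  rcases real_unit_val q χ hreal u u.isUnit with h | h
  · exact hu2 h
  · rw [h, (hpp.odd_of_ne_two hp2).neg_one_pow] at h1
    norm_num at h1

lemma prim_two (q : ℕ) [NeZero q] (χ : DirichletCharacter ℂ q) (hp : χ.IsPrimitive)
    (hreal : ∀ n : ZMod q, (starRingEnd ℂ) (χ n) = χ n) : ¬ 2 ^ 4 ∣ q := by
  rintro ⟨s, hs⟩
  have hd : 8 * s ∣ q := ⟨2, by rw [hs]; ring⟩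
  have hq0 := NeZero.ne q
  have hlt : 8 * s < q := by omega
  obtain ⟨u, hu1, hu2⟩ := prim_no_factor q χ hp _ hd hlt
  obtain ⟨t, ht⟩ := unit_form q _ hd _ hu1
  have hz : ((2 ^ 4 * s : ℕ) : ZMod q) = 0 := by rw [← hs]; simp
  set v : ZMod q := 1 + 4 * s * t with hv
  have hvu : v * v = u := by
    rw [ht, hv]
    have : (1 + 4 * (s:ZMod q) * t) * (1 + 4 * s * t) = 1 + ((8 * s : ℕ) : ZMod q) * t +
      ((2 ^ 4 * s : ℕ) : ZMod q) * (s * t ^ 2) := by push_cast; ring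
    rw [this, hz]; ring
  have hvunit : IsUnit v := isUnit_of_mul_isUnit_left (hvu ▸ u.isUnit)
  apply hu2
  rw [← hvu, map_mul]
  rcases real_unit_val q χ hreal v hvunit with h | h <;> rw [h] <;> norm_num

lemma real_char_quadratic (p : ℕ) [Fact p.Prime] (g : ZMod p →* ℝ)
    (h0 : g 0 = 0) (h1 : ∀ x, x ≠ 0 → g x = 1 ∨ g x = -1) (hn : ∃ x, x ≠ 0 ∧ g x ≠ 1) (x : ZMod p) :
    g x = ((quadraticChar (ZMod p) x : ℤ) : ℝ) := by
  have hsq : ∀ y : ZMod p, y ≠ 0 → IsSquare y → g y = 1 := by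
    rintro y hy ⟨z, rfl⟩
    have hz : z ≠ 0 := by rintro rfl; simp at hy
    rw [map_mul]
    rcases h1 z hz with h | h <;> rw [h] <;> norm_num
  obtain ⟨a, ha0, ha⟩ := hn
  have ha1 : g a = -1 := (h1 a ha0).resolve_left ha
  have hansq : ¬ IsSquare a := fun h => ha (hsq a ha0 h)
  have hqa : quadraticChar (ZMod p) a = -1 := quadraticChar_neg_one_iff_not_isSquare.mpr hansq
  by_cases hx : x = 0
  · rw [hx, h0, quadraticChar_zero]; simp
  by_cases hs : IsSquare x
  · rw [hsq x hx hs, (quadraticChar_one_iff_isSquare hx).mpr hs]; simp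
  · have hqx : quadraticChar (ZMod p) x = -1 := quadraticChar_neg_one_iff_not_isSquare.mpr hs
    have h2 : IsSquare (a * x) := by
      rw [← quadraticChar_one_iff_isSquare (mul_ne_zero ha0 hx), map_mul, hqa, hqx]; norm_num
    have h3 := hsq _ (mul_ne_zero ha0 hx) h2
    rw [map_mul, ha1] at h3
    rw [hqx]; push_cast; linarith

lemma chi_local (q : ℕ) [NeZero q] (χ : DirichletCharacter ℂ q) (hp : χ.IsPrimitive)
    (hreal : ∀ n : ZMod q, (starRingEnd ℂ) (χ n) = χ n) :
    ∃ X : q.primeFactors → (ℤ →* ℝ),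
      (∀ n : ℤ, χ (n : ZMod q) = ((∏ p, X p n : ℝ) : ℂ)) ∧
      (∀ (p : q.primeFactors) (n n' : ℤ),
        (((p : ℕ) ^ q.factorization p : ℕ) : ℤ) ∣ n - n' → X p n = X p n') ∧
      (∀ (p : q.primeFactors) (n : ℤ), ¬ ((p : ℕ) : ℤ) ∣ n → |X p n| = 1) ∧
      (∀ (p : q.primeFactors) (n : ℤ), ((p : ℕ) : ℤ) ∣ n → X p n = 0) ∧
      (∀ (p : q.primeFactors), (p : ℕ) ≠ 2 → ∀ [Fact (p : ℕ).Prime] (n : ℤ),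
        X p n = ((quadraticChar (ZMod p) (n : ZMod p) : ℤ) : ℝ)) := by
  have hq0 := NeZero.ne q
  set π := ZMod.equivPi q hq0
  let Y : (p : q.primeFactors) → ZMod ((p : ℕ) ^ q.factorization p) →* ZMod q := fun p =>
    (π.symm.toMulEquiv.toMonoidHom).comp
      (MonoidHom.mulSingle (fun p : q.primeFactors => ZMod ((p : ℕ) ^ q.factorization p)) p)
  have hre : ∀ x : ZMod q, χ x = ((χ x).re : ℂ) := fun x => (Complex.conj_eq_iff_re.mp (hreal x)).symm
  let ρ : ZMod q →* ℝ :=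
    { toFun := fun x => (χ x).re
      map_one' := by simp
      map_mul' := fun a b => by
        have h2 : ((χ (a * b)).re : ℂ) = (((χ a).re * (χ b).re : ℝ) : ℂ) := by
          rw [Complex.ofReal_mul, ← hre, ← hre, ← hre, map_mul]
        exact_mod_cast h2 }
  have hρ : ∀ x, χ x = (ρ x : ℂ) := hre
  have hρu : ∀ x, IsUnit x → ρ x = 1 ∨ ρ x = -1 := by
    intro x hx
    rcases real_unit_val q χ hreal x hx with h | h
    · left; rw [hρ] at h; exact_mod_cast h
    · right; rw [hρ] at h; exact_mod_cast h
  have hρ0 : ∀ x, ¬ IsUnit x → ρ x = 0 := by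
    intro x hx
    have h := MulChar.map_nonunit χ hx
    rw [hρ] at h; exact_mod_cast h
  have hv : ∀ p : q.primeFactors, q.factorization p ≠ 0 := fun p =>
    (Nat.Prime.factorization_pos_of_dvd (Nat.prime_of_mem_primeFactors p.2) hq0
      (Nat.dvd_of_mem_primeFactors p.2)).ne'
  have hYu : ∀ p y, IsUnit y → IsUnit (Y p y) := fun p y h => h.map (Y p)
  have hYn : ∀ p y, ¬ IsUnit y → ¬ IsUnit (Y p y) := by
    intro p y hy h
    apply hy
    have h2 : IsUnit (π (Y p y)) := h.map π
    have h3 : π (Y p y) = Pi.mulSingle p y := π.apply_symm_apply _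
    rw [h3, Pi.isUnit_iff] at h2
    simpa using h2 p
  have hunit : ∀ (p : q.primeFactors) (n : ℤ),
      IsUnit ((n : ZMod ((p : ℕ) ^ q.factorization p))) ↔ ¬ ((p : ℕ) : ℤ) ∣ n := by
    intro p n
    have hpp := Nat.prime_of_mem_primeFactors p.2
    rw [ZMod.coe_int_isUnit_iff_isCoprime, Nat.cast_pow, IsCoprime.pow_left_iff (Nat.pos_of_ne_zero (hv p)),
      (Nat.prime_iff_prime_int.mp hpp).coprime_iff_not_dvd]
  refine ⟨fun p => (ρ.comp (Y p)).comp (Int.castRingHom (ZMod ((p : ℕ) ^ q.factorization p))).toMonoidHom,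
    ?_, ?_, ?_, ?_, ?_⟩
  · intro n
    rw [hρ]
    congr 1
    show ρ n = ∏ p : q.primeFactors, ρ (Y p (n : ZMod ((p : ℕ) ^ q.factorization p)))
    rw [← map_prod]
    congr 1
    apply π.injective
    rw [map_prod]
    have : ∀ p : q.primeFactors, π (Y p (n : ZMod ((p : ℕ) ^ q.factorization p))) =
        Pi.mulSingle p ((π (n : ZMod q)) p) := by
      intro p
      rw [show π (Y p (n : ZMod ((p : ℕ) ^ q.factorization p))) = Pi.mulSingle p _ from π.apply_symm_apply _]
      rw [map_intCast, Pi.intCast_apply]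
    rw [Finset.prod_congr rfl fun p _ => this p, Finset.univ_prod_mulSingle]
  · intro p n n' h
    show ρ (Y p (n : ZMod _)) = ρ (Y p (n' : ZMod _))
    rw [(ZMod.intCast_eq_intCast_iff_dvd_sub n' n _).mpr h]
  · intro p n h
    have := hρu _ (hYu p _ ((hunit p n).mpr h))
    show |ρ (Y p (n : ZMod _))| = 1
    rcases this with h | h <;> rw [h] <;> simp
  · intro p n h
    exact hρ0 _ (hYn p _ fun h2 => (hunit p n).mp h2 h)
  · intro p hp2 _ n
    have hpp := Nat.prime_of_mem_primeFactors p.2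
    have hv1 : q.factorization p = 1 := by
      have h1 := prim_odd q χ hp hreal p hpp hp2
      have h2 := hv p
      rw [hpp.pow_dvd_iff_le_factorization hq0] at h1
      omega
    have hpow : (p : ℕ) ^ q.factorization p = p := by rw [hv1, pow_one]
    let e : ZMod p ≃+* ZMod ((p : ℕ) ^ q.factorization p) := ZMod.ringEquivCongr hpow.symm
    have key := real_char_quadratic p ((ρ.comp (Y p)).comp e.toMulEquiv.toMonoidHom) ?_ ?_ ?_ n
    · rw [← key]
      show ρ (Y p (n : ZMod _)) = ρ (Y p (e (n : ZMod p)))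
      rw [show e (n : ZMod p) = (n : ZMod _) from map_intCast e n]
    · show ρ (Y p (e 0)) = 0
      rw [map_zero]
      refine hρ0 _ (hYn p _ ?_)
      have := (hunit p 0).not.mpr (by simp)
      simpa using this
    · intro x hx
      exact hρu _ (hYu p _ ((IsUnit.mk0 x hx).map e))
    · have hdvd : q / p ∣ q := Nat.div_dvd_of_dvd (Nat.dvd_of_mem_primeFactors p.2)
      obtain ⟨u, hu1, hu2⟩ := prim_no_factor q χ hp _ hdvd
        (Nat.div_lt_self (Nat.pos_of_ne_zero hq0) hpp.one_lt)
      obtain ⟨t, ht⟩ := unit_form q _ hdvd _ hu1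
      have hYp : Y p (π u p) = u := by
        apply π.injective
        rw [show π (Y p (π u p)) = Pi.mulSingle p _ from π.apply_symm_apply _]
        ext p'
        by_cases hpp' : p' = p
        · subst hpp'; simp
        · rw [Pi.mulSingle_eq_of_ne hpp', ht]
          simp only [map_add, map_one, map_mul, map_natCast, map_intCast, Pi.add_apply, Pi.one_apply,
            Pi.mul_apply, Pi.natCast_apply, Pi.intCast_apply]
          have : ((q / (p : ℕ) : ℕ) : ZMod ((p' : ℕ) ^ q.factorization p')) = 0 := by
            rw [ZMod.natCast_eq_zero_iff]
            have hc : Nat.Coprime ((p' : ℕ) ^ q.factorization p') p :=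
              Nat.Coprime.pow_left _ ((Nat.coprime_primes (Nat.prime_of_mem_primeFactors p'.2) hpp).mpr
                (fun h => hpp' (Subtype.ext h)))
            apply hc.dvd_of_dvd_mul_left
            rw [Nat.mul_div_cancel' (Nat.dvd_of_mem_primeFactors p.2)]
            exact Nat.ordProj_dvd q p'
          rw [this]; simp
      have hup : IsUnit (π (u : ZMod q) p) := Pi.isUnit_iff.mp (u.isUnit.map π) p
      refine ⟨e.symm (π u p), ?_, ?_⟩
      · exact (hup.map e.symm).ne_zero
      · show ρ (Y p (e (e.symm (π u p)))) ≠ 1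
        rw [e.apply_symm_apply, hYp]
        intro h
        apply hu2
        rw [hρ, h]; simp

/-- The linear forms in the Gowers norm. -/
def ell {k : ℕ} {R : Type*} [AddCommMonoid R] (ω : Fin k → Bool) (x : Option (Fin k) → R) : R :=
  x none + ∑ i, if ω i then x (some i) else 0

lemma ell_cast {k : ℕ} {R S : Type*} [Ring R] [Ring S] (f : R →+* S) (ω : Fin k → Bool)
    (x : Option (Fin k) → R) : f (ell ω x) = ell ω (fun i => f (x i)) := by
  unfold ell
  rw [map_add, map_sum]
  congr 1
  refine Finset.sum_congr rfl fun i _ => ?_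
  split_ifs <;> simp

lemma ell_add {k : ℕ} {R : Type*} [AddCommMonoid R] (ω : Fin k → Bool)
    (x y : Option (Fin k) → R) : ell ω (fun i => x i + y i) = ell ω x + ell ω y := by
  unfold ell
  rw [add_add_add_comm, ← Finset.sum_add_distrib]
  congr 1
  refine Finset.sum_congr rfl fun i _ => ?_
  split_ifs <;> simp

lemma ell_mul {k : ℕ} {R : Type*} [Ring R] (ω : Fin k → Bool) (c : R)
    (x : Option (Fin k) → R) : ell ω (fun i => c * x i) = c * ell ω x := by
  unfold ell
  rw [mul_add, Finset.mul_sum]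
  congr 1
  refine Finset.sum_congr rfl fun i _ => ?_
  split_ifs <;> simp

lemma ell_dvd {k : ℕ} (ω : Fin k → Bool) (a : ℤ) (x y : Option (Fin k) → ℤ)
    (h : ∀ i, a ∣ x i - y i) : a ∣ ell ω x - ell ω y := by
  unfold ell
  rw [add_sub_add_comm, ← Finset.sum_sub_distrib]
  refine dvd_add (h _) (Finset.dvd_sum fun i _ => ?_)
  split_ifs
  · exact h _
  · simp

lemma crt_sum {P ι : Type*} [Fintype P] [DecidableEq P] [Fintype ι] [DecidableEq ι] (a : P → ℕ)
    (ha : Pairwise (Function.onFun Nat.Coprime a)) (hpos : ∀ p, 0 < a p)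
    (F : P → (ι → ℤ) → ℝ)
    (hF : ∀ p x y, (∀ i, (a p : ℤ) ∣ x i - y i) → F p x = F p y) :
    ∑ z : ι → Fin (∏ p, a p), ∏ p, F p (fun i => ((z i : ℕ) : ℤ)) =
      ∏ p, ∑ z : ι → Fin (a p), F p (fun i => ((z i : ℕ) : ℤ)) := by
  rw [Finset.prod_univ_sum, Fintype.piFinset_univ]
  let f : (ι → Fin (∏ p, a p)) → ((p : P) → ι → Fin (a p)) := fun z p i =>
    ⟨(z i : ℕ) % a p, Nat.mod_lt _ (hpos p)⟩
  have hbij : Function.Bijective f := by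
    rw [Fintype.bijective_iff_injective_and_card]
    constructor
    · intro z z' h
      ext i
      have h1 : ∀ p, (z i : ℕ) ≡ z' i [MOD a p] := fun p =>
        Fin.ext_iff.mp (congrFun (congrFun h p) i)
      have h2 : ((∏ p, a p : ℕ) : ℤ) ∣ ((z' i : ℕ) : ℤ) - ((z i : ℕ) : ℤ) := by
        push_cast
        refine Fintype.prod_dvd_of_coprime (fun p p' hp => ?_) fun p => (Nat.modEq_iff_dvd.mp (h1 p))
        exact Nat.isCoprime_iff_coprime.mpr (ha hp)
      have h3 := Nat.modEq_iff_dvd.mpr h2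
      exact Nat.ModEq.eq_of_lt_of_lt h3 (z i).2 (z' i).2
    · simp only [Fintype.card_pi, Fintype.card_fin, Finset.prod_const, Finset.card_univ]
      rw [Finset.prod_pow]
  refine Fintype.sum_bijective f hbij _ _ fun z => ?_
  refine Finset.prod_congr rfl fun p _ => hF p _ _ fun i => ?_
  show (a p : ℤ) ∣ ((z i : ℕ) : ℤ) - (((z i : ℕ) % a p : ℕ) : ℤ)
  exact Int.dvd_self_sub_of_emod_eq (by push_cast; rfl)

lemma scale_sum {ι : Type*} [Fintype ι] [DecidableEq ι] (a b : ℕ) (F : (ι → ℤ) → ℝ)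
    (hF : ∀ x y, (∀ i, (a : ℤ) ∣ x i - y i) → F x = F y) :
    ∑ z : ι → Fin (b * a), F (fun i => ((z i : ℕ) : ℤ)) =
      (b : ℝ) ^ Fintype.card ι * ∑ z : ι → Fin a, F (fun i => ((z i : ℕ) : ℤ)) := by
  let e : (ι → Fin b) × (ι → Fin a) ≃ (ι → Fin (b * a)) :=
    (Equiv.arrowProdEquivProdArrow ι (fun _ => Fin b) (fun _ => Fin a)).symm.trans
      (Equiv.piCongrRight fun _ => finProdFinEquiv)
  rw [← e.sum_comp, Fintype.sum_prod_type]
  have : ∀ (x : ι → Fin b) (y : ι → Fin a), F (fun i => ((e (x, y) i : ℕ) : ℤ)) =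
      F (fun i => ((y i : ℕ) : ℤ)) := by
    intro x y
    apply hF
    intro i
    show (a : ℤ) ∣ (((y i : ℕ) + a * (x i : ℕ) : ℕ) : ℤ) - _
    push_cast
    rw [add_sub_cancel_left]
    exact dvd_mul_right _ _
  simp_rw [this]
  rw [Finset.sum_const, Finset.card_univ, nsmul_eq_mul]
  simp

lemma sum_fin_zmod {k : ℕ} (p : ℕ) [NeZero p] (F : (Option (Fin k) → ZMod p) → ℝ) :
    ∑ z : Option (Fin k) → Fin p, F (fun i => (((z i : ℕ) : ℤ) : ZMod p)) =
      ∑ h : Fin k → ZMod p, ∑ n : ZMod p, F (fun o => Option.elim o n h) := by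
  have hb : Function.Bijective (fun (z : Option (Fin k) → Fin p) (i : Option (Fin k)) =>
      (((z i : ℕ) : ℤ) : ZMod p)) := by
    rw [Fintype.bijective_iff_injective_and_card]
    refine ⟨fun z z' h => ?_, by simp [ZMod.card]⟩
    ext i
    have h1 := congrFun h i
    simp only [Int.cast_natCast] at h1
    rw [ZMod.natCast_eq_natCast_iff] at h1
    exact Nat.ModEq.eq_of_lt_of_lt h1 (z i).2 (z' i).2
  rw [Fintype.sum_bijective _ hb _ F fun z => rfl]
  rw [← (Equiv.piOptionEquivProd (β := fun _ => ZMod p)).symm.sum_comp, Fintype.sum_prod_type,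
    Finset.sum_comm]
  refine Finset.sum_congr rfl fun h _ => Finset.sum_congr rfl fun n _ => ?_
  congr 1
  ext o
  cases o <;> rfl

lemma local_triv {k : ℕ} (p b : ℕ) [Fact p.Prime] (ω : Fin k → Bool) (F : (Option (Fin k) → ℤ) → ℝ)
    (hF1 : ∀ x, |F x| ≤ 1) (hF0 : ∀ x, ¬ (p : ℤ) ∣ ell ω x → F x = 0) :
    |∑ z : Option (Fin k) → Fin (b * p), F (fun i => ((z i : ℕ) : ℤ))| ≤
      (b : ℝ) ^ (k + 1) * (p : ℝ) ^ k := by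
  refine (Finset.abs_sum_le_sum_abs _ _).trans ?_
  let I : (Option (Fin k) → ℤ) → ℝ := fun x => if (ell ω (fun i => (x i : ZMod p)) : ZMod p) = 0 then 1 else 0
  have hI : ∀ x, ((ell ω (fun i => (x i : ZMod p)) : ZMod p) = 0) ↔ (p : ℤ) ∣ ell ω x := by
    intro x
    have := ell_cast (Int.castRingHom (ZMod p)) ω x
    simp only [eq_intCast] at this
    rw [← this, ZMod.intCast_zmod_eq_zero_iff_dvd]
  have h1 : ∀ x, |F x| ≤ I x := by
    intro x
    by_cases h : (p : ℤ) ∣ ell ω x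
    · simp only [I, if_pos ((hI x).mpr h)]; exact hF1 x
    · rw [hF0 x h, abs_zero]; simp only [I]; split_ifs <;> norm_num
  refine (Finset.sum_le_sum fun z _ => h1 _).trans ?_
  rw [scale_sum p b I]
  · have : ∑ z : Option (Fin k) → Fin p, I (fun i => ((z i : ℕ) : ℤ)) = (p : ℝ) ^ k := by
      have h2 := sum_fin_zmod (k := k) p (fun x => if ell ω x = 0 then (1:ℝ) else 0)
      have h3 : ∀ h : Fin k → ZMod p, ∑ n : ZMod p,
          (if ell ω (fun o => Option.elim o n h) = 0 then (1:ℝ) else 0) = 1 := by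
        intro h
        have : ∀ n : ZMod p, (ell ω (fun o => Option.elim o n h) = 0) ↔
            n = -(∑ i, if ω i then h i else 0) := by
          intro n
          unfold ell
          simp only [Option.elim]
          exact add_eq_zero_iff_eq_neg
        simp_rw [this]
        simp
      rw [Finset.sum_congr rfl fun h _ => h3 h] at h2
      refine h2.trans ?_
      simp [ZMod.card]
    rw [this]
    simp
  · intro x y h
    simp only [I]
    have : (fun i => (x i : ZMod p)) = fun i => (y i : ZMod p) := by
      ext i
      rw [(ZMod.intCast_eq_intCast_iff_dvd_sub _ _ _).mpr (h i)]
    rw [this]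

lemma bad_count {k : ℕ} (p : ℕ) [Fact p.Prime] (ω ω' : Fin k → Bool) (hne : ω ≠ ω') :
    ((Finset.univ.filter fun h : Fin k → ZMod p =>
      (∑ i, if ω i then h i else 0) = ∑ i, if ω' i then h i else 0).card) * p ≤ p ^ k := by
  obtain ⟨i, hi⟩ := Function.ne_iff.mp hne
  have hk : 1 ≤ k := by have := i.2; omega
  have h1 : (Finset.univ.filter fun h : Fin k → ZMod p =>
      (∑ i, if ω i then h i else 0) = ∑ i, if ω' i then h i else 0).card ≤
      Fintype.card ({j : Fin k // j ≠ i} → ZMod p) := by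
    rw [← Finset.card_univ]
    refine Finset.card_le_card_of_injOn (fun h j => h j) (fun _ _ => Finset.mem_coe.mpr (Finset.mem_univ _)) ?_
    intro h hh h' hh' heq
    have hE : ∀ j, j ≠ i → h j = h' j := fun j hj => congrFun heq ⟨j, hj⟩
    simp only [Finset.coe_filter, Finset.mem_univ, true_and, Set.mem_ofPred_eq] at hh hh'
    have e1 : ∀ v : Fin k → Bool, (∑ j, if v j then h j else 0) - (∑ j, if v j then h' j else 0) =
        if v i then h i - h' i else 0 := by
      intro v
      rw [← Finset.sum_sub_distrib, Finset.sum_eq_single i]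
      · split_ifs <;> simp
      · intro j _ hj
        rw [hE j hj, sub_self]
      · intro h; exact absurd (Finset.mem_univ _) h
    have e2 := e1 ω
    rw [hh, hh', e1 ω'] at e2
    ext j
    by_cases hj : j = i
    · subst hj
      rw [← sub_eq_zero]
      cases h1 : ω j <;> cases h2 : ω' j <;> simp_all
    · exact hE j hj
  have h2 : Fintype.card ({j : Fin k // j ≠ i} → ZMod p) = p ^ (k - 1) := by
    simp [ZMod.card]
  calc _ ≤ p ^ (k - 1) * p := Nat.mul_le_mul_right _ (h2 ▸ h1)
    _ = p ^ k := by rw [← pow_succ]; congr 1; omega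

lemma local_weil (k : ℕ) : ∃ K : ℝ, 1 ≤ K ∧ ∀ (p b : ℕ) [Fact p.Prime],
    |∑ z : Option (Fin k) → Fin (b * p), ∏ ω : Fin k → Bool,
      ((quadraticChar (ZMod p) ((ell ω (fun i => ((z i : ℕ) : ℤ)) : ℤ) : ZMod p) : ℤ) : ℝ)| ≤
      K * (b : ℝ) ^ (k + 1) * (p : ℝ) ^ k * √p := by
  obtain ⟨C, hC, hW⟩ := weil_bound (2 ^ k)
  refine ⟨C + 4 ^ k, by have := one_le_pow₀ (n := k) (show (1:ℝ) ≤ 4 by norm_num); linarith, fun p b _ => ?_⟩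
  have hp0 : (0:ℝ) < p := by exact_mod_cast (Fact.out : p.Prime).pos
  have hp1 : (1:ℝ) ≤ p := by exact_mod_cast (Fact.out : p.Prime).one_lt.le
  have hcast : ∀ (ω : Fin k → Bool) (x : Option (Fin k) → ℤ),
      ((ell ω x : ℤ) : ZMod p) = ell ω (fun i => (x i : ZMod p)) := by
    intro ω x
    have := ell_cast (Int.castRingHom (ZMod p)) ω x
    simpa only [eq_intCast] using this
  have h0 := scale_sum (ι := Option (Fin k)) p b (fun x => ∏ ω : Fin k → Bool,
      ((quadraticChar (ZMod p) ((ell ω x : ℤ) : ZMod p) : ℤ) : ℝ)) (by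
        intro x y h
        refine Finset.prod_congr rfl fun ω _ => ?_
        rw [(ZMod.intCast_eq_intCast_iff_dvd_sub _ _ _).mpr (ell_dvd ω p x y h)])
  rw [h0, abs_mul, Fintype.card_option, Fintype.card_fin, abs_of_nonneg (by positivity)]
  have h1 := sum_fin_zmod (k := k) p (fun x => ∏ ω : Fin k → Bool,
      ((quadraticChar (ZMod p) (ell ω x) : ℤ) : ℝ))
  have h2 : ∀ z : Option (Fin k) → Fin p, ∏ ω : Fin k → Bool,
      ((quadraticChar (ZMod p) ((ell ω (fun i => ((z i : ℕ) : ℤ)) : ℤ) : ZMod p) : ℤ) : ℝ) =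
      ∏ ω : Fin k → Bool,
      ((quadraticChar (ZMod p) (ell ω (fun i => (((z i : ℕ) : ℤ) : ZMod p))) : ℤ) : ℝ) := by
    intro z
    refine Finset.prod_congr rfl fun ω _ => ?_
    rw [hcast]
  rw [Finset.sum_congr rfl fun z _ => h2 z, h1]
  let s : (Fin k → ZMod p) → (Fin k → Bool) → ZMod p := fun h ω => ∑ i, if ω i then h i else 0
  have hqc : ∀ y : ZMod p, |((quadraticChar (ZMod p) y : ℤ) : ℝ)| ≤ 1 := by
    intro y
    by_cases hy : y = 0
    · rw [hy, quadraticChar_zero]; simp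
    · rcases quadraticChar_dichotomy hy with h | h <;> rw [h] <;> simp
  have hinner : ∀ h : Fin k → ZMod p, |∑ n : ZMod p, ∏ ω : Fin k → Bool,
      ((quadraticChar (ZMod p) (ell ω (fun o => Option.elim o n h)) : ℤ) : ℝ)| ≤
      C * √p + ∑ ω : Fin k → Bool, ∑ ω' : Fin k → Bool,
        if ω ≠ ω' ∧ s h ω = s h ω' then (p : ℝ) else 0 := by
    intro h
    by_cases hinj : Function.Injective (s h)
    · have hw := hW p (Finset.univ.image (s h)) (by simp) (Finset.card_image_le.trans (by simp))
      have : ∑ n : ZMod p, ∏ ω : Fin k → Bool,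
          ((quadraticChar (ZMod p) (ell ω (fun o => Option.elim o n h)) : ℤ) : ℝ) =
          ((∑ x : ZMod p, ∏ a ∈ Finset.univ.image (s h), quadraticChar (ZMod p) (x + a) : ℤ) : ℝ) := by
        push_cast
        refine Finset.sum_congr rfl fun n _ => ?_
        rw [Finset.prod_image fun a _ b _ hab => hinj hab]
        rfl
      rw [this]
      refine hw.trans (le_add_of_nonneg_right ?_)
      refine Finset.sum_nonneg fun _ _ => Finset.sum_nonneg fun _ _ => ?_
      split_ifs <;> positivity
    · rw [Function.Injective] at hinj
      push Not at hinj
      obtain ⟨ω, ω', h1, h2⟩ := hinj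
      have h3 : |∑ n : ZMod p, ∏ ω : Fin k → Bool,
          ((quadraticChar (ZMod p) (ell ω (fun o => Option.elim o n h)) : ℤ) : ℝ)| ≤ p := by
        refine (Finset.abs_sum_le_sum_abs _ _).trans ?_
        refine (Finset.sum_le_sum (g := fun _ => (1:ℝ)) fun n _ => ?_).trans (by simp [ZMod.card])
        rw [Finset.abs_prod]
        exact Finset.prod_le_one (fun _ _ => abs_nonneg _) fun _ _ => hqc _
      have h4 : (p : ℝ) ≤ ∑ ω : Fin k → Bool, ∑ ω' : Fin k → Bool,
        if ω ≠ ω' ∧ s h ω = s h ω' then (p : ℝ) else 0 := by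
        have nn : ∀ a b : Fin k → Bool, 0 ≤ (if a ≠ b ∧ s h a = s h b then (p : ℝ) else 0) := by
          intro a b; split_ifs <;> positivity
        calc (p : ℝ) = if ω ≠ ω' ∧ s h ω = s h ω' then (p : ℝ) else 0 := by rw [if_pos ⟨h2, h1⟩]
          _ ≤ ∑ ω' : Fin k → Bool, if ω ≠ ω' ∧ s h ω = s h ω' then (p : ℝ) else 0 :=
            Finset.single_le_sum (f := fun ω' => if ω ≠ ω' ∧ s h ω = s h ω' then (p : ℝ) else 0)
              (fun b _ => nn _ b) (Finset.mem_univ ω')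
          _ ≤ _ := Finset.single_le_sum (f := fun ω => ∑ ω' : Fin k → Bool, if ω ≠ ω' ∧ s h ω = s h ω' then (p : ℝ) else 0)
              (fun a _ => Finset.sum_nonneg fun b _ => nn a b) (Finset.mem_univ ω)
      have : 0 ≤ C * √p := by positivity
      linarith
  have hbad : ∑ h : Fin k → ZMod p, ∑ ω : Fin k → Bool, ∑ ω' : Fin k → Bool,
        (if ω ≠ ω' ∧ s h ω = s h ω' then (p : ℝ) else 0) ≤ 4 ^ k * (p : ℝ) ^ k := by
    rw [Finset.sum_comm]
    have : ∀ ω : Fin k → Bool, ∑ h : Fin k → ZMod p, ∑ ω' : Fin k → Bool,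
        (if ω ≠ ω' ∧ s h ω = s h ω' then (p : ℝ) else 0) ≤ 2 ^ k * (p : ℝ) ^ k := by
      intro ω
      rw [Finset.sum_comm]
      refine (Finset.sum_le_sum (g := fun _ => (p : ℝ) ^ k) fun ω' _ => ?_).trans (by simp)
      by_cases hne : ω = ω'
      · simp [hne]
      · have := bad_count p ω ω' hne
        simp only [ne_eq, hne, not_false_eq_true, true_and]
        rw [← Finset.sum_filter, Finset.sum_const, nsmul_eq_mul]
        exact_mod_cast this
    refine (Finset.sum_le_sum fun ω _ => this ω).trans ?_
    rw [Finset.sum_const, Finset.card_univ, nsmul_eq_mul]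
    simp only [Fintype.card_pi, Fintype.card_bool, Finset.prod_const, Finset.card_univ, Fintype.card_fin]
    push_cast
    rw [show (4:ℝ) = 2 * 2 by norm_num, mul_pow]
    exact le_of_eq (by ring)
  have htot : |∑ h : Fin k → ZMod p, ∑ n : ZMod p, ∏ ω : Fin k → Bool,
      ((quadraticChar (ZMod p) (ell ω (fun o => Option.elim o n h)) : ℤ) : ℝ)| ≤
      (C + 4 ^ k) * (p : ℝ) ^ k * √p := by
    refine (Finset.abs_sum_le_sum_abs _ _).trans ((Finset.sum_le_sum fun h _ => hinner h).trans ?_)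
    rw [Finset.sum_add_distrib, Finset.sum_const, Finset.card_univ, nsmul_eq_mul]
    have h5 : (Fintype.card (Fin k → ZMod p) : ℝ) = (p : ℝ) ^ k := by simp [ZMod.card]
    rw [h5]
    have h6 : (1:ℝ) ≤ √p := Real.one_le_sqrt.mpr hp1
    have h7 : (4:ℝ) ^ k * (p : ℝ) ^ k ≤ 4 ^ k * (p : ℝ) ^ k * √p :=
      le_mul_of_one_le_right (by positivity) h6
    calc _ ≤ (p : ℝ) ^ k * (C * √p) + 4 ^ k * (p : ℝ) ^ k * √p := by linarith
      _ = _ := by ring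
  calc _ ≤ (b : ℝ) ^ (k + 1) * ((C + 4 ^ k) * (p : ℝ) ^ k * √p) :=
        mul_le_mul_of_nonneg_left htot (by positivity)
    _ = _ := by ring

/-- Local components of a real primitive character. -/
structure LocChar (q : ℕ) (X : q.primeFactors → (ℤ →* ℝ)) : Prop where
  per : ∀ (p : q.primeFactors) (n n' : ℤ),
        (((p : ℕ) ^ q.factorization p : ℕ) : ℤ) ∣ n - n' → X p n = X p n'
  unit : ∀ (p : q.primeFactors) (n : ℤ), ¬ ((p : ℕ) : ℤ) ∣ n → |X p n| = 1
  zero : ∀ (p : q.primeFactors) (n : ℤ), ((p : ℕ) : ℤ) ∣ n → X p n = 0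
  quad : ∀ (p : q.primeFactors), (p : ℕ) ≠ 2 → ∀ [Fact (p : ℕ).Prime] (n : ℤ),
        X p n = ((quadraticChar (ZMod p) (n : ZMod p) : ℤ) : ℝ)
  odd : ∀ (p : q.primeFactors), (p : ℕ) ≠ 2 → q.factorization p = 1
  two : ∀ (p : q.primeFactors), (p : ℕ) = 2 → q.factorization p ≤ 3

lemma locChar_exists (q : ℕ) [NeZero q] (χ : DirichletCharacter ℂ q) (hp : χ.IsPrimitive)
    (hreal : ∀ n : ZMod q, (starRingEnd ℂ) (χ n) = χ n) :
    ∃ X : q.primeFactors → (ℤ →* ℝ), LocChar q X ∧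
      (∀ n : ℤ, χ (n : ZMod q) = ((∏ p, X p n : ℝ) : ℂ)) := by
  obtain ⟨X, h1, h2, h3, h4, h5⟩ := chi_local q χ hp hreal
  refine ⟨X, ⟨h2, h3, h4, h5, ?_, ?_⟩, h1⟩
  · intro p hp2
    have hpp := Nat.prime_of_mem_primeFactors p.2
    have h1 := prim_odd q χ hp hreal p hpp hp2
    have h2 := Nat.Prime.factorization_pos_of_dvd hpp (NeZero.ne q) (Nat.dvd_of_mem_primeFactors p.2)
    rw [hpp.pow_dvd_iff_le_factorization (NeZero.ne q)] at h1
    omega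
  · intro p hp2
    have hpp := Nat.prime_of_mem_primeFactors p.2
    have h1 := prim_two q χ hp hreal
    rw [← hp2, hpp.pow_dvd_iff_le_factorization (NeZero.ne q)] at h1
    omega

section psi
variable {q : ℕ} (X : q.primeFactors → (ℤ →* ℝ))

/-- product of the primes in `S`. -/
def eS (S : Finset q.primeFactors) : ℕ := ∏ p ∈ S, (p : ℕ)

/-- twisted dilate of the character. -/
noncomputable def thetaS (S : Finset q.primeFactors) (n : ℤ) : ℝ :=
  if ((eS S : ℕ) : ℤ) ∣ n then ∏ p, X p (n / (eS S : ℕ)) else 0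

/-- local factor. -/
noncomputable def tauP (p : q.primeFactors) (b : Prop) (n : ℤ) : ℝ :=
  if b then (if ((p : ℕ) : ℤ) ∣ n then X p (n / (p : ℕ)) else 0) else X p n

/-- the periodic part. -/
noncomputable def psiW (w : Finset q.primeFactors → ℝ) (n : ℤ) : ℝ := ∑ S, w S * thetaS X S n

/-- local modulus. -/
def modP (p : q.primeFactors) : ℕ := (p : ℕ) ^ (q.factorization p + 1)

variable {X}

lemma pf_prime (p : q.primeFactors) : (p : ℕ).Prime := Nat.prime_of_mem_primeFactors p.2

lemma X_abs_le (hX : LocChar q X) (p : q.primeFactors) (n : ℤ) : |X p n| ≤ 1 := by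
  by_cases h : ((p : ℕ) : ℤ) ∣ n
  · rw [hX.zero p n h]; simp
  · rw [hX.unit p n h]

lemma tauP_abs_le (hX : LocChar q X) (p : q.primeFactors) (b : Prop) (n : ℤ) : |tauP X p b n| ≤ 1 := by
  unfold tauP
  split_ifs
  · exact X_abs_le hX _ _
  · simp
  · exact X_abs_le hX _ _

lemma tauP_per (hX : LocChar q X) (p : q.primeFactors) (b : Prop) (n n' : ℤ)
    (h : (modP p : ℤ) ∣ n - n') : tauP X p b n = tauP X p b n' := by
  unfold modP at h
  have hp0 : ((p : ℕ) : ℤ) ≠ 0 := by exact_mod_cast (pf_prime p).ne_zero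
  unfold tauP
  obtain ⟨t, ht⟩ := h
  push_cast at ht
  rw [pow_succ] at ht
  split_ifs with h1 h2 h3 h4
  · apply hX.per
    obtain ⟨a, ha⟩ := h2
    obtain ⟨c, hc⟩ := h3
    rw [ha, hc, Int.mul_ediv_cancel_left _ hp0, Int.mul_ediv_cancel_left _ hp0]
    refine ⟨t, ?_⟩
    push_cast
    apply mul_left_cancel₀ hp0
    rw [ha, hc] at ht
    linear_combination ht
  · exfalso; apply h3
    have : n' = n - ((p:ℕ):ℤ) * (((p:ℕ):ℤ) ^ q.factorization p * t) := by linear_combination -ht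
    rw [this]; exact dvd_sub h2 (dvd_mul_right _ _)
  · exfalso; apply h2
    have : n = n' + ((p:ℕ):ℤ) * (((p:ℕ):ℤ) ^ q.factorization p * t) := by linear_combination ht
    rw [this]; exact dvd_add h4 (dvd_mul_right _ _)
  · rfl
  · apply hX.per
    refine ⟨((p:ℕ):ℤ) * t, ?_⟩
    push_cast
    linear_combination ht

lemma pf_not_dvd_prod (p : q.primeFactors) (S : Finset q.primeFactors) (hp : p ∉ S) :
    ¬ ((p : ℕ) : ℤ) ∣ ((eS S : ℕ) : ℤ) := by
  rw [Int.natCast_dvd_natCast]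
  unfold eS
  rw [(pf_prime p).prime.dvd_finsetProd_iff]
  rintro ⟨r, hr, hd⟩
  rw [Nat.prime_dvd_prime_iff_eq (pf_prime p) (pf_prime r)] at hd
  exact hp (Subtype.ext hd ▸ hr)

lemma eS_dvd (S : Finset q.primeFactors) (n : ℤ) (h : ∀ p ∈ S, ((p : ℕ) : ℤ) ∣ n) :
    ((eS S : ℕ) : ℤ) ∣ n := by
  unfold eS
  push_cast
  refine Finset.prod_dvd_of_coprime (fun p _ r _ hpr => ?_) h
  exact Nat.isCoprime_iff_coprime.mpr ((Nat.coprime_primes (pf_prime p) (pf_prime r)).mpr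
    fun h => hpr (Subtype.ext h))

lemma eS_pos (S : Finset q.primeFactors) : 0 < eS S :=
  Finset.prod_pos fun p _ => (pf_prime p).pos

lemma theta_factor (hX : LocChar q X) (S : Finset q.primeFactors) :
    ∃ κ : ℝ, |κ| = 1 ∧ ∀ n, thetaS X S n = κ * ∏ p, tauP X p (p ∈ S) n := by
  have hκ : |∏ p, X p ((eS (S.erase p) : ℕ) : ℤ)| = 1 := by
    rw [Finset.abs_prod]
    exact Finset.prod_eq_one fun p _ => hX.unit p _ (pf_not_dvd_prod p _ (Finset.notMem_erase p S))
  refine ⟨∏ p, X p ((eS (S.erase p) : ℕ) : ℤ), hκ, fun n => ?_⟩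
  unfold thetaS
  have he0 : ((eS S : ℕ) : ℤ) ≠ 0 := by exact_mod_cast (eS_pos S).ne'
  split_ifs with h
  · obtain ⟨n', rfl⟩ := h
    rw [Int.mul_ediv_cancel_left _ he0]
    have h1 : ∀ p, tauP X p (p ∈ S) (((eS S : ℕ) : ℤ) * n') =
        X p ((eS (S.erase p) : ℕ) : ℤ) * X p n' := by
      intro p
      unfold tauP
      have hp0 : ((p : ℕ) : ℤ) ≠ 0 := by exact_mod_cast (pf_prime p).ne_zero
      split_ifs with h1 h2
      · have : ((eS S : ℕ) : ℤ) * n' = ((p : ℕ) : ℤ) * (((eS (S.erase p) : ℕ) : ℤ) * n') := by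
          unfold eS
          rw [← Finset.mul_prod_erase S _ h1]; push_cast; ring
        rw [this, Int.mul_ediv_cancel_left _ hp0, map_mul]
      · exfalso; apply h2
        apply Dvd.dvd.mul_right
        exact_mod_cast Finset.dvd_prod_of_mem (fun p : q.primeFactors => (p : ℕ)) h1
      · rw [Finset.erase_eq_of_notMem h1, map_mul]
    rw [Finset.prod_congr rfl fun p _ => h1 p, Finset.prod_mul_distrib, ← mul_assoc]
    have : (∏ p, X p ((eS (S.erase p) : ℕ) : ℤ)) * (∏ p, X p ((eS (S.erase p) : ℕ) : ℤ)) = 1 := by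
      rw [← abs_mul_abs_self, hκ, one_mul]
    rw [this, one_mul]
  · have : ∃ p ∈ S, ¬ ((p : ℕ) : ℤ) ∣ n := by
      by_contra hc
      push Not at hc
      exact h (eS_dvd S n hc)
    obtain ⟨p, hp, hpn⟩ := this
    have hz : ∏ p, tauP X p (p ∈ S) n = 0 := by
      refine Finset.prod_eq_zero (Finset.mem_univ p) ?_
      unfold tauP
      rw [if_pos hp, if_neg hpn]
    rw [hz, mul_zero]

lemma modP_pos (p : q.primeFactors) : 0 < modP p := pow_pos (pf_prime p).pos _

lemma modP_coprime : Pairwise (Function.onFun Nat.Coprime (modP : q.primeFactors → ℕ)) := by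
  intro p r h
  exact Nat.Coprime.pow _ _ ((Nat.coprime_primes (pf_prime p) (pf_prime r)).mpr
    fun h' => h (Subtype.ext h'))

lemma psiW_per (hX : LocChar q X) (w : Finset q.primeFactors → ℝ) (n n' : ℤ)
    (h : ((∏ p : q.primeFactors, modP p : ℕ) : ℤ) ∣ n - n') : psiW X w n = psiW X w n' := by
  unfold psiW
  refine Finset.sum_congr rfl fun S _ => ?_
  obtain ⟨κ, _, hκ⟩ := theta_factor hX S
  rw [hκ, hκ]
  congr 2
  refine Finset.prod_congr rfl fun p _ => tauP_per hX p _ _ _ (dvd_trans ?_ h)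
  exact_mod_cast Finset.dvd_prod_of_mem modP (Finset.mem_univ p)

lemma theta_abs_le (hX : LocChar q X) (S : Finset q.primeFactors) (n : ℤ) : |thetaS X S n| ≤ 1 := by
  unfold thetaS
  split_ifs
  · rw [Finset.abs_prod]
    exact Finset.prod_le_one (fun _ _ => abs_nonneg _) fun p _ => X_abs_le hX p _
  · simp

lemma psiW_eq (hX : LocChar q X) (w : Finset q.primeFactors → ℝ) (n : ℤ) :
    psiW X w n = w (Finset.univ.filter fun p : q.primeFactors => ((p : ℕ) : ℤ) ∣ n) *
      thetaS X (Finset.univ.filter fun p : q.primeFactors => ((p : ℕ) : ℤ) ∣ n) n := by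
  unfold psiW
  rw [Finset.sum_eq_single (Finset.univ.filter fun p : q.primeFactors => ((p : ℕ) : ℤ) ∣ n)]
  · intro S _ hS
    rw [mul_eq_zero]; right
    unfold thetaS
    split_ifs with h
    swap
    · rfl
    by_contra hne
    apply hS
    obtain ⟨n', rfl⟩ := h
    have he0 : ((eS S : ℕ) : ℤ) ≠ 0 := by exact_mod_cast (eS_pos S).ne'
    rw [Int.mul_ediv_cancel_left _ he0] at hne
    rw [← ne_eq, Finset.prod_ne_zero_iff] at hne
    ext p
    simp only [Finset.mem_filter, Finset.mem_univ, true_and]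
    constructor
    · intro hp
      apply Dvd.dvd.mul_right
      exact_mod_cast Finset.dvd_prod_of_mem (fun p : q.primeFactors => (p : ℕ)) hp
    · intro hp
      by_contra hpS
      rcases (Nat.prime_iff_prime_int.mp (pf_prime p)).dvd_or_dvd hp with h | h
      · exact pf_not_dvd_prod p S hpS h
      · exact hne p (Finset.mem_univ _) (hX.zero p _ h)
  · intro h; exact absurd (Finset.mem_univ _) h

lemma psiW_abs_le (hX : LocChar q X) (w : Finset q.primeFactors → ℝ) (hw : ∀ S, |w S| ≤ 2) (n : ℤ) :
    |psiW X w n| ≤ 2 := by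
  rw [psiW_eq hX, abs_mul]
  have := mul_le_mul (hw (Finset.univ.filter fun p : q.primeFactors => ((p : ℕ) : ℤ) ∣ n)) (theta_abs_le hX (Finset.univ.filter fun p : q.primeFactors => ((p : ℕ) : ℤ) ∣ n) n)
    (abs_nonneg _) (by norm_num)
  linarith

end psi

lemma local_bound (k : ℕ) : ∃ K : ℝ, 1 ≤ K ∧ ∀ (q : ℕ) (X : q.primeFactors → (ℤ →* ℝ)),
    LocChar q X → ∀ (p : q.primeFactors) (A : (Fin k → Bool) → Prop),
    |∑ z : Option (Fin k) → Fin (modP p), ∏ ω, tauP X p (A ω) (ell ω (fun i => ((z i : ℕ) : ℤ)))| ≤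
      (modP p : ℝ) ^ (k + 1) * (if (p : ℕ) = 2 then 1 else K / √((p : ℕ) : ℝ)) := by
  obtain ⟨K, hK, hW⟩ := local_weil k
  refine ⟨K, hK, fun q X hX p A => ?_⟩
  haveI : Fact (p : ℕ).Prime := ⟨pf_prime p⟩
  have hp0 : (0:ℝ) < (p : ℕ) := by exact_mod_cast (pf_prime p).pos
  have hp1 : (1:ℝ) ≤ (p : ℕ) := by exact_mod_cast (pf_prime p).one_lt.le
  have hle : ∀ x : Option (Fin k) → ℤ, |∏ ω, tauP X p (A ω) (ell ω x)| ≤ 1 := by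
    intro x
    rw [Finset.abs_prod]
    exact Finset.prod_le_one (fun _ _ => abs_nonneg _) fun _ _ => tauP_abs_le hX _ _ _
  split_ifs with hp2
  · refine (Finset.abs_sum_le_sum_abs _ _).trans ?_
    refine (Finset.sum_le_sum (g := fun _ => (1:ℝ)) fun z _ => hle _).trans ?_
    simp
  · have hmod : modP p = (p : ℕ) * p := by
      unfold modP; rw [hX.odd p hp2]; ring
    have hs : √((p : ℕ) : ℝ) * √((p : ℕ) : ℝ) = (p : ℕ) := Real.mul_self_sqrt hp0.le
    have hs0 : 0 < √((p : ℕ) : ℝ) := Real.sqrt_pos.mpr hp0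
    have hs1 : 1 ≤ √((p : ℕ) : ℝ) := Real.one_le_sqrt.mpr hp1
    rw [hmod]
    by_cases hA : ∃ ω, A ω
    · obtain ⟨ω, hω⟩ := hA
      refine (local_triv (p : ℕ) p ω (fun x => ∏ ω, tauP X p (A ω) (ell ω x)) hle ?_).trans ?_
      · intro x hx
        refine Finset.prod_eq_zero (Finset.mem_univ ω) ?_
        unfold tauP
        rw [if_pos hω, if_neg hx]
      · have e : ((((p : ℕ) * (p : ℕ) : ℕ) : ℝ)) ^ (k + 1) * (K / √((p : ℕ) : ℝ)) =
            ((p : ℕ) : ℝ) ^ (k + 1) * ((p : ℕ) : ℝ) ^ k * (K * √((p : ℕ) : ℝ)) := by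
          push_cast
          rw [mul_pow]
          field_simp
          rw [Real.sq_sqrt hp0.le]; ring
        rw [e]
        refine le_mul_of_one_le_right (by positivity) ?_
        nlinarith
    · push Not at hA
      have h1 := hW (p : ℕ) (p : ℕ)
      have h2 : ∀ z : Option (Fin k) → Fin ((p : ℕ) * p), ∏ ω, tauP X p (A ω) (ell ω (fun i => ((z i : ℕ) : ℤ))) =
          ∏ ω : Fin k → Bool, ((quadraticChar (ZMod p) ((ell ω (fun i => ((z i : ℕ) : ℤ)) : ℤ) : ZMod p) : ℤ) : ℝ) := by
        intro z
        refine Finset.prod_congr rfl fun ω _ => ?_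
        unfold tauP
        rw [if_neg (hA ω), hX.quad p hp2]
      rw [Finset.sum_congr rfl fun z _ => h2 z]
      refine h1.trans (le_of_eq ?_)
      push_cast
      rw [mul_pow]
      field_simp
      rw [Real.sq_sqrt hp0.le]; ring

lemma prod_bound (K D : ℝ) (hK : 1 ≤ K) (hD : 1 ≤ D) : ∃ C : ℝ, 0 < C ∧
    ∀ (q : ℕ) [NeZero q] (X : q.primeFactors → (ℤ →* ℝ)), LocChar q X →
    ∏ p : q.primeFactors, (D * (if (p : ℕ) = 2 then 1 else K / √((p : ℕ) : ℝ))) ≤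
      C * (q : ℝ) ^ (-(1/4) : ℝ) := by
  set A : ℝ := 2 * (D * K) with hA
  have hDK : 1 ≤ D * K := by nlinarith
  have hA1 : 1 ≤ A := by rw [hA]; linarith
  set p0 : ℕ := ⌈(D * K) ^ 4⌉₊ + 3 with hp0
  refine ⟨A ^ p0, by positivity, fun q _ X hX => ?_⟩
  have hloc : ∀ p : q.primeFactors, D * (if (p : ℕ) = 2 then 1 else K / √((p : ℕ) : ℝ)) ≤
      (if (p : ℕ) < p0 then A else 1) * ((((p : ℕ) ^ q.factorization p : ℕ)) : ℝ) ^ (-(1/4) : ℝ) := by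
    intro p
    have hpp := pf_prime p
    have hpos : (0:ℝ) < (p : ℕ) := by exact_mod_cast hpp.pos
    by_cases h2 : (p : ℕ) = 2
    · rw [if_pos h2, if_pos (by omega)]
      have h3 := hX.two p h2
      have h4 : ((((p : ℕ) ^ q.factorization p : ℕ)) : ℝ) ≤ 16 := by
        rw [h2]; push_cast
        calc (2:ℝ) ^ q.factorization 2 ≤ 2 ^ 3 := pow_le_pow_right₀ (by norm_num) (by rw [← h2]; exact h3)
          _ ≤ 16 := by norm_num
      have h5 : (16:ℝ) ^ (-(1/4) : ℝ) = 1 / 2 := by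
        rw [show (16:ℝ) = 2 ^ (4:ℝ) by norm_num, ← Real.rpow_mul (by norm_num)]
        norm_num [Real.rpow_neg_one]
      have h6 : (16:ℝ) ^ (-(1/4) : ℝ) ≤ ((((p : ℕ) ^ q.factorization p : ℕ)) : ℝ) ^ (-(1/4) : ℝ) :=
        Real.rpow_le_rpow_of_nonpos (by exact_mod_cast pow_pos hpp.pos _) h4 (by norm_num)
      rw [h5] at h6
      nlinarith
    · rw [if_neg h2, hX.odd p h2, pow_one]
      have e : √((p : ℕ) : ℝ) = ((p : ℕ) : ℝ) ^ (1/4 : ℝ) * ((p : ℕ) : ℝ) ^ (1/4 : ℝ) := by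
        rw [Real.sqrt_eq_rpow, ← Real.rpow_add hpos]; norm_num
      have hy : 0 < ((p : ℕ) : ℝ) ^ (1/4 : ℝ) := by positivity
      have hy1 : 1 ≤ ((p : ℕ) : ℝ) ^ (1/4 : ℝ) :=
        Real.one_le_rpow (by exact_mod_cast hpp.one_lt.le) (by norm_num)
      rw [e, Real.rpow_neg hpos.le, ← mul_div_assoc, ← div_div, ← div_eq_mul_inv]
      apply div_le_div_of_nonneg_right _ hy.le
      rw [div_le_iff₀ hy]
      split_ifs with h
      · nlinarith
      · rw [one_mul]
        push Not at h
        have h7 : (D * K) ^ 4 ≤ (p : ℕ) := by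
          have : ((⌈(D * K) ^ 4⌉₊ : ℕ) : ℝ) ≤ (p : ℕ) := by exact_mod_cast (by omega : ⌈(D * K) ^ 4⌉₊ ≤ (p : ℕ))
          exact (Nat.le_ceil _).trans this
        calc D * K = ((D * K) ^ 4) ^ (1/4 : ℝ) := by
              rw [← Real.rpow_natCast, ← Real.rpow_mul (by linarith)]; norm_num
          _ ≤ _ := Real.rpow_le_rpow (by positivity) h7 (by norm_num)
  refine (Finset.prod_le_prod (fun p _ => ?_) fun p _ => hloc p).trans ?_
  · split_ifs <;> positivity
  rw [Finset.prod_mul_distrib, Real.finsetProd_rpow _ _ (fun _ _ => by positivity)]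
  have hq : (∏ p : q.primeFactors, ((((p : ℕ) ^ q.factorization p : ℕ)) : ℝ)) = q := by
    have := Nat.prod_primeFactors_coe_pow_factorization (NeZero.ne q)
    exact_mod_cast this.symm
  rw [hq]
  refine mul_le_mul_of_nonneg_right ?_ (by positivity)
  rw [Finset.prod_coe_sort q.primeFactors (fun p => if p < p0 then A else 1), ← Finset.prod_filter,
    Finset.prod_const]
  refine pow_le_pow_right₀ hA1 ?_
  calc _ ≤ (Finset.range p0).card := Finset.card_le_card fun p hp => by simp at hp ⊢; exact hp.2
    _ = p0 := Finset.card_range _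

theorem psi_mean (k : ℕ) : ∃ C : ℝ, 0 < C ∧
    ∀ (q : ℕ) [NeZero q] (X : q.primeFactors → (ℤ →* ℝ)), LocChar q X →
    ∀ w : Finset q.primeFactors → ℝ, (∀ S, |w S| ≤ 2) →
    |∑ z : Option (Fin k) → Fin (∏ p : q.primeFactors, modP p),
      ∏ ω : Fin k → Bool, psiW X w (ell ω (fun i => ((z i : ℕ) : ℤ)))| ≤
      C * (q : ℝ) ^ (-(1/4) : ℝ) * ((∏ p : q.primeFactors, modP p : ℕ) : ℝ) ^ (k + 1) := by
  obtain ⟨K, hK, hloc⟩ := local_bound k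
  obtain ⟨C, hC, hprod⟩ := prod_bound K (2 ^ (2 ^ k)) hK (one_le_pow₀ (by norm_num))
  refine ⟨2 ^ (2 ^ k) * C, by positivity, fun q _ X hX w hw => ?_⟩
  choose κ hκ1 hκ using theta_factor hX
  set M := ∏ p : q.primeFactors, modP p with hM
  have h1 : ∀ z : Option (Fin k) → Fin M, ∏ ω : Fin k → Bool, psiW X w (ell ω (fun i => ((z i : ℕ) : ℤ))) =
      ∑ σ : (Fin k → Bool) → Finset q.primeFactors, (∏ ω, w (σ ω) * κ (σ ω)) *
        ∏ p, ∏ ω, tauP X p (p ∈ σ ω) (ell ω (fun i => ((z i : ℕ) : ℤ))) := by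
    intro z
    unfold psiW
    rw [Finset.prod_univ_sum, Fintype.piFinset_univ]
    refine Finset.sum_congr rfl fun σ _ => ?_
    rw [Finset.prod_comm, ← Finset.prod_mul_distrib]
    refine Finset.prod_congr rfl fun ω _ => ?_
    rw [hκ, mul_assoc]
  rw [Finset.sum_congr rfl fun z _ => h1 z, Finset.sum_comm]
  have h2 : ∀ σ : (Fin k → Bool) → Finset q.primeFactors,
      |∑ z : Option (Fin k) → Fin M, (∏ ω, w (σ ω) * κ (σ ω)) *
        ∏ p, ∏ ω, tauP X p (p ∈ σ ω) (ell ω (fun i => ((z i : ℕ) : ℤ)))| ≤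
      2 ^ (2 ^ k) * ∏ p : q.primeFactors, ((modP p : ℝ) ^ (k + 1) *
        (if (p : ℕ) = 2 then 1 else K / √((p : ℕ) : ℝ))) := by
    intro σ
    rw [← Finset.mul_sum, abs_mul]
    refine mul_le_mul ?_ ?_ (abs_nonneg _) (by positivity)
    · rw [Finset.abs_prod]
      refine (Finset.prod_le_prod (g := fun _ => (2:ℝ)) (fun _ _ => abs_nonneg _) fun ω _ => ?_).trans (by simp)
      rw [abs_mul, hκ1, mul_one]; exact hw _
    · have := crt_sum (ι := Option (Fin k)) modP (modP_coprime (q := q)) modP_pos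
        (fun p x => ∏ ω, tauP X p (p ∈ σ ω) (ell ω x)) (fun p x y h =>
          Finset.prod_congr rfl fun ω _ => tauP_per hX p _ _ _ (ell_dvd ω _ x y h))
      rw [this, Finset.abs_prod]
      exact Finset.prod_le_prod (fun _ _ => abs_nonneg _) fun p _ => hloc q X hX p _
  refine (Finset.abs_sum_le_sum_abs _ _).trans ((Finset.sum_le_sum fun σ _ => h2 σ).trans ?_)
  rw [Finset.sum_const, Finset.card_univ, nsmul_eq_mul, Finset.prod_mul_distrib, Finset.prod_pow]
  have h3 : (Fintype.card ((Fin k → Bool) → Finset q.primeFactors) : ℝ) =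
      ∏ p : q.primeFactors, (2:ℝ) ^ (2 ^ k) := by
    simp [Fintype.card_finset, ← pow_mul, mul_comm]
  have h4 := hprod q X hX
  rw [Finset.prod_mul_distrib, ← h3] at h4
  have e : ((M : ℕ) : ℝ) = ∏ p : q.primeFactors, (modP p : ℝ) := by rw [hM]; push_cast; rfl
  rw [e]
  have h5 : 0 ≤ (2:ℝ) ^ (2 ^ k) * (∏ p : q.primeFactors, (modP p : ℝ)) ^ (k + 1) := by positivity
  have := mul_le_mul_of_nonneg_left h4 h5
  linarith

/-- The linear forms, on pairs. -/
def LL {k : ℕ} (ω : Fin k → Bool) (x : ℤ × (Fin k → ℤ)) : ℤ :=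
  x.1 + ∑ i, if ω i then x.2 i else 0

lemma LL_add {k : ℕ} (ω : Fin k → Bool) (x y : ℤ × (Fin k → ℤ)) :
    LL ω (x + y) = LL ω x + LL ω y := by
  simp only [LL, Prod.fst_add, Prod.snd_add, Pi.add_apply]
  rw [add_add_add_comm, ← Finset.sum_add_distrib]
  congr 1
  refine Finset.sum_congr rfl fun i _ => ?_
  split_ifs <;> simp

/-- The box of sidelength `R`. -/
noncomputable def boxR (k R : ℕ) : Finset (ℤ × (Fin k → ℤ)) :=
  Finset.Icc (-(R : ℤ)) R ×ˢ Fintype.piFinset fun _ : Fin k => Finset.Icc (-(R : ℤ)) R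

lemma card_Icc_R (R : ℕ) : (Finset.Icc (-(R : ℤ)) R).card = 2 * R + 1 := by
  rw [Int.card_Icc]; omega

lemma boxR_card (k R : ℕ) : (boxR k R).card = (2 * R + 1) ^ (k + 1) := by
  unfold boxR
  rw [Finset.card_product, Fintype.card_piFinset_const, card_Icc_R, pow_succ']

lemma box_sum {k : ℕ} (R : ℕ) (ω : Fin k → Bool) (g : ℤ → ℝ) (T : ℝ)
    (h : ∀ c, ∑ n ∈ Finset.Icc (-(R : ℤ)) R, g (n + c) ≤ T) :
    ∑ x ∈ boxR k R, g (LL ω x) ≤ (2 * R + 1) ^ k * T := by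
  unfold boxR
  rw [Finset.sum_product_right]
  refine (Finset.sum_le_card_nsmul _ _ T fun y _ => ?_).trans ?_
  · exact h (∑ i, if ω i then y i else 0)
  · rw [Fintype.card_piFinset_const, card_Icc_R, nsmul_eq_mul]; push_cast; rfl

/-- If all forms lie in `[1, N]`, then the point lies in the box. -/
lemma LL_mem_box {k : ℕ} (N : ℕ) (x : ℤ × (Fin k → ℤ)) (h : ∀ ω, 1 ≤ LL ω x ∧ LL ω x ≤ N) :
    (1 ≤ x.1 ∧ x.1 ≤ N) ∧ ∀ i, -(N : ℤ) ≤ x.2 i ∧ x.2 i ≤ N := by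
  have h0 := h fun _ => false
  simp only [LL, Bool.false_eq_true, if_false, Finset.sum_const_zero, add_zero] at h0
  refine ⟨h0, fun i => ?_⟩
  have h1 := h fun j => decide (j = i)
  simp only [LL, decide_eq_true_eq, Finset.sum_ite_eq', Finset.mem_univ, if_true] at h1
  omega

lemma mem_boxR {k : ℕ} (R : ℕ) (x : ℤ × (Fin k → ℤ)) :
    x ∈ boxR k R ↔ (-(R : ℤ) ≤ x.1 ∧ x.1 ≤ R) ∧ ∀ i, -(R : ℤ) ≤ x.2 i ∧ x.2 i ≤ R := by
  simp [boxR, Fintype.mem_piFinset]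

lemma box_translate {k : ℕ} (N : ℕ) (F : (ℤ × (Fin k → ℤ)) → ℝ)
    (hF : ∀ x, F x ≠ 0 → ∀ ω, 1 ≤ LL ω x ∧ LL ω x ≤ N) (c : ℤ × (Fin k → ℤ))
    (hc : |c.1| ≤ N ∧ ∀ i, |c.2 i| ≤ N) :
    ∑ x ∈ boxR k (2 * N), F (x + c) = ∑ x ∈ boxR k (2 * N), F x := by
  rw [← finsum_eq_sum_of_support_subset (s := boxR k (2 * N)),
    ← finsum_eq_sum_of_support_subset (s := boxR k (2 * N))]
  · exact finsum_comp_equiv (Equiv.addRight c) (f := F)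
  · intro x hx
    have h := LL_mem_box N x (hF x hx)
    rw [Finset.mem_coe, mem_boxR]
    push_cast
    refine ⟨by omega, fun i => ?_⟩
    have := h.2 i
    omega
  · intro x hx
    have h := LL_mem_box N (x + c) (hF (x + c) hx)
    rw [Finset.mem_coe, mem_boxR]
    push_cast
    have h1 := h.1
    have h2 := abs_le.mp hc.1
    rw [Prod.fst_add] at h1
    refine ⟨by omega, fun i => ?_⟩
    have := h.2 i
    have h3 := abs_le.mp (hc.2 i)
    rw [Prod.snd_add, Pi.add_apply] at this
    omega

lemma mono_var (W : ℤ → ℝ) (hm : Monotone W) (h0 : ∀ n, 0 ≤ W n) (h1 : ∀ n, W n ≤ 1) (s : ℕ)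
    (a b c : ℤ) : ∑ n ∈ Finset.Icc a b, |W (n + c + s) - W (n + c)| ≤ s := by
  have : ∀ n, |W (n + c + s) - W (n + c)| =
      ∑ j ∈ Finset.range s, (W (n + c + (j + 1 : ℕ)) - W (n + c + j)) := by
    intro n
    rw [Finset.sum_range_sub (fun j : ℕ => W (n + c + j)), abs_of_nonneg]
    · simp
    · exact sub_nonneg.mpr (hm (by omega))
  simp_rw [this]
  rw [Finset.sum_comm]
  refine (Finset.sum_le_card_nsmul _ _ 1 fun j _ => ?_).trans (by simp)
  rw [show Finset.Icc a b = (Finset.range (b + 1 - a).toNat).map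
    (Nat.castEmbedding.trans <| addLeftEmbedding a) from rfl, Finset.sum_map]
  have h2 := Finset.sum_range_sub (fun i : ℕ => W (a + i + c + j)) (b + 1 - a).toNat
  have h3 : ∀ i : ℕ, W (((Nat.castEmbedding.trans <| addLeftEmbedding a) i : ℤ) + c + (j + 1 : ℕ)) -
      W (((Nat.castEmbedding.trans <| addLeftEmbedding a) i : ℤ) + c + j) =
      W (a + (i + 1 : ℕ) + c + j) - W (a + i + c + j) := by
    intro i
    simp only [Function.Embedding.trans_apply, Nat.castEmbedding_apply, addLeftEmbedding_apply]
    congr 2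
    push_cast; ring
  simp_rw [h3]
  rw [h2]
  linarith [h1 (a + ((b + 1 - a).toNat : ℕ) + c + j), h0 (a + (0 : ℕ) + c + j)]

lemma prod_diff {ι : Type*} (s : Finset ι) (a b : ι → ℝ) (t : ℝ) (ht : 0 ≤ t)
    (ha : ∀ i ∈ s, |a i| ≤ 1) (hab : ∀ i ∈ s, |a i - b i| ≤ t) :
    |∏ i ∈ s, b i| ≤ (1 + t) ^ s.card ∧
    |∏ i ∈ s, a i - ∏ i ∈ s, b i| ≤ s.card * t * (1 + t) ^ s.card := by
  induction s using Finset.induction_on with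
  | empty => simp
  | insert j s hj ih =>
    obtain ⟨i1, i2⟩ := ih (fun i hi => ha i (Finset.mem_insert_of_mem hi))
      (fun i hi => hab i (Finset.mem_insert_of_mem hi))
    have a1 := ha j (Finset.mem_insert_self _ _)
    have a2 := hab j (Finset.mem_insert_self _ _)
    have a3 : |b j| ≤ 1 + t := by
      have := abs_sub_abs_le_abs_sub (b j) (a j)
      rw [abs_sub_comm] at this
      linarith
    rw [Finset.prod_insert hj, Finset.prod_insert hj, Finset.card_insert_of_notMem hj]
    constructor
    · rw [abs_mul, pow_succ']
      exact mul_le_mul a3 i1 (abs_nonneg _) (by positivity)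
    · rw [show a j * ∏ i ∈ s, a i - b j * ∏ i ∈ s, b i =
        a j * (∏ i ∈ s, a i - ∏ i ∈ s, b i) + (a j - b j) * ∏ i ∈ s, b i by ring]
      refine (abs_add_le _ _).trans ?_
      rw [abs_mul, abs_mul]
      have e1 : |a j| * |∏ i ∈ s, a i - ∏ i ∈ s, b i| ≤ 1 * (s.card * t * (1 + t) ^ s.card) :=
        mul_le_mul a1 i2 (abs_nonneg _) zero_le_one
      have e2 : |a j - b j| * |∏ i ∈ s, b i| ≤ t * (1 + t) ^ s.card :=
        mul_le_mul a2 i1 (abs_nonneg _) ht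
      have e3 : (s.card + 1 : ℝ) * t * (1 + t) ^ s.card ≤ (s.card + 1) * t * (1 + t) ^ (s.card + 1) := by
        gcongr
        · linarith
        · omega
      push_cast
      linarith

lemma prod_diff_one {ι : Type*} (s : Finset ι) (a b : ι → ℝ)
    (ha : ∀ i ∈ s, |a i| ≤ 1) (hb : ∀ i ∈ s, |b i| ≤ 1) :
    |∏ i ∈ s, b i| ≤ 1 ∧ |∏ i ∈ s, a i - ∏ i ∈ s, b i| ≤ ∑ i ∈ s, |a i - b i| := by
  induction s using Finset.induction_on with
  | empty => simp
  | insert j s hj ih =>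
    obtain ⟨i1, i2⟩ := ih (fun i hi => ha i (Finset.mem_insert_of_mem hi))
      (fun i hi => hb i (Finset.mem_insert_of_mem hi))
    have a1 := ha j (Finset.mem_insert_self _ _)
    have a2 := hb j (Finset.mem_insert_self _ _)
    rw [Finset.prod_insert hj, Finset.prod_insert hj, Finset.sum_insert hj]
    constructor
    · rw [abs_mul]
      exact mul_le_one₀ a2 (abs_nonneg _) i1
    · rw [show a j * ∏ i ∈ s, a i - b j * ∏ i ∈ s, b i =
        a j * (∏ i ∈ s, a i - ∏ i ∈ s, b i) + (a j - b j) * ∏ i ∈ s, b i by ring]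
      refine (abs_add_le _ _).trans ?_
      rw [abs_mul, abs_mul]
      have e1 := mul_le_mul a1 i2 (abs_nonneg _) zero_le_one
      have e2 := mul_le_mul_of_nonneg_left i1 (abs_nonneg (a j - b j))
      linarith

/-- Permuting residues. -/
lemma res_perm {ι : Type*} [Fintype ι] [DecidableEq ι] (M : ℕ) [NeZero M] (E : ℕ) (hE : E.Coprime M)
    (F : (ι → ℤ) → ℝ) (hF : ∀ x y, (∀ i, (M : ℤ) ∣ x i - y i) → F x = F y) (x : ι → ℤ) :
    ∑ z : ι → Fin M, F (fun i => x i + E * ((z i : ℕ) : ℤ)) =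
      ∑ z : ι → Fin M, F (fun i => ((z i : ℕ) : ℤ)) := by
  have hM : (0 : ℤ) < M := by exact_mod_cast NeZero.pos M
  let f : (ι → Fin M) → (ι → Fin M) := fun z i =>
    ⟨((x i + E * ((z i : ℕ) : ℤ)) % M).toNat, by
      have h1 := Int.emod_lt_of_pos (x i + E * ((z i : ℕ) : ℤ)) hM
      have h2 := Int.emod_nonneg (x i + E * ((z i : ℕ) : ℤ)) hM.ne'
      omega⟩
  have hf : ∀ z i, ((f z i : ℕ) : ℤ) = (x i + E * ((z i : ℕ) : ℤ)) % M := fun z i =>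
    Int.toNat_of_nonneg (Int.emod_nonneg _ hM.ne')
  have hinj : Function.Injective f := by
    intro z z' h
    ext i
    have h1 : (x i + E * ((z i : ℕ) : ℤ)) % M = (x i + E * ((z' i : ℕ) : ℤ)) % M := by
      rw [← hf, ← hf, h]
    have h2 := Int.ModEq.dvd h1
    rw [show x i + E * ((z' i : ℕ) : ℤ) - (x i + E * ((z i : ℕ) : ℤ)) =
      E * (((z' i : ℕ) : ℤ) - ((z i : ℕ) : ℤ)) by ring] at h2
    have h3 := (Nat.isCoprime_iff_coprime.mpr hE.symm).dvd_of_dvd_mul_left h2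
    exact Nat.ModEq.eq_of_lt_of_lt (Nat.modEq_iff_dvd.mpr h3) (z i).2 (z' i).2
  refine Fintype.sum_bijective f (Finite.injective_iff_bijective.mp hinj) _ _ fun z => ?_
  refine hF _ _ fun i => ?_
  rw [hf]
  exact Int.dvd_self_sub_of_emod_eq rfl

theorem shift_avg (k N M E : ℕ) [NeZero M] (hE : E.Coprime M) (hEM : E * M ≤ N)
    (V ψ : ℤ → ℝ) (I : (Fin k → Bool) → ℤ → ℝ)
    (hV1 : ∀ n, |V n| ≤ 1) (hVs : ∀ n, V n ≠ 0 → 1 ≤ n ∧ n ≤ N)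
    (hVt : ∀ (s : ℕ) (a b c : ℤ), ∑ n ∈ Finset.Icc a b, |V (n + c + s) - V (n + c)| ≤ 2 * s)
    (hψ : ∀ n, |ψ n| ≤ 2) (hψM : ∀ n n', (M : ℤ) ∣ n - n' → ψ n = ψ n')
    (hI : ∀ ω n, |I ω n| ≤ 1) (hIE : ∀ ω n t, I ω (n + E * t) = I ω n) :
    |∑ x ∈ boxR k (2 * N), ∏ ω, (V (LL ω x) * ψ (LL ω x) * I ω (LL ω x)) -
      (∑ z : Option (Fin k) → Fin M, ∏ ω, ψ (ell ω (fun i => ((z i : ℕ) : ℤ)))) / M ^ (k + 1) *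
        ∑ x ∈ boxR k (2 * N), ∏ ω, (V (LL ω x) * I ω (LL ω x))| ≤
      2 ^ (2 ^ k) * 2 ^ k * ((2 * (2 * N : ℕ) + 1) ^ k * (2 * (E * ((k + 1) * M)))) := by
  have hM : (0 : ℝ) < M := by exact_mod_cast NeZero.pos M
  set Ψ := ∑ z : Option (Fin k) → Fin M, ∏ ω, ψ (ell ω (fun i => ((z i : ℕ) : ℤ))) with hΨ
  set F : ℤ × (Fin k → ℤ) → ℝ := fun x => ∏ ω, (V (LL ω x) * ψ (LL ω x) * I ω (LL ω x)) with hFdef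
  let c : (Option (Fin k) → Fin M) → ℤ × (Fin k → ℤ) := fun z =>
    ((E : ℤ) * ((z none : ℕ) : ℤ), fun i => (E : ℤ) * ((z (some i) : ℕ) : ℤ))
  have hcL : ∀ ω z, LL ω (c z) = E * ell ω (fun i => ((z i : ℕ) : ℤ)) := by
    intro ω z
    rw [← ell_mul]; rfl
  have hzb : ∀ (z : Option (Fin k) → Fin M) i, |(E : ℤ) * ((z i : ℕ) : ℤ)| ≤ N := by
    intro z i
    rw [abs_of_nonneg (by positivity)]
    exact_mod_cast (Nat.mul_le_mul_left E (z i).2.le).trans hEM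
  have htr : ∀ z, ∑ x ∈ boxR k (2 * N), F (x + c z) = ∑ x ∈ boxR k (2 * N), F x := by
    intro z
    refine box_translate N F (fun x hx ω => ?_) _ ⟨hzb z none, fun i => hzb z (some i)⟩
    apply hVs
    intro h0
    apply hx
    exact Finset.prod_eq_zero (Finset.mem_univ ω) (by rw [h0]; ring)
  let H : (Option (Fin k) → Fin M) → ℤ × (Fin k → ℤ) → ℝ := fun z x =>
    (∏ ω, ψ (LL ω x + E * ell ω (fun i => ((z i : ℕ) : ℤ)))) * ∏ ω, (V (LL ω x) * I ω (LL ω x))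
  have hper : ∀ x : ℤ × (Fin k → ℤ), ∑ z : Option (Fin k) → Fin M,
      ∏ ω, ψ (LL ω x + E * ell ω (fun i => ((z i : ℕ) : ℤ))) = Ψ := by
    intro x
    have h := res_perm M E hE (fun y : Option (Fin k) → ℤ => ∏ ω, ψ (ell ω y))
      (fun y y' hy => Finset.prod_congr rfl fun ω _ => hψM _ _ (ell_dvd ω _ y y' hy))
      (fun o => o.elim x.1 x.2)
    rw [hΨ, ← h]
    refine Finset.sum_congr rfl fun z _ => Finset.prod_congr rfl fun ω _ => ?_
    rw [ell_add, ell_mul]; rfl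
  have hdiff : ∀ z, |∑ x ∈ boxR k (2 * N), F (x + c z) - ∑ x ∈ boxR k (2 * N), H z x| ≤
      2 ^ (2 ^ k) * 2 ^ k * ((2 * (2 * N : ℕ) + 1) ^ k * (2 * (E * ((k + 1) * M)))) := by
    intro z
    have hlz : ∀ ω : Fin k → Bool, ∃ s : ℕ, (E : ℤ) * ell ω (fun i => ((z i : ℕ) : ℤ)) = (s : ℤ) ∧
        (s : ℝ) ≤ E * ((k + 1) * M) := by
      intro ω
      refine ⟨E * ell ω (fun i => (z i : ℕ)), ?_, ?_⟩
      · have := ell_cast (Int.castRingHom ℤ) ω (fun i => ((z i : ℕ) : ℤ))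
        push_cast
        congr 1
        simp only [ell]
        push_cast
        rfl
      · have h2 : ell ω (fun i => (z i : ℕ)) ≤ (k + 1) * M := by
          unfold ell
          have : ∑ i, (if ω i then (z (some i) : ℕ) else 0) ≤ ∑ _i : Fin k, M := by
            refine Finset.sum_le_sum fun i _ => ?_
            split_ifs
            · exact (z _).2.le
            · omega
          simp only [Finset.sum_const, Finset.card_univ, Fintype.card_fin, smul_eq_mul] at this
          have := (z none).2
          linarith
        exact_mod_cast Nat.mul_le_mul_left E h2
    rw [← Finset.sum_sub_distrib]
    refine (Finset.abs_sum_le_sum_abs _ _).trans ?_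
    have hpt : ∀ x ∈ boxR k (2 * N), |F (x + c z) - H z x| ≤
        ∑ ω, 2 ^ (2 ^ k) * |V (LL ω x + E * ell ω (fun i => ((z i : ℕ) : ℤ))) - V (LL ω x)| := by
      intro x _
      have e1 : F (x + c z) = (∏ ω, ψ (LL ω x + E * ell ω (fun i => ((z i : ℕ) : ℤ)))) *
          ∏ ω, (V (LL ω x + E * ell ω (fun i => ((z i : ℕ) : ℤ))) * I ω (LL ω x)) := by
        rw [hFdef, ← Finset.prod_mul_distrib]
        refine Finset.prod_congr rfl fun ω _ => ?_
        rw [LL_add, hcL, hIE]; ring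
      rw [e1, ← mul_sub, abs_mul, ← Finset.mul_sum]
      refine mul_le_mul ?_ ?_ (abs_nonneg _) (by positivity)
      · rw [Finset.abs_prod]
        refine (Finset.prod_le_prod (fun _ _ => abs_nonneg _) fun ω _ => hψ _).trans (by simp)
      · refine (prod_diff_one _ _ _ (fun ω _ => ?_) fun ω _ => ?_).2.trans ?_
        · rw [abs_mul]; exact mul_le_one₀ (hV1 _) (abs_nonneg _) (hI _ _)
        · rw [abs_mul]; exact mul_le_one₀ (hV1 _) (abs_nonneg _) (hI _ _)
        · refine Finset.sum_le_sum fun ω _ => ?_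
          rw [← sub_mul, abs_mul]
          exact mul_le_of_le_one_right (abs_nonneg _) (hI _ _)
    refine (Finset.sum_le_sum hpt).trans ?_
    rw [Finset.sum_comm]
    refine (Finset.sum_le_card_nsmul _ _ (2 ^ (2 ^ k) * ((2 * ((2 * N : ℕ) : ℝ) + 1) ^ k *
      (2 * (E * ((k + 1) * M))))) fun ω _ => ?_).trans (le_of_eq ?_)
    · rw [← Finset.mul_sum]
      refine mul_le_mul_of_nonneg_left ?_ (by positivity)
      obtain ⟨s, hs, hs2⟩ := hlz ω
      rw [hs]
      refine box_sum (2 * N) ω (fun n => |V (n + s) - V n|) _ fun c => ?_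
      refine (hVt s _ _ c).trans (by linarith)
    · simp; ring
  have hcard : ∑ _z : Option (Fin k) → Fin M, (1 : ℝ) = M ^ (k + 1) := by simp
  have hMk : (0 : ℝ) < M ^ (k + 1) := by positivity
  have e2 : M ^ (k + 1) * (∑ x ∈ boxR k (2 * N), F x - Ψ / M ^ (k + 1) *
        ∑ x ∈ boxR k (2 * N), ∏ ω, (V (LL ω x) * I ω (LL ω x))) =
      ∑ z, (∑ x ∈ boxR k (2 * N), F (x + c z) - ∑ x ∈ boxR k (2 * N), H z x) := by
    simp_rw [htr]
    rw [Finset.sum_sub_distrib, Finset.sum_comm (s := Finset.univ) (f := fun z x => H z x)]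
    have : ∀ x, ∑ z, H z x = Ψ * ∏ ω, (V (LL ω x) * I ω (LL ω x)) := fun x => by
      rw [← Finset.sum_mul, hper]
    simp_rw [this]
    rw [← Finset.mul_sum, Finset.sum_const, nsmul_eq_mul]
    simp only [Finset.card_univ, Fintype.card_fun, Fintype.card_option, Fintype.card_fin]
    push_cast
    field_simp
  have e3 := (Finset.abs_sum_le_sum_abs _ _).trans (Finset.sum_le_sum fun z (_ : z ∈ Finset.univ) => hdiff z)
  rw [← e2, abs_mul, abs_of_pos hMk, Finset.sum_const, nsmul_eq_mul] at e3
  simp only [Finset.card_univ, Fintype.card_fun, Fintype.card_option, Fintype.card_fin] at e3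
  push_cast at e3 ⊢
  exact le_of_mul_le_mul_left e3 hMk

section expansion
variable (P : Finset ℕ) (g : ℕ → Fin 3 → ℝ)

/-- Coefficient of a term of the expansion. -/
noncomputable def gco (φ : P → Fin 3) : ℝ := ∏ p : P, g p (φ p)
/-- Modulus of a term of the expansion. -/
noncomputable def eph (φ : P → Fin 3)  : ℕ := ∏ p : P, (p : ℕ) ^ (φ p : ℕ)
/-- Indicator of a term of the expansion. -/
noncomputable def iph (φ : P → Fin 3) (n : ℤ) : ℝ :=
  ∏ p : P, if (((p : ℕ) ^ (φ p : ℕ) : ℕ) : ℤ) ∣ n then 1 else 0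
/-- The sifting factor. -/
noncomputable def GG (n : ℤ) : ℝ :=
  ∏ p : P, ∑ j : Fin 3, g p j * (if (((p : ℕ) ^ (j : ℕ) : ℕ) : ℤ) ∣ n then 1 else 0)
/-- The terms of small modulus. -/
noncomputable def TT (D : ℕ) : Finset (P → Fin 3) := Finset.univ.filter fun φ => eph P φ ≤ D
/-- The truncated sifting factor. -/
noncomputable def GD (D : ℕ) (n : ℤ) : ℝ := ∑ φ ∈ TT P D, gco P g φ * iph P φ n

lemma GG_eq (n : ℤ) : GG P g n = ∑ φ, gco P g φ * iph P φ n := by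
  unfold GG gco iph
  rw [Finset.prod_univ_sum, Fintype.piFinset_univ]
  exact Finset.sum_congr rfl fun φ _ => Finset.prod_mul_distrib

lemma iph_abs (φ : P → Fin 3) (n : ℤ) : |iph P φ n| ≤ 1 ∧ 0 ≤ iph P φ n := by
  have h0 : 0 ≤ iph P φ n := Finset.prod_nonneg fun p _ => by split_ifs <;> norm_num
  refine ⟨?_, h0⟩
  rw [abs_of_nonneg h0]
  exact Finset.prod_le_one (fun p _ => by split_ifs <;> norm_num) fun p _ => by split_ifs <;> norm_num

lemma iph_per (φ : P → Fin 3) (E : ℕ) (hE : eph P φ ∣ E) (n t : ℤ) :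
    iph P φ (n + E * t) = iph P φ n := by
  refine Finset.prod_congr rfl fun p _ => ?_
  have h : (((p : ℕ) ^ (φ p : ℕ) : ℕ) : ℤ) ∣ E * t := Dvd.dvd.mul_right
    (Int.natCast_dvd_natCast.mpr ((Finset.dvd_prod_of_mem _ (Finset.mem_univ p)).trans hE)) _
  simp only [Int.dvd_add_left h]

variable {P g}

lemma eph_pos (hP : ∀ p ∈ P, p.Prime) (φ : P → Fin 3) : 0 < eph P φ :=
  Finset.prod_pos fun p _ => pow_pos (hP p p.2).pos _

lemma sum_coeff (hP : ∀ p ∈ P, p.Prime) (h0 : ∀ p, g p 0 = 1) (h1 : ∀ p ∈ P, |g p 1| ≤ 3)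
    (h2 : ∀ p ∈ P, |g p 2| ≤ 2) (D : ℕ) :
    ∑ φ ∈ TT P D, |gco P g φ| ≤ D * ∏ p ∈ P, (1 + 5 / (p : ℝ)) := by
  have a1 : ∀ φ ∈ TT P D, |gco P g φ| ≤ D * (|gco P g φ| / eph P φ) := by
    intro φ hφ
    have hpos : (0 : ℝ) < eph P φ := by exact_mod_cast eph_pos hP φ
    have hle : (eph P φ : ℝ) ≤ D := by exact_mod_cast (Finset.mem_filter.mp hφ).2
    rw [mul_div_assoc', le_div_iff₀ hpos, mul_comm]
    gcongr
  refine (Finset.sum_le_sum a1).trans ?_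
  rw [← Finset.mul_sum]
  refine mul_le_mul_of_nonneg_left ?_ (by positivity)
  refine (Finset.sum_le_univ_sum_of_nonneg fun φ => by positivity).trans ?_
  have a2 : ∀ φ : P → Fin 3, |gco P g φ| / eph P φ = ∏ p : P, |g p (φ p)| / (p : ℝ) ^ (φ p : ℕ) := by
    intro φ
    unfold gco eph
    rw [Finset.abs_prod, Finset.prod_div_distrib]
    push_cast; rfl
  simp_rw [a2]
  rw [← Fintype.piFinset_univ, ← Finset.prod_univ_sum (f := fun (p : P) (j : Fin 3) => |g p j| / (p : ℝ) ^ (j : ℕ)),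
    ← Finset.prod_coe_sort P (fun p => 1 + 5 / (p : ℝ))]
  refine Finset.prod_le_prod (fun p _ => Finset.sum_nonneg fun j _ => by positivity) fun p _ => ?_
  have hp : (1 : ℝ) ≤ (p : ℕ) := by exact_mod_cast (hP p p.2).one_le
  have b1 : |g p 1| / (p : ℝ) ≤ 3 / (p : ℝ) := by gcongr; exact h1 p p.2
  have b2 : |g p 2| / (p : ℝ) ^ 2 ≤ 2 / (p : ℝ) := by
    refine div_le_div₀ (by norm_num) (h2 p p.2) (by positivity) (by nlinarith)
  rw [Fin.sum_univ_three, h0]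
  simp only [Fin.val_zero, Fin.val_one, Fin.val_two, pow_zero, pow_one, abs_one, div_one]
  have : (5 : ℝ) / (p : ℕ) = 3 / (p : ℕ) + 2 / (p : ℕ) := by rw [← add_div]; norm_num
  linarith

lemma trunc_err (h0 : ∀ p, g p 0 = 1) (h1 : ∀ p ∈ P, |g p 1| ≤ 3)
    (h2 : ∀ p ∈ P, |g p 2| ≤ 2) (D : ℕ) (hD : 0 < D) (σ : ℝ) (hσ : 0 ≤ σ)
    (h3 : ∀ p ∈ P, (p : ℝ) ^ σ ≤ 3) (n : ℤ) :
    |GG P g n - GD P g D n| ≤ (D : ℝ) ^ (-σ) * ∏ p ∈ P, (if (p : ℤ) ∣ n then 30 else 1) := by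
  have hDp : (0 : ℝ) < D := by exact_mod_cast hD
  have a0 : GG P g n - GD P g D n = ∑ φ ∈ Finset.univ.filter (fun φ => ¬ eph P φ ≤ D),
      gco P g φ * iph P φ n := by
    rw [GG_eq, GD, TT, sub_eq_iff_eq_add', Finset.sum_filter_add_sum_filter_not]
  rw [a0]
  refine (Finset.abs_sum_le_sum_abs _ _).trans ?_
  have a1 : ∀ φ ∈ Finset.univ.filter (fun φ => ¬ eph P φ ≤ D), |gco P g φ * iph P φ n| ≤
      (D : ℝ) ^ (-σ) * (|gco P g φ| * iph P φ n * (eph P φ : ℝ) ^ σ) := by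
    intro φ hφ
    have hle : (D : ℝ) ≤ eph P φ := by exact_mod_cast (not_le.mp (Finset.mem_filter.mp hφ).2).le
    rw [abs_mul, abs_of_nonneg (iph_abs P φ n).2, mul_left_comm]
    refine le_mul_of_one_le_right (mul_nonneg (abs_nonneg _) (iph_abs P φ n).2) ?_
    rw [Real.rpow_neg hDp.le, inv_mul_eq_div, one_le_div (by positivity)]
    gcongr
  refine (Finset.sum_le_sum a1).trans ?_
  rw [← Finset.mul_sum]
  refine mul_le_mul_of_nonneg_left ?_ (by positivity)
  refine (Finset.sum_le_univ_sum_of_nonneg fun φ => mul_nonneg (mul_nonneg (abs_nonneg _)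
    (iph_abs P φ n).2) (by positivity)).trans ?_
  have a2 : ∀ φ : P → Fin 3, |gco P g φ| * iph P φ n * (eph P φ : ℝ) ^ σ = ∏ p : P, |g p (φ p)| *
      (if (((p : ℕ) ^ (φ p : ℕ) : ℕ) : ℤ) ∣ n then 1 else 0) * ((p : ℝ) ^ σ) ^ (φ p : ℕ) := by
    intro φ
    unfold gco eph iph
    rw [Finset.abs_prod]
    push_cast
    rw [← Real.finsetProd_rpow _ _ (fun p _ => by positivity), ← Finset.prod_mul_distrib,
      ← Finset.prod_mul_distrib]
    refine Finset.prod_congr rfl fun p _ => ?_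
    rw [← Real.rpow_natCast, ← Real.rpow_natCast, ← Real.rpow_mul (by positivity),
      ← Real.rpow_mul (by positivity), mul_comm σ]
  simp_rw [a2]
  rw [← Fintype.piFinset_univ, ← Finset.prod_univ_sum (f := fun (p : P) (j : Fin 3) => |g p j| *
      (if (((p : ℕ) ^ (j : ℕ) : ℕ) : ℤ) ∣ n then 1 else 0) * ((p : ℝ) ^ σ) ^ (j : ℕ)),
    ← Finset.prod_coe_sort P (fun p => if (p : ℤ) ∣ n then (30 : ℝ) else 1)]
  refine Finset.prod_le_prod (fun p _ => Finset.sum_nonneg fun j _ => by positivity) fun p _ => ?_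
  rw [Fin.sum_univ_three, h0]
  simp only [Fin.val_zero, Fin.val_one, Fin.val_two, pow_zero, pow_one, abs_one]
  have hs : 0 ≤ (p : ℝ) ^ σ := by positivity
  have hs3 := h3 p p.2
  have c1 := mul_le_mul (h1 p p.2) hs3 hs (by norm_num)
  have c2 := mul_le_mul (h2 p p.2) (pow_le_pow_left₀ hs hs3 2) (by positivity) (by norm_num)
  by_cases hd : ((p : ℕ) : ℤ) ∣ n
  · by_cases hd2 : (((p : ℕ) ^ 2 : ℕ) : ℤ) ∣ n
    · simp only [hd, hd2, if_true]; norm_num at *; linarith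
    · simp only [hd, hd2, if_true, if_false]; norm_num at *; linarith
  · have hd2 : ¬ (((p : ℕ) ^ 2 : ℕ) : ℤ) ∣ n := fun h => hd (dvd_trans (by push_cast; exact dvd_pow_self _ two_ne_zero) h)
    simp only [hd, hd2, if_false]; norm_num

lemma sum_K (hP : ∀ p ∈ P, p.Prime) (N : ℕ) (K : ℝ) (hK : 0 ≤ K) :
    ∑ n ∈ Finset.Icc (1 : ℤ) N, ∏ p ∈ P, (if (p : ℤ) ∣ n then K else 1) ≤
      N * ∏ p ∈ P, (1 + K / (p : ℝ)) := by
  have a0 : Finset.Icc (1 : ℤ) N = (Finset.Ioc 0 N).image (fun n : ℕ => (n : ℤ)) := by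
    ext x
    simp only [Finset.mem_Icc, Finset.mem_image, Finset.mem_Ioc]
    constructor
    · intro h; exact ⟨x.toNat, by omega, by omega⟩
    · rintro ⟨a, h, rfl⟩; omega
  rw [a0, Finset.sum_image (fun a _ b _ h => by exact_mod_cast h)]
  have a1 : ∀ n : ℕ, ∏ p ∈ P, (if (p : ℤ) ∣ (n : ℤ) then K else 1) ≤
      ∑ t ∈ P.powerset, ∏ p ∈ t, (if p ∣ n then K else 0) := by
    intro n
    rw [← Finset.prod_one_add]
    refine Finset.prod_le_prod (fun p _ => by split_ifs <;> linarith) fun p _ => ?_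
    simp only [Int.natCast_dvd_natCast]
    split_ifs <;> linarith
  refine (Finset.sum_le_sum fun n _ => a1 n).trans ?_
  rw [Finset.sum_comm, Finset.prod_one_add, Finset.mul_sum]
  refine Finset.sum_le_sum fun t ht => ?_
  have htP := Finset.mem_powerset.mp ht
  have a2 : ∀ n : ℕ, ∏ p ∈ t, (if p ∣ n then K else 0) ≤ if (∏ p ∈ t, p) ∣ n then K ^ t.card else 0 := by
    intro n
    by_cases h : ∀ p ∈ t, p ∣ n
    · rw [if_pos (Finset.prod_primes_dvd n (fun p hp => (hP p (htP hp)).prime) h),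
        Finset.prod_congr rfl (fun p hp => if_pos (h p hp)), Finset.prod_const]
    · push Not at h
      obtain ⟨p, hp, hpn⟩ := h
      rw [Finset.prod_eq_zero hp (if_neg hpn)]
      split_ifs <;> positivity
  refine (Finset.sum_le_sum fun n _ => a2 n).trans ?_
  rw [← Finset.sum_filter, Finset.sum_const, Nat.Ioc_filter_dvd_card_eq_div, nsmul_eq_mul,
    Finset.prod_div_distrib, Finset.prod_const]
  have a3 : ((N / ∏ p ∈ t, p : ℕ) : ℝ) ≤ (N : ℝ) / (∏ p ∈ t, (p : ℝ)) := by
    have := @Nat.cast_div_le ℝ _ _ _ N (∏ p ∈ t, p)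
    push_cast at this; exact this
  calc _ ≤ (N : ℝ) / (∏ p ∈ t, (p : ℝ)) * K ^ t.card := by gcongr
    _ = _ := by ring

lemma prod_exp_le (hP : ∀ p ∈ P, p.Prime) (Q K : ℝ) (hQ : 1 ≤ Q) (hPQ : ∀ p ∈ P, (p : ℝ) < Q)
    (hK : 0 ≤ K) : ∏ p ∈ P, (1 + K / (p : ℝ)) ≤ Real.exp (K * (1 + Real.log Q)) := by
  have h1 : ∏ p ∈ P, (1 + K / (p : ℝ)) ≤ ∏ p ∈ P, Real.exp (K / (p : ℝ)) :=
    Finset.prod_le_prod (fun p _ => by positivity) fun p _ => by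
      rw [add_comm]; exact Real.add_one_le_exp _
  refine h1.trans ?_
  rw [← Real.exp_sum, Real.exp_le_exp]
  have h2 : ∑ p ∈ P, K / (p : ℝ) = K * ∑ p ∈ P, ((p : ℝ))⁻¹ := by
    rw [Finset.mul_sum]; rfl
  rw [h2]
  refine mul_le_mul_of_nonneg_left ?_ hK
  have h3 : ∑ p ∈ P, ((p : ℝ))⁻¹ ≤ ∑ i ∈ Finset.Icc 1 ⌊Q⌋₊, ((i : ℝ))⁻¹ := by
    refine Finset.sum_le_sum_of_subset_of_nonneg (fun p hp => ?_) fun i _ _ => by positivity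
    exact Finset.mem_Icc.mpr ⟨(hP p hp).one_le, Nat.le_floor (hPQ p hp).le⟩
  refine h3.trans ?_
  have h4 := harmonic_le_one_add_log ⌊Q⌋₊
  rw [harmonic_eq_sum_Icc] at h4
  push_cast at h4
  refine h4.trans ?_
  gcongr
  · exact_mod_cast Nat.floor_pos.mpr hQ
  · exact Nat.floor_le (by linarith)

theorem tuple_avg (k N M D : ℕ) [NeZero M] (hPM : ∀ p ∈ P, p.Coprime M)
    (hEM : D ^ (2 ^ k) * M ≤ N) (V ψ : ℤ → ℝ)
    (hV1 : ∀ n, |V n| ≤ 1) (hVs : ∀ n, V n ≠ 0 → 1 ≤ n ∧ n ≤ N)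
    (hVt : ∀ (s : ℕ) (a b c : ℤ), ∑ n ∈ Finset.Icc a b, |V (n + c + s) - V (n + c)| ≤ 2 * s)
    (hψ : ∀ n, |ψ n| ≤ 2) (hψM : ∀ n n', (M : ℤ) ∣ n - n' → ψ n = ψ n') :
    |∑ x ∈ boxR k (2 * N), ∏ ω, (V (LL ω x) * ψ (LL ω x) * GD P g D (LL ω x)) -
      (∑ z : Option (Fin k) → Fin M, ∏ ω, ψ (ell ω (fun i => ((z i : ℕ) : ℤ)))) / M ^ (k + 1) *
        ∑ x ∈ boxR k (2 * N), ∏ ω, (V (LL ω x) * GD P g D (LL ω x))| ≤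
      (∑ φ ∈ TT P D, |gco P g φ|) ^ (2 ^ k) *
      (2 ^ (2 ^ k) * 2 ^ k * ((2 * (2 * N : ℕ) + 1) ^ k * (2 * (D ^ (2 ^ k) * ((k + 1) * M))))) := by
  have hexp : ∀ (a : (Fin k → Bool) → ℝ) (n : (Fin k → Bool) → ℤ),
      ∏ ω, (a ω * GD P g D (n ω)) = ∑ Φ ∈ Fintype.piFinset fun _ : Fin k → Bool => TT P D,
        (∏ ω, gco P g (Φ ω)) * ∏ ω, (a ω * iph P (Φ ω) (n ω)) := by
    intro a n
    unfold GD
    simp_rw [Finset.mul_sum]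
    rw [Finset.prod_univ_sum]
    refine Finset.sum_congr rfl fun Φ _ => ?_
    rw [← Finset.prod_mul_distrib]
    exact Finset.prod_congr rfl fun ω _ => by ring
  simp_rw [hexp]
  rw [Finset.sum_comm, Finset.sum_comm (s := boxR k (2 * N)), Finset.mul_sum, ← Finset.sum_sub_distrib]
  refine (Finset.abs_sum_le_sum_abs _ _).trans ?_
  have hsum : (∑ φ ∈ TT P D, |gco P g φ|) ^ (2 ^ k) =
      ∑ Φ ∈ Fintype.piFinset fun _ : Fin k → Bool => TT P D, ∏ ω, |gco P g (Φ ω)| := by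
    rw [← Finset.prod_univ_sum (f := fun (_ : Fin k → Bool) φ => |gco P g φ|), Finset.prod_const]; simp
  rw [hsum, Finset.sum_mul]
  refine Finset.sum_le_sum fun Φ hΦ => ?_
  rw [← Finset.mul_sum, ← Finset.mul_sum, mul_left_comm, ← mul_sub, abs_mul, Finset.abs_prod]
  refine mul_le_mul_of_nonneg_left ?_ (Finset.prod_nonneg fun _ _ => abs_nonneg _)
  set E := ∏ ω, eph P (Φ ω) with hEdef
  have hED : E ≤ D ^ (2 ^ k) := by
    refine (Finset.prod_le_prod' fun ω _ => (Finset.mem_filter.mp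
      (Fintype.mem_piFinset.mp hΦ ω)).2).trans (by simp)
  have hEc : E.Coprime M := Nat.Coprime.prod_left fun ω _ => Nat.Coprime.prod_left fun p _ =>
    Nat.Coprime.pow_left _ (hPM p p.2)
  have h := shift_avg k N M E hEc ((Nat.mul_le_mul_right M hED).trans hEM) V ψ (fun ω => iph P (Φ ω))
    hV1 hVs hVt hψ hψM (fun ω n => (iph_abs P _ n).1)
    (fun ω n t => iph_per P _ E (Finset.dvd_prod_of_mem _ (Finset.mem_univ ω)) n t)
  refine h.trans ?_
  have : (E : ℝ) ≤ D ^ (2 ^ k) := by exact_mod_cast hED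
  gcongr

end expansion

lemma box_supp (R N : ℕ) (g : ℤ → ℝ) (h0 : ∀ n, 0 ≤ g n) (hs : ∀ n, g n ≠ 0 → 1 ≤ n ∧ n ≤ N) (c : ℤ) :
    ∑ n ∈ Finset.Icc (-(R : ℤ)) R, g (n + c) ≤ ∑ n ∈ Finset.Icc (1 : ℤ) N, g n := by
  have h1 : ∑ n ∈ Finset.Icc (-(R : ℤ)) R, g (n + c) =
      ∑ n ∈ (Finset.Icc (-(R : ℤ)) R).image (· + c), g n := by
    rw [Finset.sum_image (fun a _ b _ h => by simpa using h)]
  rw [h1, ← Finset.sum_filter_ne_zero]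
  refine Finset.sum_le_sum_of_subset_of_nonneg (fun n hn => ?_) fun n _ _ => h0 n
  exact Finset.mem_Icc.mpr (hs n (Finset.mem_filter.mp hn).2)

lemma prod_diff_sum {ι : Type*} [Fintype ι] [Nonempty ι] (a b δ : ι → ℝ) (hδ : ∀ i, 0 ≤ δ i)
    (ha : ∀ i, |a i| ≤ 1) (hab : ∀ i, |a i - b i| ≤ δ i) :
    |∏ i, a i - ∏ i, b i| ≤ Fintype.card ι * 2 ^ Fintype.card ι *
      ∑ i, (δ i + δ i ^ (Fintype.card ι + 1)) := by
  obtain ⟨j, hj⟩ := Finite.exists_max δ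
  set m := Fintype.card ι
  have h1 := (prod_diff Finset.univ a b (δ j) (hδ j) (fun i _ => ha i)
    fun i _ => (hab i).trans (hj i)).2
  rw [Finset.card_univ] at h1
  refine h1.trans ?_
  have h2 : δ j * (1 + δ j) ^ m ≤ 2 ^ m * (δ j + δ j ^ (m + 1)) := by
    rcases le_total (δ j) 1 with h | h
    · have : (1 + δ j) ^ m ≤ 2 ^ m := pow_le_pow_left₀ (by linarith [hδ j]) (by linarith) _
      nlinarith [hδ j, mul_le_mul_of_nonneg_left this (hδ j), pow_nonneg (hδ j) (m + 1),
        mul_nonneg (pow_nonneg (zero_le_two (α := ℝ)) m) (pow_nonneg (hδ j) (m + 1))]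
    · have : (1 + δ j) ^ m ≤ (2 * δ j) ^ m := pow_le_pow_left₀ (by linarith [hδ j]) (by linarith) _
      have h3 := mul_le_mul_of_nonneg_left this (hδ j)
      rw [mul_pow, show δ j * (2 ^ m * δ j ^ m) = 2 ^ m * δ j ^ (m + 1) by ring] at h3
      nlinarith [mul_nonneg (pow_nonneg (zero_le_two (α := ℝ)) m) (hδ j)]
  have h4 : δ j + δ j ^ (m + 1) ≤ ∑ i, (δ i + δ i ^ (m + 1)) :=
    Finset.single_le_sum (f := fun i => δ i + δ i ^ (m + 1))
      (fun i _ => add_nonneg (hδ i) (pow_nonneg (hδ i) _)) (Finset.mem_univ j)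
  calc (m : ℝ) * δ j * (1 + δ j) ^ m = m * (δ j * (1 + δ j) ^ m) := by ring
    _ ≤ m * (2 ^ m * (δ j + δ j ^ (m + 1))) := by gcongr
    _ ≤ m * (2 ^ m * ∑ i, (δ i + δ i ^ (m + 1))) := by gcongr
    _ = _ := by ring

section core
variable {P : Finset ℕ} {g : ℕ → Fin 3 → ℝ}

lemma prod_err (hP : ∀ p ∈ P, p.Prime) (h0 : ∀ p, g p 0 = 1) (h1 : ∀ p ∈ P, |g p 1| ≤ 3)
    (h2 : ∀ p ∈ P, |g p 2| ≤ 2) (k N D : ℕ) (hD : 0 < D) (σ Q : ℝ) (hσ : 0 ≤ σ)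
    (h3 : ∀ p ∈ P, (p : ℝ) ^ σ ≤ 3) (hQ : 1 ≤ Q) (hPQ : ∀ p ∈ P, (p : ℝ) < Q)
    (U : ℤ → ℝ) (hU2 : ∀ n, |U n| ≤ 2) (hUs : ∀ n, U n ≠ 0 → 1 ≤ n ∧ n ≤ N)
    (hUG : ∀ n, |U n * GG P g n| ≤ 1) :
    |∑ x ∈ boxR k (2 * N), ∏ ω, (U (LL ω x) * GG P g (LL ω x)) -
      ∑ x ∈ boxR k (2 * N), ∏ ω, (U (LL ω x) * GD P g D (LL ω x))| ≤
    2 ^ k * 2 ^ (2 ^ k) * (2 ^ k * ((2 * (2 * N : ℕ) + 1) ^ k * (2 * 2 ^ (2 ^ k + 1) * (D : ℝ) ^ (-σ) *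
      (N * Real.exp (30 ^ (2 ^ k + 1) * (1 + Real.log Q)))))) := by
  set m := 2 ^ k with hm
  have hD1 : (1 : ℝ) ≤ D := by exact_mod_cast hD
  set A := (D : ℝ) ^ (-σ) with hA
  have hA0 : 0 ≤ A := by positivity
  have hA1 : A ≤ 1 := Real.rpow_le_one_of_one_le_of_nonpos hD1 (by linarith)
  let T : ℤ → ℝ := fun n => ∏ p ∈ P, (if (p : ℤ) ∣ n then 30 else 1)
  have hT1 : ∀ n, 1 ≤ T n := fun n => by
    have := Finset.prod_le_prod (s := P) (f := fun _ => (1 : ℝ)) (g := fun p : ℕ => if (p : ℤ) ∣ n then (30 : ℝ) else 1)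
      (fun _ _ => zero_le_one) (fun p _ => by split_ifs <;> norm_num)
    simpa using this
  let δ : ℤ → ℝ := fun n => if 1 ≤ n ∧ n ≤ N then 2 * (A * T n) else 0
  have hδ0 : ∀ n, 0 ≤ δ n := fun n => by
    simp only [δ]; split_ifs
    · have := hT1 n; positivity
    · exact le_rfl
  have hδ : ∀ n, |U n * GG P g n - U n * GD P g D n| ≤ δ n := by
    intro n
    rw [← mul_sub, abs_mul]
    by_cases hn : 1 ≤ n ∧ n ≤ N
    · simp only [δ, hn, and_self, if_true]
      exact mul_le_mul (hU2 n) (trunc_err h0 h1 h2 D hD σ hσ h3 n) (abs_nonneg _) (by norm_num)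
    · have : U n = 0 := by by_contra h; exact hn (hUs n h)
      rw [this, abs_zero, zero_mul]; exact hδ0 n
  have hcard : Fintype.card (Fin k → Bool) = m := by simp [hm]
  rw [← Finset.sum_sub_distrib]
  refine (Finset.abs_sum_le_sum_abs _ _).trans ?_
  have hpt : ∀ x ∈ boxR k (2 * N), |∏ ω, (U (LL ω x) * GG P g (LL ω x)) -
      ∏ ω, (U (LL ω x) * GD P g D (LL ω x))| ≤
      m * 2 ^ m * ∑ ω, (δ (LL ω x) + δ (LL ω x) ^ (m + 1)) := by
    intro x _
    have := prod_diff_sum (fun ω : Fin k → Bool => U (LL ω x) * GG P g (LL ω x))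
      (fun ω => U (LL ω x) * GD P g D (LL ω x)) (fun ω => δ (LL ω x)) (fun _ => hδ0 _)
      (fun _ => hUG _) (fun _ => hδ _)
    rwa [hcard] at this
  refine (Finset.sum_le_sum hpt).trans ?_
  rw [← Finset.mul_sum, Finset.sum_comm]
  have step : ∀ ω ∈ (Finset.univ : Finset (Fin k → Bool)),
      ∑ x ∈ boxR k (2 * N), (δ (LL ω x) + δ (LL ω x) ^ (m + 1)) ≤
      ((2 * ((2 * N : ℕ) : ℝ) + 1) ^ k * (2 * 2 ^ (m + 1) * A *
      (N * Real.exp (30 ^ (m + 1) * (1 + Real.log Q))))) := by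
    intro ω _
    refine box_sum (2 * N) ω (fun n => δ n + δ n ^ (m + 1)) _ fun c => (box_supp (2 * N) N _
      (fun n => add_nonneg (hδ0 n) (pow_nonneg (hδ0 n) _)) (fun n hn => ?_) c).trans ?_
    · by_contra h
      exact hn (by simp [δ, h])
    · have e1 : ∀ n ∈ Finset.Icc (1 : ℤ) N, δ n + δ n ^ (m + 1) ≤ 2 * 2 ^ (m + 1) * A *
          ∏ p ∈ P, (if (p : ℤ) ∣ n then (30 : ℝ) ^ (m + 1) else 1) := by
        intro n hn
        have e2 : ∏ p ∈ P, (if (p : ℤ) ∣ n then (30 : ℝ) ^ (m + 1) else 1) = T n ^ (m + 1) := by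
          rw [← Finset.prod_pow]
          exact Finset.prod_congr rfl fun p _ => by split_ifs <;> simp
        rw [e2]
        simp only [δ, Finset.mem_Icc.mp hn, and_self, if_true]
        have t1 : T n ≤ T n ^ (m + 1) := le_self_pow₀ (hT1 n) (by omega)
        have t2 : A ^ (m + 1) ≤ A := pow_le_of_le_one hA0 hA1 (by omega)
        have t3 : (2 : ℝ) ≤ 2 ^ (m + 1) := le_self_pow₀ (by norm_num) (by omega)
        have t4 : 0 ≤ T n := by linarith [hT1 n]
        calc 2 * (A * T n) + (2 * (A * T n)) ^ (m + 1)
            = 2 * (A * T n) + 2 ^ (m + 1) * (A ^ (m + 1) * T n ^ (m + 1)) := by rw [mul_pow, mul_pow]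
          _ ≤ 2 ^ (m + 1) * (A * T n ^ (m + 1)) + 2 ^ (m + 1) * (A * T n ^ (m + 1)) := by gcongr
          _ = _ := by ring
      refine (Finset.sum_le_sum e1).trans ?_
      rw [← Finset.mul_sum]
      refine mul_le_mul_of_nonneg_left ?_ (by positivity)
      refine (sum_K hP N _ (by positivity)).trans ?_
      gcongr
      exact prod_exp_le hP Q _ hQ hPQ (by positivity)
  refine mul_le_mul (by rw [hm]; push_cast; exact le_rfl)
    ((Finset.sum_le_card_nsmul _ _ _ step).trans (le_of_eq ?_))
    (Finset.sum_nonneg fun _ _ => Finset.sum_nonneg fun _ _ =>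
      add_nonneg (hδ0 _) (pow_nonneg (hδ0 _) _)) (by positivity)
  rw [Finset.card_univ, hcard, nsmul_eq_mul, hm]; push_cast; ring

theorem core_bound (hP : ∀ p ∈ P, p.Prime) (h0 : ∀ p, g p 0 = 1) (h1 : ∀ p ∈ P, |g p 1| ≤ 3)
    (h2 : ∀ p ∈ P, |g p 2| ≤ 2) (k N M D : ℕ) (hD : 0 < D) [NeZero M] (σ Q y : ℝ) (hσ : 0 ≤ σ)
    (h3 : ∀ p ∈ P, (p : ℝ) ^ σ ≤ 3) (hQ : 1 ≤ Q) (hPQ : ∀ p ∈ P, (p : ℝ) < Q)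
    (hPM : ∀ p ∈ P, p.Coprime M)
    (hEM : D ^ (2 ^ k) * M ≤ N) (V ψ : ℤ → ℝ)
    (hV1 : ∀ n, |V n| ≤ 1) (hVs : ∀ n, V n ≠ 0 → 1 ≤ n ∧ n ≤ N)
    (hVt : ∀ (s : ℕ) (a b c : ℤ), ∑ n ∈ Finset.Icc a b, |V (n + c + s) - V (n + c)| ≤ 2 * s)
    (hψ : ∀ n, |ψ n| ≤ 2) (hψM : ∀ n n', (M : ℤ) ∣ n - n' → ψ n = ψ n')
    (hVG : ∀ n, |V n * GG P g n| ≤ 1) (hF : ∀ n, |V n * ψ n * GG P g n| ≤ 1)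
    (hy : |∑ z : Option (Fin k) → Fin M, ∏ ω, ψ (ell ω (fun i => ((z i : ℕ) : ℤ)))| ≤
      y * M ^ (k + 1)) (err : ℝ)
    (herr : 2 ^ k * 2 ^ (2 ^ k) * (2 ^ k * ((2 * (2 * N : ℕ) + 1) ^ k * (2 * 2 ^ (2 ^ k + 1) *
      (D : ℝ) ^ (-σ) * (N * Real.exp (30 ^ (2 ^ k + 1) * (1 + Real.log Q)))))) ≤ err) :
    |∑ x ∈ boxR k (2 * N), ∏ ω, (V (LL ω x) * ψ (LL ω x) * GG P g (LL ω x))| ≤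
      err + y * ((2 * (2 * N : ℕ) + 1) ^ (k + 1) + err) +
      (D * Real.exp (5 * (1 + Real.log Q))) ^ (2 ^ k) *
      (2 ^ (2 ^ k) * 2 ^ k * ((2 * (2 * N : ℕ) + 1) ^ k * (2 * (D ^ (2 ^ k) * ((k + 1) * M))))) := by
  have hM : (0 : ℝ) < M := by exact_mod_cast NeZero.pos M
  have a1 := (prod_err hP h0 h1 h2 k N D hD σ Q hσ h3 hQ hPQ (fun n => V n * ψ n)
    (fun n => by
      rw [abs_mul]
      calc |V n| * |ψ n| ≤ 1 * 2 := mul_le_mul (hV1 n) (hψ n) (abs_nonneg _) zero_le_one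
        _ = 2 := by norm_num)
    (fun n hn => hVs n (left_ne_zero_of_mul hn)) hF).trans herr
  have a2 := (prod_err hP h0 h1 h2 k N D hD σ Q hσ h3 hQ hPQ V (fun n => (hV1 n).trans (by norm_num))
    hVs hVG).trans herr
  have a3 := tuple_avg (P := P) (g := g) k N M D hPM hEM V ψ hV1 hVs hVt hψ hψM
  have a4 : |∑ x ∈ boxR k (2 * N), ∏ ω, (V (LL ω x) * GG P g (LL ω x))| ≤
      (2 * (2 * N : ℕ) + 1) ^ (k + 1) := by
    refine (Finset.abs_sum_le_sum_abs _ _).trans ?_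
    refine (Finset.sum_le_card_nsmul _ _ 1 fun x _ => ?_).trans ?_
    · rw [Finset.abs_prod]
      exact Finset.prod_le_one (fun _ _ => abs_nonneg _) fun _ _ => hVG _
    · rw [boxR_card, nsmul_eq_mul]; push_cast; linarith
  have a5 : (∑ φ ∈ TT P D, |gco P g φ|) ^ (2 ^ k) ≤ (D * Real.exp (5 * (1 + Real.log Q))) ^ (2 ^ k) := by
    refine pow_le_pow_left₀ (Finset.sum_nonneg fun _ _ => abs_nonneg _) ?_ _
    refine (sum_coeff hP h0 h1 h2 D).trans ?_
    gcongr
    exact prod_exp_le hP Q _ hQ hPQ (by positivity)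
  replace a3 := a3.trans (mul_le_mul_of_nonneg_right a5 (by positivity))
  set S0 := ∑ x ∈ boxR k (2 * N), ∏ ω, (V (LL ω x) * ψ (LL ω x) * GG P g (LL ω x))
  set S1 := ∑ x ∈ boxR k (2 * N), ∏ ω, (V (LL ω x) * ψ (LL ω x) * GD P g D (LL ω x))
  set S2 := ∑ x ∈ boxR k (2 * N), ∏ ω, (V (LL ω x) * GD P g D (LL ω x))
  set S3 := ∑ x ∈ boxR k (2 * N), ∏ ω, (V (LL ω x) * GG P g (LL ω x))
  set Ψ := ∑ z : Option (Fin k) → Fin M, ∏ ω, ψ (ell ω (fun i => ((z i : ℕ) : ℤ)))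
  have b1 : |Ψ / M ^ (k + 1)| ≤ y := by
    rw [abs_div, abs_of_pos (pow_pos hM (k + 1)), div_le_iff₀ (by positivity)]; exact hy
  have b2 : |S2| ≤ (2 * (2 * N : ℕ) + 1) ^ (k + 1) + err := by
    have : |S2| ≤ |S3| + |S3 - S2| := by
      rw [show S2 = S3 - (S3 - S2) by ring]
      refine (abs_sub _ _).trans ?_
      rw [sub_sub_cancel]
    linarith
  have b3 : |Ψ / M ^ (k + 1) * S2| ≤ y * ((2 * (2 * N : ℕ) + 1) ^ (k + 1) + err) := by
    rw [abs_mul]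
    exact mul_le_mul b1 b2 (abs_nonneg _) ((abs_nonneg _).trans b1)
  have b4 : |S0| ≤ |S0 - S1| + |S1 - Ψ / M ^ (k + 1) * S2| + |Ψ / M ^ (k + 1) * S2| := by
    rw [show S0 = (S0 - S1) + (S1 - Ψ / M ^ (k + 1) * S2) + Ψ / M ^ (k + 1) * S2 by ring]
    refine (abs_add_three _ _ _).trans (le_of_eq ?_)
    congr 3 <;> ring
  linarith
end core

lemma sqf_prod (Z : Finset ℕ) (hZ : ∀ p ∈ Z, p.Prime) : Squarefree (∏ p ∈ Z, p) := by
  refine Finset.squarefree_prod_of_pairwise_isCoprime (fun p hp r hr h => ?_)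
    fun p hp => (hZ p hp).prime.squarefree
  exact Nat.coprime_iff_isRelPrime.mp ((Nat.coprime_primes (hZ p hp) (hZ r hr)).mpr h)

lemma mem_of_dvd_prod (Z : Finset ℕ) (hZ : ∀ p ∈ Z, p.Prime) (p : ℕ) (hp : p.Prime)
    (h : p ∣ ∏ r ∈ Z, r) : p ∈ Z := by
  rw [hp.prime.dvd_finsetProd_iff] at h
  obtain ⟨r, hr, hd⟩ := h
  rw [Nat.prime_dvd_prime_iff_eq hp (hZ r hr)] at hd
  exact hd ▸ hr

lemma gcd_one_iff (A : Finset ℕ) (hA : ∀ p ∈ A, p.Prime) (t : ℕ) :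
    Nat.gcd t (∏ p ∈ A, p) = 1 ↔ ∀ p ∈ A, ¬ p ∣ t := by
  rw [← Nat.coprime_iff_gcd_eq_one, Nat.coprime_prod_right_iff]
  refine forall₂_congr fun p hp => ?_
  rw [Nat.coprime_comm, (hA p hp).coprime_iff_not_dvd]

lemma muSiegel_single (q : ℕ) (χ : DirichletCharacter ℂ q) (β : ℝ) (α : ℂ) (A : Finset ℕ)
    (hA : ∀ p ∈ A, p.Prime) (n : ℕ) (hn : n ≠ 0) (Z : Finset ℕ) (hZ : Z = A.filter (· ∣ n)) (t : ℕ)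
    (ht : n = (∏ p ∈ Z, p) * t) :
    muSiegelFun q χ β α (∏ p ∈ A, p) n = α * ((-1) ^ Z.card * (((t : ℝ) ^ (β - 1) : ℝ) : ℂ) *
      χ (t : ZMod q) * (if ∀ p ∈ A, ¬ p ∣ t then 1 else 0)) := by
  have hZA : Z ⊆ A := hZ ▸ Finset.filter_subset _ _
  have hZp : ∀ p ∈ Z, p.Prime := fun p hp => hA p (hZA hp)
  have hd0 : 0 < ∏ p ∈ Z, p := Finset.prod_pos fun p hp => (hZp p hp).pos
  unfold muSiegelFun
  rw [Finset.sum_eq_single (∏ p ∈ Z, p)]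
  · have hnt : n / (∏ p ∈ Z, p) = t := by rw [ht]; exact Nat.mul_div_cancel_left t hd0
    have hmu : ArithmeticFunction.moebius (∏ p ∈ Z, p) = (-1) ^ Z.card := by
      rw [ArithmeticFunction.isMultiplicative_moebius.map_prod_of_prime Z hZp,
        Finset.prod_congr rfl fun p hp => ArithmeticFunction.moebius_apply_prime (hZp p hp),
        Finset.prod_const]
    rw [hnt, hmu]
    simp only [gcd_one_iff A hA]
    push_cast
    ring
  · intro d hd hne
    rw [Finset.mem_filter, Nat.mem_divisors] at hd
    rw [if_neg, mul_zero]
    intro hg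
    apply hne
    rw [gcd_one_iff A hA] at hg
    rw [← Nat.prod_primeFactors_of_squarefree ((sqf_prod A hA).squarefree_of_dvd hd.2)]
    refine Finset.prod_congr ?_ fun _ _ => rfl
    ext p
    rw [hZ, Finset.mem_filter, Nat.mem_primeFactors]
    constructor
    · rintro ⟨hp, hpd, _⟩
      exact ⟨mem_of_dvd_prod A hA p hp (hpd.trans hd.2), hpd.trans hd.1.1⟩
    · rintro ⟨hp, hpn⟩
      refine ⟨hA p hp, ?_, fun h => hn (by simpa [h] using hd.1.1)⟩
      rw [← Nat.mul_div_cancel' hd.1.1] at hpn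
      exact ((hA p hp).dvd_mul.mp hpn).resolve_right (hg p hp)
  · intro h
    exact (h (Finset.mem_filter.mpr ⟨Nat.mem_divisors.mpr ⟨⟨t, ht⟩, hn⟩,
      Finset.prod_dvd_prod_of_subset Z A _ hZA⟩)).elim

section rep
variable {q : ℕ} {X : q.primeFactors → (ℤ →* ℝ)} (β : ℝ)

/-- The product character. -/
noncomputable def ch (X : q.primeFactors → (ℤ →* ℝ)) : ℤ →* ℝ := ∏ p, X p

lemma ch_apply (n : ℤ) : ch X n = ∏ p, X p n := by simp [ch]

lemma ch_abs (hX : LocChar q X) (n : ℤ) : |ch X n| ≤ 1 := by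
  rw [ch_apply, Finset.abs_prod]
  exact Finset.prod_le_one (fun _ _ => abs_nonneg _) fun p _ => X_abs_le hX p _

/-- Weights. -/
noncomputable def wS (S : Finset q.primeFactors) : ℝ := (-1) ^ S.card * (eS S : ℝ) ^ (1 - β)

/-- Local coefficients. -/
noncomputable def gS (X : q.primeFactors → (ℤ →* ℝ)) (p : ℕ) : Fin 3 → ℝ :=
  ![1, -(1 + ch X p * (p : ℝ) ^ (1 - β)), ch X p * (p : ℝ) ^ (1 - β)]

lemma GG_gS (P : Finset ℕ) (n : ℤ) : GG P (gS β X) n = ∏ p ∈ P.filter (fun p : ℕ => (p : ℤ) ∣ n),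
    (if ((p ^ 2 : ℕ) : ℤ) ∣ n then 0 else -(ch X p * (p : ℝ) ^ (1 - β))) := by
  unfold GG
  rw [Finset.prod_filter, ← Finset.prod_coe_sort P]
  refine Finset.prod_congr rfl fun p _ => ?_
  rw [Fin.sum_univ_three]
  simp only [gS, Fin.val_zero, Fin.val_one, Fin.val_two, pow_zero, pow_one]
  by_cases hd : ((p : ℕ) : ℤ) ∣ n
  · by_cases hd2 : (((p : ℕ) ^ 2 : ℕ) : ℤ) ∣ n
    · simp only [hd, hd2]; simp
    · simp only [hd, hd2]; simp
  · have hd2 : ¬ (((p : ℕ) ^ 2 : ℕ) : ℤ) ∣ n := fun h => hd (dvd_trans (by push_cast; exact dvd_pow_self _ two_ne_zero) h)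
    simp only [hd, hd2]; simp

theorem rep_eq (hq : q ≠ 0) (hX : LocChar q X) (A : Finset ℕ) (hA : ∀ p ∈ A, p.Prime) (hqA : q.primeFactors ⊆ A)
    (n : ℕ) (hn : n ≠ 0) (Z : Finset ℕ) (hZ : Z = A.filter (· ∣ n)) (t : ℕ)
    (ht : n = (∏ p ∈ Z, p) * t) :
    (n : ℝ) ^ (β - 1) * psiW X (wS β) n * GG (A.filter (fun p => ¬ p ∣ q)) (gS β X) n =
      (-1) ^ Z.card * (t : ℝ) ^ (β - 1) * ch X t * (if ∀ p ∈ A, ¬ p ∣ t then 1 else 0) := by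
  have hZp : ∀ p ∈ Z, p.Prime := fun p hp => hA p ((hZ ▸ Finset.filter_subset _ _ : Z ⊆ A) hp)
  set S := Finset.univ.filter fun p : q.primeFactors => ((p : ℕ) : ℤ) ∣ (n : ℤ) with hS
  set Z2 := (A.filter (fun p => ¬ p ∣ q)).filter (fun p : ℕ => (p : ℤ) ∣ (n : ℤ)) with hZ2
  have hmemZ2 : ∀ p, p ∈ Z2 ↔ p ∈ Z ∧ ¬ p ∣ q := by
    intro p
    simp only [hZ2, hZ, Finset.mem_filter, Int.natCast_dvd_natCast]; tauto
  have hZ12 : Z = S.map (Function.Embedding.subtype _) ∪ Z2 := by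
    ext p
    rw [Finset.mem_union, hmemZ2, Finset.mem_map]
    constructor
    · intro hp
      by_cases hpq : p ∣ q
      · refine Or.inl ⟨⟨p, Nat.mem_primeFactors.mpr ⟨hZp p hp, hpq, hq⟩⟩, ?_, rfl⟩
        rw [hZ, Finset.mem_filter] at hp
        simp [hS, Int.natCast_dvd_natCast, hp.2]
      · exact Or.inr ⟨hp, hpq⟩
    · rintro (⟨r, hr, rfl⟩ | h)
      · rw [hZ, Finset.mem_filter]
        refine ⟨hqA r.2, ?_⟩
        rw [hS, Finset.mem_filter] at hr
        exact_mod_cast hr.2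
      · exact h.1
  have hdisj : Disjoint (S.map (Function.Embedding.subtype _)) Z2 := by
    rw [Finset.disjoint_left]
    intro p hp hp2
    obtain ⟨r, hr, rfl⟩ := Finset.mem_map.mp hp
    exact ((hmemZ2 _).mp hp2).2 (Nat.dvd_of_mem_primeFactors r.2)
  have hprod : ∏ p ∈ Z, p = eS S * ∏ p ∈ Z2, p := by
    rw [hZ12, Finset.prod_union hdisj, Finset.prod_map]; rfl
  have hcard : Z.card = S.card + Z2.card := by
    rw [hZ12, Finset.card_union_of_disjoint hdisj, Finset.card_map]
  set e := eS S with he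
  set f := ∏ p ∈ Z2, p with hf
  have he0 : 0 < e := eS_pos S
  have hf0 : 0 < f := Finset.prod_pos fun p hp => (hZp p ((hmemZ2 p).mp hp).1).pos
  have ht0 : t ≠ 0 := by rintro rfl; exact hn (by simpa using ht)
  have hnef : n = e * (f * t) := by rw [ht, hprod, mul_assoc]
  have hpsi : psiW X (wS β) n = (-1) ^ S.card * (e : ℝ) ^ (1 - β) * (ch X f * ch X t) := by
    rw [psiW_eq hX, ← hS, wS, thetaS, ← he, if_pos, ← ch_apply, ← map_mul]
    · congr 2
      rw [hnef]; push_cast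
      exact Int.mul_ediv_cancel_left _ (by exact_mod_cast he0.ne')
    · rw [hnef]; push_cast; exact dvd_mul_right _ _
  rw [hpsi, GG_gS, ← hZ2]
  by_cases hsq : ∃ p ∈ Z2, p ^ 2 ∣ n
  · obtain ⟨p, hp, hpn⟩ := hsq
    have hz : (if ((p ^ 2 : ℕ) : ℤ) ∣ (n : ℤ) then 0 else -(ch X p * (p : ℝ) ^ (1 - β))) = 0 :=
      if_pos (by exact_mod_cast hpn)
    rw [Finset.prod_eq_zero hp hz, mul_zero, if_neg, mul_zero]
    intro hall
    have hpZ := ((hmemZ2 p).mp hp).1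
    have hpA : p ∈ A := (hZ ▸ Finset.filter_subset _ _ : Z ⊆ A) hpZ
    have h1 : Nat.Coprime (p ^ 2) t := Nat.Coprime.pow_left _ (((hA p hpA).coprime_iff_not_dvd).mpr (hall p hpA))
    rw [ht] at hpn
    have h2 := h1.dvd_of_dvd_mul_right hpn
    have h3 := (sqf_prod Z hZp) p (by rw [← pow_two]; exact h2)
    exact (hA p hpA).one_lt.ne' (Nat.isUnit_iff.mp h3)
  · push Not at hsq
    have hG : ∏ p ∈ Z2, (if ((p ^ 2 : ℕ) : ℤ) ∣ (n : ℤ) then 0 else -(ch X p * (p : ℝ) ^ (1 - β))) =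
        (-1) ^ Z2.card * (ch X f * (f : ℝ) ^ (1 - β)) := by
      rw [Finset.prod_congr rfl fun p hp => if_neg (by exact_mod_cast hsq p hp), Finset.prod_neg,
        Finset.prod_mul_distrib, hf]
      push_cast
      rw [map_prod, Real.finsetProd_rpow _ _ fun p _ => by positivity]
    rw [hG]
    have hchf : ch X f * ch X f = 1 := by
      rw [← pow_two, ← sq_abs, ch_apply, Finset.abs_prod, Finset.prod_congr rfl (fun p _ => hX.unit p _ ?_)]
      · simp
      · intro h
        have h1 : (p : ℕ) ∣ f := by exact_mod_cast h
        have h2 := mem_of_dvd_prod Z2 (fun p hp => hZp p ((hmemZ2 p).mp hp).1) p (pf_prime p) h1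
        exact ((hmemZ2 p).mp h2).2 (Nat.dvd_of_mem_primeFactors p.2)
    have hpow : (n : ℝ) ^ (β - 1) * (e : ℝ) ^ (1 - β) * (f : ℝ) ^ (1 - β) = (t : ℝ) ^ (β - 1) := by
      have e1 : (0 : ℝ) < e := by exact_mod_cast he0
      have f1 : (0 : ℝ) < f := by exact_mod_cast hf0
      rw [hnef]; push_cast
      rw [Real.mul_rpow e1.le (by positivity), Real.mul_rpow f1.le (by positivity),
        show (1 - β) = -(β - 1) by ring, Real.rpow_neg e1.le, Real.rpow_neg f1.le]
      field_simp
    have hmain : (n : ℝ) ^ (β - 1) * ((-1) ^ S.card * (e : ℝ) ^ (1 - β) * (ch X f * ch X t)) *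
        ((-1) ^ Z2.card * (ch X f * (f : ℝ) ^ (1 - β))) = (-1) ^ Z.card * (t : ℝ) ^ (β - 1) * ch X t := by
      rw [← hpow, hcard, pow_add]
      linear_combination ((-1) ^ S.card * (-1) ^ Z2.card * (n : ℝ) ^ (β - 1) * (e : ℝ) ^ (1 - β) *
        (f : ℝ) ^ (1 - β) * ch X t) * hchf
    rw [hmain]
    split_ifs with hind
    · rw [mul_one]
    · rw [mul_zero]
      push Not at hind
      obtain ⟨p, hpA, hpt⟩ := hind
      by_cases hpq : p ∣ q
      · have : ch X (t : ℤ) = 0 := by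
          rw [ch_apply]
          exact Finset.prod_eq_zero (Finset.mem_univ (⟨p, Nat.mem_primeFactors.mpr ⟨hA p hpA, hpq, hq⟩⟩ : q.primeFactors))
            (hX.zero _ _ (by exact_mod_cast hpt))
        rw [this, mul_zero]
      · exfalso
        have hpn : p ∣ n := by rw [ht]; exact Dvd.dvd.mul_left hpt _
        have hpZ : p ∈ Z := by rw [hZ, Finset.mem_filter]; exact ⟨hpA, hpn⟩
        refine hsq p ((hmemZ2 p).mpr ⟨hpZ, hpq⟩) ?_
        rw [ht, pow_two]
        exact mul_dvd_mul (Finset.dvd_prod_of_mem _ hpZ) hpt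

end rep

lemma numerics (k : ℕ) : ∃ U C : ℝ, 1000 ≤ U ∧ 0 < C ∧ ∀ (u : ℝ) (N M : ℕ), U ≤ u →
    (N : ℝ) ≤ Real.exp (u ^ 10) → Real.exp (u ^ 10) < N + 1 → (M : ℝ) ≤ Real.exp u ^ 2 →
    ∃ D : ℕ, 0 < D ∧ D ^ (2 ^ k) * M ≤ N ∧ 1 ≤ N ∧
    2 ^ k * 2 ^ (2 ^ k) * (2 ^ k * ((2 * (2 * N : ℕ) + 1) ^ k * (2 * 2 ^ (2 ^ k + 1) *
      (D : ℝ) ^ (-(1 / u)) * (N * Real.exp (30 ^ (2 ^ k + 1) * (1 + Real.log (Real.exp u))))))) ≤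
      C * N ^ (k + 1) * Real.exp (-u) ∧
    (D * Real.exp (5 * (1 + Real.log (Real.exp u)))) ^ (2 ^ k) *
      (2 ^ (2 ^ k) * 2 ^ k * ((2 * (2 * N : ℕ) + 1) ^ k * (2 * (D ^ (2 ^ k) * ((k + 1) * M))))) ≤
      C * N ^ (k + 1) * Real.exp (-u) := by
  obtain ⟨m, hm⟩ : ∃ m : ℕ, m = 2 ^ k := ⟨_, rfl⟩
  have hm1 : (1 : ℝ) ≤ m := by rw [hm]; exact_mod_cast Nat.one_le_two_pow
  have hm0 : m ≠ 0 := by rw [hm]; positivity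
  obtain ⟨K, hK⟩ : ∃ K : ℝ, K = 30 ^ (m + 1) := ⟨_, rfl⟩
  have hK0 : 0 < K := by rw [hK]; positivity
  obtain ⟨C1, hC1⟩ : ∃ C : ℝ, C = 2 ^ k * 2 ^ m * (2 ^ k * (5 ^ k * (2 * 2 ^ (m + 1) * 2))) := ⟨_, rfl⟩
  obtain ⟨C2, hC2⟩ : ∃ C : ℝ, C = 2 ^ m * 2 ^ k * (5 ^ k * (2 * (k + 1))) * 2 := ⟨_, rfl⟩
  have hC1p : 0 < C1 := by rw [hC1]; positivity
  have hC2p : 0 < C2 := by rw [hC2]; positivity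
  refine ⟨4 * m * (2 * K + 1) + 20 * m + 1000, C1 + C2, by nlinarith [mul_nonneg (zero_le_one.trans hm1) hK0.le],
    by positivity, ?_⟩
  intro u N M hu hN1 hN2 hM
  rw [← hm, ← hK, Real.log_exp]
  have hmK : 0 ≤ (m : ℝ) * K := by positivity
  have hu1 : 1 ≤ u := by nlinarith
  have hu0 : 0 < u := by linarith
  have h8 : u ≤ u ^ 8 := le_self_pow₀ hu1 (by norm_num)
  have h9' : u ≤ u ^ 9 := le_self_pow₀ hu1 (by norm_num)
  have h9 : (4 * m * (2 * K + 1)) * u ≤ u ^ 9 := by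
    rw [show u ^ 9 = u ^ 8 * u by ring]
    exact mul_le_mul_of_nonneg_right (by nlinarith) hu0.le
  have h10 : (20 * m + 1000) * u ≤ u ^ 10 := by
    rw [show u ^ 10 = u ^ 9 * u by ring]
    exact mul_le_mul_of_nonneg_right (by nlinarith) hu0.le
  have hexp2 : (2 : ℝ) ≤ Real.exp u := by linarith [Real.add_one_le_exp u]
  have hN2' : Real.exp (u ^ 10) ≤ 2 * N := by
    have : (2 : ℝ) ≤ Real.exp (u ^ 10) := hexp2.trans (Real.exp_le_exp.mpr (le_self_pow₀ hu1 (by norm_num)))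
    linarith
  have hNp : (0 : ℝ) < N := by linarith [Real.exp_pos (u ^ 10)]
  have hN1' : 1 ≤ N := by exact_mod_cast hNp
  have hN1r : (1 : ℝ) ≤ N := by exact_mod_cast hN1'
  obtain ⟨Y, hY⟩ : ∃ Y, Y = Real.exp (u ^ 10 / (4 * m)) := ⟨_, rfl⟩
  have hY2 : 2 ≤ Y := by
    rw [hY]
    refine hexp2.trans (Real.exp_le_exp.mpr ?_)
    rw [le_div_iff₀ (by positivity)]
    nlinarith
  have hYm : Y ^ m = Real.exp (u ^ 10 / 4) := by
    rw [hY, ← Real.exp_nat_mul]; congr 1; field_simp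
  obtain ⟨D, hD⟩ : ∃ D, D = ⌊Y⌋₊ := ⟨_, rfl⟩
  have hDY : (D : ℝ) ≤ Y := by rw [hD]; exact Nat.floor_le (by linarith)
  have hD2 : Y / 2 ≤ D := by
    have := Nat.lt_floor_add_one Y
    rw [← hD] at this; linarith
  have hDm : (D : ℝ) ^ m ≤ Real.exp (u ^ 10 / 4) := by
    rw [← hYm]; gcongr
  have hDp : (0 : ℝ) < D := by linarith
  have hM2 : (M : ℝ) ≤ Real.exp (2 * u) := by rw [two_mul, Real.exp_add, ← pow_two]; exact hM
  have h5 : (2 * ((2 * N : ℕ) : ℝ) + 1) ≤ 5 * N := by push_cast; linarith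
  refine ⟨D, by exact_mod_cast hDp, ?_, hN1', ?_, ?_⟩
  · have h1 : (D : ℝ) ^ m * M ≤ Real.exp (u ^ 10 / 4) * Real.exp (2 * u) := by gcongr
    rw [← Real.exp_add] at h1
    have h2 : 2 * Real.exp (u ^ 10 / 4 + 2 * u) ≤ Real.exp (u ^ 10) := by
      calc _ ≤ Real.exp u * Real.exp (u ^ 10 / 4 + 2 * u) := by gcongr
        _ = Real.exp (u + (u ^ 10 / 4 + 2 * u)) := by rw [← Real.exp_add]
        _ ≤ _ := Real.exp_le_exp.mpr (by nlinarith)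
    have h3 : ((D ^ m * M : ℕ) : ℝ) ≤ N := by push_cast; linarith
    exact_mod_cast h3
  · have hDσ : (D : ℝ) ^ (-(1 / u)) ≤ 2 * Real.exp (-(u ^ 9 / (4 * m))) := by
      calc (D : ℝ) ^ (-(1 / u)) ≤ (Y / 2) ^ (-(1 / u)) :=
            Real.rpow_le_rpow_of_nonpos (by linarith) hD2 (by simp [hu0.le])
        _ = Y ^ (-(1 / u)) * (2 : ℝ) ^ (1 / u) := by
            rw [Real.div_rpow (by linarith) (by norm_num), Real.rpow_neg (by norm_num : (0 : ℝ) ≤ 2),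
              div_inv_eq_mul]
        _ ≤ Y ^ (-(1 / u)) * (2 : ℝ) ^ (1 : ℝ) := by
            gcongr
            · norm_num
            · rw [div_le_one hu0]; exact hu1
        _ = 2 * Real.exp (-(u ^ 9 / (4 * m))) := by
            rw [hY, ← Real.exp_mul, Real.rpow_one, mul_comm]
            congr 2
            field_simp
    have hE : Real.exp (-(u ^ 9 / (4 * m))) * Real.exp (K * (1 + u)) ≤ Real.exp (-u) := by
      rw [← Real.exp_add, Real.exp_le_exp]
      have : K * (1 + u) + u ≤ u ^ 9 / (4 * m) := by
        rw [le_div_iff₀ (by positivity)]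
        have : (K * (1 + u) + u) * (4 * m) ≤ (K * (u + u) + u) * (4 * m) := by gcongr
        linarith
      linarith
    calc _ ≤ 2 ^ k * 2 ^ m * (2 ^ k * ((5 * N) ^ k * (2 * 2 ^ (m + 1) *
          (2 * Real.exp (-(u ^ 9 / (4 * m)))) * (N * Real.exp (K * (1 + u)))))) := by gcongr
      _ = C1 * N ^ (k + 1) * (Real.exp (-(u ^ 9 / (4 * m))) * Real.exp (K * (1 + u))) := by
          rw [hC1]; ring
      _ ≤ (C1 + C2) * N ^ (k + 1) * Real.exp (-u) := by gcongr; linarith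
  · have hE : Real.exp (u ^ 10 / 4) * Real.exp (5 * (1 + u)) ^ m * (Real.exp (u ^ 10 / 4) * Real.exp (2 * u)) ≤
        2 * N * Real.exp (-u) := by
      calc _ = Real.exp (u ^ 10 / 4 + m * (5 * (1 + u)) + (u ^ 10 / 4 + 2 * u) + u) * Real.exp (-u) := by
            rw [← Real.exp_nat_mul]; simp only [← Real.exp_add]; congr 1; ring
        _ ≤ Real.exp (u ^ 10) * Real.exp (-u) := by
            gcongr
            have : (m : ℝ) * (5 * (1 + u)) ≤ m * (5 * (u + u)) := by gcongr
            nlinarith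
        _ ≤ _ := by gcongr
    calc _ ≤ (Y * Real.exp (5 * (1 + u))) ^ m *
          (2 ^ m * 2 ^ k * ((5 * N) ^ k * (2 * (Real.exp (u ^ 10 / 4) * ((k + 1) * Real.exp (2 * u)))))) := by
          gcongr
      _ = 2 ^ m * 2 ^ k * (5 ^ k * (2 * (k + 1))) * N ^ k * (Real.exp (u ^ 10 / 4) *
          Real.exp (5 * (1 + u)) ^ m * (Real.exp (u ^ 10 / 4) * Real.exp (2 * u))) := by
          rw [mul_pow, hYm]; ring
      _ ≤ 2 ^ m * 2 ^ k * (5 ^ k * (2 * (k + 1))) * N ^ k * (2 * N * Real.exp (-u)) := by gcongr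
      _ = C2 * N ^ (k + 1) * Real.exp (-u) := by rw [hC2]; ring
      _ ≤ (C1 + C2) * N ^ (k + 1) * Real.exp (-u) := by gcongr; linarith

/-- The smooth weight. -/
noncomputable def Vf (β : ℝ) (N : ℕ) (n : ℤ) : ℝ := if 1 ≤ n ∧ n ≤ N then (n : ℝ) ^ (β - 1) else 0

lemma Vf_bd (β : ℝ) (hβ : β < 1) (N : ℕ) (n : ℤ) : 0 ≤ Vf β N n ∧ Vf β N n ≤ 1 := by
  unfold Vf
  split_ifs with h
  · have : (1 : ℝ) ≤ n := by exact_mod_cast h.1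
    exact ⟨by positivity, Real.rpow_le_one_of_one_le_of_nonpos this (by linarith)⟩
  · norm_num

lemma Vf_var (β : ℝ) (hβ : β < 1) (N : ℕ) (s : ℕ) (a b c : ℤ) :
    ∑ n ∈ Finset.Icc a b, |Vf β N (n + c + s) - Vf β N (n + c)| ≤ 2 * s := by
  let A : ℤ → ℝ := fun n => if 1 ≤ n then 1 else 0
  let W : ℤ → ℝ := fun n => A n - Vf β N n
  have hA : Monotone A := by
    intro x y hxy
    simp only [A]
    split_ifs <;> first | (exfalso; omega) | norm_num
  have hA0 : ∀ n, 0 ≤ A n ∧ A n ≤ 1 := fun n => by simp only [A]; split_ifs <;> norm_num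
  have hW : Monotone W := by
    intro x y hxy
    simp only [W, A, Vf]
    by_cases hx : 1 ≤ x
    · have hy : 1 ≤ y := hx.trans hxy
      have hx' : (1 : ℝ) ≤ x := by exact_mod_cast hx
      have hxy' : (x : ℝ) ≤ y := by exact_mod_cast hxy
      simp only [hx, hy, true_and, if_true]
      split_ifs
      · have := Real.rpow_le_rpow_of_nonpos (z := β - 1) (by linarith) hxy' (by linarith)
        linarith
      · have : 0 ≤ (x : ℝ) ^ (β - 1) := by positivity
        linarith
      · omega
      · exact le_rfl
    · simp only [hx, false_and, if_false, sub_zero]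
      have := Vf_bd β hβ N y
      have h2 : Vf β N y ≤ A y := by
        simp only [A]
        split_ifs with h
        · exact this.2
        · simp [Vf, h]
      simp only [Vf, A] at h2
      linarith
  have hW0 : ∀ n, 0 ≤ W n := fun n => by
    simp only [W, A]
    split_ifs with h
    · linarith [(Vf_bd β hβ N n).2]
    · simp [Vf, h]
  have hW1 : ∀ n, W n ≤ 1 := fun n => by
    simp only [W]; linarith [(hA0 n).2, (Vf_bd β hβ N n).1]
  have e1 := mono_var A hA (fun n => (hA0 n).1) (fun n => (hA0 n).2) s a b c
  have e2 := mono_var W hW hW0 hW1 s a b c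
  have e3 : ∑ n ∈ Finset.Icc a b, |Vf β N (n + c + s) - Vf β N (n + c)| ≤
      ∑ n ∈ Finset.Icc a b, (|A (n + c + s) - A (n + c)| + |W (n + c + s) - W (n + c)|) := by
    refine Finset.sum_le_sum fun n _ => ?_
    rw [show Vf β N (n + c + s) - Vf β N (n + c) =
      (A (n + c + s) - A (n + c)) - (W (n + c + s) - W (n + c)) by simp only [W]; ring]
    exact abs_sub _ _
  rw [Finset.sum_add_distrib] at e3
  linarith

lemma rpow_small (u β x : ℝ) (hu : 1000 ≤ u) (hβ : 1 - (1/1000) / u < β) (hβ1 : β < 1)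
    (hx1 : 1 ≤ x) (hx : x ≤ Real.exp u) : x ^ (1 - β) ≤ 2 := by
  have hu0 : 0 < u := by linarith
  have h1 : x ^ (1 - β) ≤ Real.exp u ^ (1 - β) :=
    Real.rpow_le_rpow (by linarith) hx (by linarith)
  have h2 : u * (1 - β) ≤ 1/1000 := by
    have : 1 - β ≤ (1/1000) / u := by linarith
    rw [le_div_iff₀ hu0] at this; linarith
  rw [← Real.exp_mul] at h1
  have h3 : Real.exp (u * (1 - β)) ≤ Real.exp (1/2) := Real.exp_le_exp.mpr (by linarith)
  have h4 : Real.exp (1/2) ≤ 2 := by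
    have h5 := Real.exp_one_lt_d9
    have h6 : Real.exp (1/2) * Real.exp (1/2) = Real.exp 1 := by rw [← Real.exp_add]; norm_num
    nlinarith [Real.exp_pos (1/2)]
  linarith

lemma modP_prod (q : ℕ) [NeZero q] : (∏ p : q.primeFactors, modP p) ≤ q ^ 2 := by
  have h : (∏ p : q.primeFactors, modP p) = ∏ p ∈ q.primeFactors, (p ^ q.factorization p * p) := by
    rw [← Finset.prod_coe_sort q.primeFactors (fun p => p ^ q.factorization p * p)]
    exact Finset.prod_congr rfl fun p _ => by rw [modP, pow_succ]
  rw [h, Finset.prod_mul_distrib]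
  have h1 : ∏ p ∈ q.primeFactors, p ^ q.factorization p = q :=
    Nat.prod_factorization_pow_eq_self (NeZero.ne q)
  rw [h1, sq]
  exact Nat.mul_le_mul_left _ (Nat.le_of_dvd (NeZero.pos q) (Nat.prod_primeFactors_dvd q))

lemma decomp (A : Finset ℕ) (hA : ∀ p ∈ A, p.Prime) (n : ℕ) (hn : n ≠ 0) :
    ∃ t, t ≠ 0 ∧ n = (∏ p ∈ A.filter (· ∣ n), p) * t := by
  obtain ⟨t, ht⟩ := Finset.prod_primes_dvd (s := A.filter (· ∣ n)) n
    (fun p hp => (hA p (Finset.mem_filter.mp hp).1).prime) (fun p hp => (Finset.mem_filter.mp hp).2)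
  exact ⟨t, fun h => hn (by rw [ht, h, mul_zero]), ht⟩

lemma VG_le {q : ℕ} {X : q.primeFactors → (ℤ →* ℝ)} (hX : LocChar q X) (β : ℝ) (hβ1 : β < 1)
    (P : Finset ℕ) (hP : ∀ p ∈ P, p.Prime) (N : ℕ) (n : ℤ) :
    |Vf β N n * GG P (gS β X) n| ≤ 1 := by
  by_cases hn : 1 ≤ n ∧ n ≤ N
  swap
  · simp [Vf, hn]
  have hn1 : (1 : ℝ) ≤ n := by exact_mod_cast hn.1
  set Z := P.filter (fun p : ℕ => (p : ℤ) ∣ n) with hZ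
  have hd : (∏ p ∈ Z, p) ≤ n.toNat := by
    refine Nat.le_of_dvd (by omega) (Finset.prod_primes_dvd _
      (fun p hp => (hP p (Finset.mem_filter.mp hp).1).prime) fun p hp => ?_)
    have := (Finset.mem_filter.mp hp).2
    rw [← Int.natCast_dvd_natCast, Int.toNat_of_nonneg (by omega)]
    exact this
  have hd' : ((∏ p ∈ Z, p : ℕ) : ℝ) ≤ n := by
    have : ((∏ p ∈ Z, p : ℕ) : ℤ) ≤ n := by omega
    exact_mod_cast this
  have hG : |GG P (gS β X) n| ≤ (n : ℝ) ^ (1 - β) := by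
    rw [GG_gS, Finset.abs_prod]
    calc _ ≤ ∏ p ∈ Z, ((p : ℕ) : ℝ) ^ (1 - β) := by
          refine Finset.prod_le_prod (fun _ _ => abs_nonneg _) fun p _ => ?_
          have h0 : (0 : ℝ) ≤ (p : ℝ) ^ (1 - β) := by positivity
          split_ifs
          · simpa using h0
          · rw [abs_neg, abs_mul, abs_of_nonneg h0]
            exact mul_le_of_le_one_left h0 (ch_abs hX _)
      _ = ((∏ p ∈ Z, p : ℕ) : ℝ) ^ (1 - β) := by
          push_cast
          rw [Real.finsetProd_rpow _ _ (fun _ _ => by positivity)]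
      _ ≤ _ := Real.rpow_le_rpow (by positivity) hd' (by linarith)
  have hV : Vf β N n = (n : ℝ) ^ (β - 1) := by simp [Vf, hn]
  rw [abs_mul, hV, abs_of_nonneg (by positivity)]
  calc _ ≤ (n : ℝ) ^ (β - 1) * (n : ℝ) ^ (1 - β) := by gcongr
    _ = 1 := by rw [← Real.rpow_add (by linarith)]; simp

lemma F_le {q : ℕ} [NeZero q] {X : q.primeFactors → (ℤ →* ℝ)} (hX : LocChar q X) (β : ℝ) (hβ1 : β < 1)
    (A : Finset ℕ) (hA : ∀ p ∈ A, p.Prime) (hqA : q.primeFactors ⊆ A) (N : ℕ) (n : ℤ) :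
    |Vf β N n * psiW X (wS β) n * GG (A.filter (fun p => ¬ p ∣ q)) (gS β X) n| ≤ 1 := by
  by_cases hn : 1 ≤ n ∧ n ≤ N
  swap
  · simp [Vf, hn]
  have hV : Vf β N n = (n : ℝ) ^ (β - 1) := by simp [Vf, hn]
  rw [hV]
  lift n to ℕ using by omega
  have hn0 : n ≠ 0 := by omega
  obtain ⟨t, ht0, ht⟩ := decomp A hA n hn0
  have := rep_eq β (NeZero.ne q) hX A hA hqA n hn0 _ rfl t ht
  push_cast at this ⊢
  rw [this]
  have h1 : (t : ℝ) ^ (β - 1) ≤ 1 :=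
    Real.rpow_le_one_of_one_le_of_nonpos (by exact_mod_cast Nat.one_le_iff_ne_zero.mpr ht0)
      (by linarith)
  have h2 : |(if ∀ p ∈ A, ¬ p ∣ t then (1 : ℝ) else 0)| ≤ 1 := by split_ifs <;> simp
  have h3 := ch_abs hX t
  rw [abs_mul, abs_mul, abs_mul, abs_pow, abs_neg, abs_one, one_pow, one_mul,
    abs_of_nonneg (by positivity : (0 : ℝ) ≤ (t : ℝ) ^ (β - 1))]
  exact mul_le_one₀ (mul_le_one₀ h1 (abs_nonneg _) h3) (abs_nonneg _) h2

lemma F_bound (k : ℕ) : ∃ U C : ℝ, 1000 ≤ U ∧ 0 < C ∧ ∀ (u : ℝ) (N : ℕ), U ≤ u →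
    (N : ℝ) ≤ Real.exp (u ^ 10) → Real.exp (u ^ 10) < N + 1 →
    ∀ (q : ℕ) [NeZero q] (X : q.primeFactors → (ℤ →* ℝ)), LocChar q X → (q : ℝ) < Real.exp u →
    ∀ β : ℝ, 1 - (1/1000) / u < β → β < 1 → ∀ A : Finset ℕ, (∀ p ∈ A, p.Prime) →
    (∀ p ∈ A, (p : ℝ) < Real.exp u) → q.primeFactors ⊆ A →
    1 ≤ N ∧ |∑ x ∈ boxR k (2 * N), ∏ ω, (Vf β N (LL ω x) * psiW X (wS β) (LL ω x) *
      GG (A.filter (fun p => ¬ p ∣ q)) (gS β X) (LL ω x))| ≤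
      C * N ^ (k + 1) * (q : ℝ) ^ (-(1/4) : ℝ) := by
  obtain ⟨U, C1, hU, hC1, hnum⟩ := numerics k
  obtain ⟨C2, hC2, hmean⟩ := psi_mean k
  refine ⟨U, C1 + C2 * (5 ^ (k + 1) + C1) + C1, hU, by positivity, ?_⟩
  intro u N hu hN1 hN2 q _ X hX hq β hβ hβ1 A hA hAQ hqA
  have hu1 : 1000 ≤ u := hU.trans hu
  have hu0 : 0 < u := by linarith
  have hq1 : (1 : ℝ) ≤ q := by exact_mod_cast NeZero.one_le
  have hM : ((∏ p : q.primeFactors, modP p : ℕ) : ℝ) ≤ Real.exp u ^ 2 := by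
    have : ((∏ p : q.primeFactors, modP p : ℕ) : ℝ) ≤ ((q ^ 2 : ℕ) : ℝ) := by exact_mod_cast modP_prod q
    refine this.trans ?_
    push_cast
    gcongr
  obtain ⟨D, hD, hDM, hN, herr, hlast⟩ := hnum u N _ hu hN1 hN2 hM
  refine ⟨hN, ?_⟩
  have hPp : ∀ p ∈ A.filter (fun p => ¬ p ∣ q), p.Prime := fun p hp => hA p (Finset.mem_filter.mp hp).1
  have hPQ : ∀ p ∈ A.filter (fun p => ¬ p ∣ q), (p : ℝ) < Real.exp u :=
    fun p hp => hAQ p (Finset.mem_filter.mp hp).1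
  have hw : ∀ S, |wS (q := q) β S| ≤ 2 := fun S => by
    unfold wS
    rw [abs_mul, abs_pow, abs_neg, abs_one, one_pow, one_mul, abs_of_nonneg (by positivity)]
    have he : eS S ∣ q := by
      have := eS_dvd S q fun p _ => by exact_mod_cast Nat.dvd_of_mem_primeFactors p.2
      exact_mod_cast this
    have he' : (eS S : ℝ) ≤ q := by exact_mod_cast Nat.le_of_dvd (NeZero.pos q) he
    exact rpow_small u β _ hu1 hβ hβ1 (by exact_mod_cast eS_pos S) (by linarith)
  have hpb : ∀ p ∈ A.filter (fun p => ¬ p ∣ q), |ch X p * (p : ℝ) ^ (1 - β)| ≤ 2 := fun p hp => by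
    have h0 : (0 : ℝ) ≤ (p : ℝ) ^ (1 - β) := by positivity
    rw [abs_mul, abs_of_nonneg h0]
    exact (mul_le_of_le_one_left h0 (ch_abs hX _)).trans (rpow_small u β _ hu1 hβ hβ1
      (by exact_mod_cast (hPp p hp).one_lt.le) (hPQ p hp).le)
  have : NeZero (∏ p : q.primeFactors, modP p) :=
    ⟨(Finset.prod_pos fun p _ => modP_pos p).ne'⟩
  have hPM : ∀ p ∈ A.filter (fun p => ¬ p ∣ q), p.Coprime (∏ p : q.primeFactors, modP p) := fun p hp => by
    refine Nat.Coprime.prod_right fun r _ => Nat.Coprime.pow_right _ ?_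
    rw [Nat.coprime_primes (hPp p hp) (pf_prime r)]
    rintro rfl
    exact (Finset.mem_filter.mp hp).2 (Nat.dvd_of_mem_primeFactors r.2)
  have key := core_bound (P := A.filter (fun p => ¬ p ∣ q)) (g := gS β X) hPp (fun p => by simp [gS])
    (fun p hp => by
      have h := hpb p hp
      have : gS β X p 1 = -(1 + ch X p * (p : ℝ) ^ (1 - β)) := by simp [gS]
      rw [this, abs_neg]
      refine (abs_add_le _ _).trans ?_
      rw [abs_one]; linarith)
    (fun p hp => by
      have : gS β X p 2 = ch X p * (p : ℝ) ^ (1 - β) := by simp [gS]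
      rw [this]; exact hpb p hp)
    k N (∏ p : q.primeFactors, modP p) D hD (1 / u) (Real.exp u) (C2 * (q : ℝ) ^ (-(1/4) : ℝ))
    (by positivity)
    (fun p hp => by
      have h1 : (p : ℝ) ^ (1 / u) ≤ Real.exp u ^ (1 / u) :=
        Real.rpow_le_rpow (by positivity) (hPQ p hp).le (by positivity)
      rw [← Real.exp_mul, mul_one_div_cancel hu0.ne'] at h1
      linarith [Real.exp_one_lt_d9])
    (Real.one_le_exp hu0.le) hPQ hPM hDM (Vf β N) (psiW X (wS β))
    (fun n => by rw [abs_of_nonneg (Vf_bd β hβ1 N n).1]; exact (Vf_bd β hβ1 N n).2)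
    (fun n h => by
      by_contra h'
      exact h (by simp [Vf, h']))
    (Vf_var β hβ1 N) (psiW_abs_le hX _ hw) (psiW_per hX _) (VG_le hX β hβ1 _ hPp N)
    (F_le hX β hβ1 A hA hqA N) (hmean q X hX _ hw) _ herr
  refine key.trans ?_
  set y := (q : ℝ) ^ (-(1/4) : ℝ) with hy
  have hy0 : 0 < y := by positivity
  have he : Real.exp (-u) ≤ y := by
    rw [Real.exp_neg, hy, Real.rpow_neg (by linarith)]
    refine inv_anti₀ (by positivity) (le_trans ?_ hq.le)
    calc (q : ℝ) ^ ((1/4) : ℝ) ≤ (q : ℝ) ^ (1 : ℝ) := Real.rpow_le_rpow_of_exponent_le hq1 (by norm_num)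
      _ = q := Real.rpow_one _
  have hN1r : (1 : ℝ) ≤ N := by exact_mod_cast hN
  have h5 : (2 * ((2 * N : ℕ) : ℝ) + 1) ^ (k + 1) ≤ 5 ^ (k + 1) * N ^ (k + 1) := by
    rw [← mul_pow]
    gcongr
    push_cast; linarith
  have hE : C1 * N ^ (k + 1) * Real.exp (-u) ≤ C1 * N ^ (k + 1) * y := by gcongr
  have hE1 : C1 * N ^ (k + 1) * Real.exp (-u) ≤ C1 * N ^ (k + 1) := by
    refine mul_le_of_le_one_right (by positivity) ?_
    rw [Real.exp_le_one_iff]; linarith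
  have hm : C2 * y * ((2 * ((2 * N : ℕ) : ℝ) + 1) ^ (k + 1) + C1 * N ^ (k + 1) * Real.exp (-u)) ≤
      C2 * y * (5 ^ (k + 1) * N ^ (k + 1) + C1 * N ^ (k + 1)) := by gcongr
  refine (add_le_add (add_le_add hE hm) (hlast.trans hE)).trans (le_of_eq ?_)
  ring

lemma conj_iter (j : ℕ) (a : ℂ) (r : ℝ) :
    (⇑(starRingEnd ℂ))^[j] (a * r) = (⇑(starRingEnd ℂ))^[j] a * r := by
  induction j with
  | zero => rfl
  | succ j ih => rw [Function.iterate_succ_apply', Function.iterate_succ_apply', ih, map_mul, Complex.conj_ofReal]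

lemma conj_iter_norm (j : ℕ) (a : ℂ) : ‖(⇑(starRingEnd ℂ))^[j] a‖ = ‖a‖ := by
  induction j with
  | zero => rfl
  | succ j ih => rw [Function.iterate_succ_apply', RCLike.norm_conj, ih]

lemma conj_iter_one (j : ℕ) : (⇑(starRingEnd ℂ))^[j] 1 = 1 := by
  induction j with
  | zero => rfl
  | succ j ih => rw [Function.iterate_succ_apply', ih, map_one]

lemma gowers_tsum (k N : ℕ) (f : ℤ → ℂ) (a : ℂ) (F : ℤ → ℝ) (hf : ∀ n, f n = a * F n)
    (hF : ∀ n, F n ≠ 0 → 1 ≤ n ∧ n ≤ N) :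
    ∑' nh : ℤ × (Fin k → ℤ), gowersProd k f nh.1 nh.2 =
      (∏ ω : Fin k → Bool, (⇑(starRingEnd ℂ))^[(Finset.univ.filter fun i => ω i = true).card] a) *
      ((∑ x ∈ boxR k (2 * N), ∏ ω, F (LL ω x) : ℝ) : ℂ) := by
  have h1 : ∀ x : ℤ × (Fin k → ℤ), gowersProd k f x.1 x.2 =
      (∏ ω : Fin k → Bool, (⇑(starRingEnd ℂ))^[(Finset.univ.filter fun i => ω i = true).card] a) *
      ((∏ ω, F (LL ω x) : ℝ) : ℂ) := fun x => by
    unfold gowersProd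
    rw [Complex.ofReal_prod, ← Finset.prod_mul_distrib]
    refine Finset.prod_congr rfl fun ω _ => ?_
    rw [hf, conj_iter]
    rfl
  rw [tsum_eq_sum (s := boxR k (2 * N))]
  · rw [Finset.sum_congr rfl fun x _ => h1 x, ← Finset.mul_sum, Complex.ofReal_sum]
  · intro x hx
    rw [h1]
    by_cases h : ∏ ω, F (LL ω x) = 0
    · rw [h]; simp
    · exfalso
      replace h := Finset.prod_ne_zero_iff.mp h
      have := LL_mem_box N x fun ω => hF _ (h ω (Finset.mem_univ _))
      apply hx
      rw [mem_boxR]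
      push_cast
      refine ⟨by omega, fun i => ?_⟩
      have := this.2 i
      omega

lemma gowers_num (k N : ℕ) (f : ℤ → ℂ) (a : ℂ) (F : ℤ → ℝ) (hf : ∀ n, f n = a * F n)
    (hF : ∀ n, F n ≠ 0 → 1 ≤ n ∧ n ≤ N) :
    gowersTildeU k f ≤ (‖a‖ ^ (2 ^ k) * |∑ x ∈ boxR k (2 * N), ∏ ω, F (LL ω x)|) ^ ((1 : ℝ) / 2 ^ k) := by
  unfold gowersTildeU
  refine (le_abs_self _).trans ((Real.abs_rpow_le_abs_rpow _ _).trans ?_)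
  refine Real.rpow_le_rpow (abs_nonneg _) ((Complex.abs_re_le_norm _).trans (le_of_eq ?_)) (by positivity)
  rw [gowers_tsum k N f a F hf hF, norm_mul, norm_prod, Complex.norm_real, Real.norm_eq_abs]
  congr 1
  rw [Finset.prod_congr rfl fun ω _ => conj_iter_norm _ a]
  simp

lemma trunc_cond (N : ℝ) (hN : 0 ≤ N) (n : ℤ) :
    (1 ≤ n ∧ (n : ℝ) ≤ N) ↔ (1 ≤ n ∧ n ≤ (⌊N⌋₊ : ℤ)) := by
  refine and_congr_right fun h => ?_
  rw [← Int.le_floor, ← Int.natCast_floor_eq_floor hN]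

lemma gowers_den (k : ℕ) (N : ℝ) (hN : 0 ≤ N) (hk : k + 1 ≤ ⌊N⌋₊) :
    (((⌊N⌋₊ : ℝ) / (2 * (k + 1))) ^ (k + 1)) ^ ((1 : ℝ) / 2 ^ k) ≤ gowersTildeU k (truncN N fun _ => 1) := by
  unfold gowersTildeU
  set n := ⌊N⌋₊ with hn
  let F : ℤ → ℝ := fun m => if 1 ≤ m ∧ m ≤ (n : ℤ) then 1 else 0
  rw [gowers_tsum k n (truncN N fun _ => 1) 1 F (fun m => by
      simp only [truncN, F, trunc_cond N hN, ← hn]; split_ifs <;> simp)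
    (fun m hm => by by_contra h; exact hm (by simp only [F, h, if_false])),
    Finset.prod_congr rfl fun ω _ => conj_iter_one _, Finset.prod_const_one, one_mul, Complex.ofReal_re]
  refine Real.rpow_le_rpow (by positivity) ?_ (by positivity)
  set L := n / (k + 1) with hL
  have hL1 : 1 ≤ L := (Nat.one_le_div_iff (by omega)).mpr hk
  have hL2 : (k + 1) * L ≤ n := Nat.mul_div_le _ _
  have hL3 : (n : ℝ) / (2 * (k + 1)) ≤ L := by
    rw [div_le_iff₀ (by positivity)]
    have : n ≤ L * (2 * (k + 1)) := by
      have := Nat.lt_mul_div_succ n (show 0 < k + 1 by omega)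
      rw [← hL] at this
      nlinarith
    exact_mod_cast this
  let B : Finset (ℤ × (Fin k → ℤ)) := Finset.Icc 1 (L : ℤ) ×ˢ Fintype.piFinset fun _ : Fin k => Finset.Icc 1 (L : ℤ)
  have hB : (B.card : ℝ) = (L : ℝ) ^ (k + 1) := by
    simp only [B, Finset.card_product, Fintype.card_piFinset_const, Int.card_Icc]
    rw [show ((L : ℤ) + 1 - 1).toNat = L by omega, ← pow_succ']
    push_cast; rfl
  have hF0 : ∀ m, 0 ≤ F m := fun m => by simp only [F]; split_ifs <;> norm_num
  calc ((n : ℝ) / (2 * (k + 1))) ^ (k + 1) ≤ (L : ℝ) ^ (k + 1) := by gcongr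
    _ = ∑ x ∈ B, (1 : ℝ) := by rw [← hB]; simp
    _ = ∑ x ∈ B, ∏ ω, F (LL ω x) := by
        refine Finset.sum_congr rfl fun x hx => (Finset.prod_eq_one fun ω _ => ?_).symm
        simp only [B, Finset.mem_product, Finset.mem_Icc, Fintype.mem_piFinset] at hx
        have h1 : 0 ≤ ∑ i, (if ω i then x.2 i else 0) :=
          Finset.sum_nonneg fun i _ => by have := hx.2 i; split_ifs <;> omega
        have h2 : ∑ i, (if ω i then x.2 i else 0) ≤ ∑ i : Fin k, (L : ℤ) :=
          Finset.sum_le_sum fun i _ => by have := hx.2 i; split_ifs <;> omega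
        rw [Finset.sum_const, Finset.card_univ, Fintype.card_fin, nsmul_eq_mul] at h2
        have h3 : ((k : ℤ) + 1) * L ≤ n := by exact_mod_cast hL2
        have : 1 ≤ LL ω x ∧ LL ω x ≤ (n : ℤ) := by
          unfold LL
          constructor
          · linarith [hx.1.1]
          · linarith [hx.1.2]
        simp only [F, this, and_self, if_true]
    _ ≤ _ := by
        refine Finset.sum_le_sum_of_subset_of_nonneg (fun x hx => ?_)
          fun x _ _ => Finset.prod_nonneg fun ω _ => hF0 _
        simp only [B, Finset.mem_product, Finset.mem_Icc, Fintype.mem_piFinset] at hx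
        have h3 : (L : ℤ) ≤ n := by exact_mod_cast Nat.div_le_self _ _
        rw [mem_boxR]
        push_cast
        refine ⟨by omega, fun i => ?_⟩
        have := hx.2 i
        omega

lemma zeta_near : ∃ δ > 0, ∀ β : ℝ, 1 - δ < β → β < 1 → riemannZeta (β : ℂ) ≠ 0 := by
  have h := (riemannZeta_residue_one.eventually_ne one_ne_zero)
  rw [eventually_nhdsWithin_iff, Metric.eventually_nhds_iff] at h
  obtain ⟨δ, hδ, h⟩ := h
  refine ⟨δ, hδ, fun β h1 h2 h3 => ?_⟩
  refine h (y := (β : ℂ)) ?_ ?_ (by rw [h3, mul_zero])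
  · rw [Complex.dist_eq, ← Complex.ofReal_one, ← Complex.ofReal_sub, Complex.norm_real, Real.norm_eq_abs, abs_lt]
    constructor <;> linarith
  · simp only [Set.mem_compl_iff, Set.mem_singleton_iff]
    norm_cast
    exact h2.ne

theorem siegel_correction_mobius_gowers_uniform (k : ℕ) (hk : 2 ≤ k) :
    ∃ c₀ c C : ℝ, 0 < c₀ ∧ 0 < c ∧ 0 < C ∧ ∃ N₀ : ℝ, ∀ N : ℝ, N₀ ≤ N →
      ∀ (q : ℕ) [NeZero q] (χ : DirichletCharacter ℂ q), (q : ℝ) < Qparam N →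
        χ.IsPrimitive → (∀ n : ZMod q, (starRingEnd ℂ) (χ n) = χ n) →
        ∀ β : ℝ, 1 - c₀ / Real.log (Qparam N) < β → β < 1 →
          DirichletCharacter.LFunction χ (β : ℂ) = 0 →
          deriv (fun s : ℂ => DirichletCharacter.LFunction χ s) (β : ℂ) ≠ 0 →
          gowersUN k N
              (fun n : ℤ => muSiegelFun q χ β
                ((1 / deriv (fun s : ℂ => DirichletCharacter.LFunction χ s) (β : ℂ)) *
              ∏ p ∈ (Finset.range (⌈Qparam N⌉₊ + 1)).filter
                  (fun p => Nat.Prime p ∧ (p : ℝ) < Qparam N),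
                ((1 - 1 / (p : ℂ))⁻¹ * (1 - χ ((p : ℕ) : ZMod q) / (((p : ℝ) ^ β : ℝ) : ℂ))⁻¹))
                (primorialLT (Qparam N)) n.toNat)
            ≤ C * (q : ℝ) ^ (-c) := by
  obtain ⟨U, C1, hU, hC1, hFb⟩ := F_bound k
  obtain ⟨δ, hδ, hz⟩ := zeta_near
  set K : ℝ := 32 ^ (2 ^ k) * C1 * (2 * (k + 1)) ^ (k + 1) with hK
  have hK0 : 0 < K := by positivity
  set U' := max (max U 4000) (max (1 / δ) (k + 1 : ℝ)) with hU'
  refine ⟨1/1000, 1 / (4 * 2 ^ k), K ^ ((1 : ℝ) / 2 ^ k), by norm_num, by positivity, by positivity,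
    Real.exp (U' ^ 10), ?_⟩
  intro N hN q _ χ hq hprim hreal β hβ hβ1 hL hL'
  have hU0 : 0 < U' := lt_of_lt_of_le (by norm_num) ((le_max_right U 4000).trans (le_max_left _ _))
  have hNpos : 0 < N := (Real.exp_pos _).trans_le hN
  set u := Real.log N ^ ((1 : ℝ) / 10) with hu
  have hlog : U' ^ 10 ≤ Real.log N := (Real.le_log_iff_exp_le hNpos).mpr hN
  have hlog0 : 0 ≤ Real.log N := (by positivity : (0 : ℝ) ≤ U' ^ 10).trans hlog
  have hu10 : u ^ 10 = Real.log N := by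
    rw [hu, ← Real.rpow_natCast, ← Real.rpow_mul hlog0]; norm_num
  have hu0 : 0 ≤ u := by positivity
  have hUu : U' ≤ u := le_of_pow_le_pow_left₀ (n := 10) (by norm_num) hu0 (hu10 ▸ hlog)
  have hexpN : Real.exp (u ^ 10) = N := by rw [hu10, Real.exp_log hNpos]
  have hQ : Qparam N = Real.exp u := rfl
  rw [hQ] at hq hβ ⊢
  have hβ' := hβ
  rw [Real.log_exp] at hβ'
  have hu1 : U ≤ u := ((le_max_left _ _).trans (le_max_left _ _)).trans hUu
  have hu2 : 4000 ≤ u := ((le_max_right _ _).trans (le_max_left _ _)).trans hUu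
  have hu3 : 1 / δ ≤ u := ((le_max_left _ _).trans (le_max_right _ _)).trans hUu
  have hu4 : (k + 1 : ℝ) ≤ u := ((le_max_right _ _).trans (le_max_right _ _)).trans hUu
  have hupos : 0 < u := by linarith
  have hq1 : q ≠ 1 := by
    rintro rfl
    rw [DirichletCharacter.LFunction_modOne_eq] at hL
    refine hz β ?_ hβ1 hL
    have h1 : (1/1000) / u ≤ δ := by
      rw [div_le_iff₀ hδ] at hu3
      rw [div_le_iff₀ hupos]
      linarith
    linarith
  have hχ1 : χ ≠ 1 := by
    rintro rfl
    have : (1 : DirichletCharacter ℂ q).conductor = q := hprim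
    rw [DirichletCharacter.conductor_one] at this
    exact hq1 this.symm
  have hα := alpha_bound (Real.exp u) (Real.exp_le_exp.mpr hu2) q χ hq hχ1 hreal β hβ hβ1 hL
  obtain ⟨X, hX, hXχ⟩ := locChar_exists q χ hprim hreal
  unfold primorialLT
  set A := (Finset.range (⌈Real.exp u⌉₊ + 1)).filter (fun p => Nat.Prime p ∧ (p : ℝ) < Real.exp u) with hA
  set α := (1 / deriv (fun s : ℂ => DirichletCharacter.LFunction χ s) (β : ℂ)) *
    ∏ p ∈ A, ((1 - 1 / (p : ℂ))⁻¹ * (1 - χ ((p : ℕ) : ZMod q) / (((p : ℝ) ^ β : ℝ) : ℂ))⁻¹) with hαd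
  have hαn : ‖α‖ ≤ 32 := by
    rw [hαd, norm_mul, norm_div, norm_one, one_div, inv_mul_le_iff₀ (norm_pos_iff.mpr hL')]
    linarith
  have hAp : ∀ p ∈ A, p.Prime := fun p hp => (Finset.mem_filter.mp hp).2.1
  have hAQ : ∀ p ∈ A, (p : ℝ) < Real.exp u := fun p hp => (Finset.mem_filter.mp hp).2.2
  have hqA : q.primeFactors ⊆ A := fun p hp => by
    have h1 : (p : ℝ) < Real.exp u := by
      have : (p : ℝ) ≤ q := by exact_mod_cast Nat.le_of_mem_primeFactors hp
      linarith
    refine Finset.mem_filter.mpr ⟨Finset.mem_range.mpr ?_, Nat.prime_of_mem_primeFactors hp, h1⟩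
    have := Nat.le_ceil (Real.exp u)
    have : p < ⌈Real.exp u⌉₊ := by exact_mod_cast h1.trans_le this
    omega
  set N' := ⌊N⌋₊ with hN'
  obtain ⟨hN1, hmain⟩ := hFb u N' hu1 (by rw [hexpN]; exact Nat.floor_le hNpos.le)
    (by rw [hexpN]; exact Nat.lt_floor_add_one N) q X hX hq β hβ' hβ1 A hAp hAQ hqA
  have hnum := gowers_num k N' (truncN N fun n : ℤ => muSiegelFun q χ β α (∏ p ∈ A, p) n.toNat) α
    (fun n => Vf β N' n * psiW X (wS β) n * GG (A.filter (fun p => ¬ p ∣ q)) (gS β X) n)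
    (fun n => by
      simp only [truncN, trunc_cond N hNpos.le, ← hN']
      by_cases hn : 1 ≤ n ∧ n ≤ (N' : ℤ)
      swap
      · simp only [Vf, hn, if_false, zero_mul, Complex.ofReal_zero, mul_zero]
      · simp only [Vf, hn, and_self, if_true]
        lift n to ℕ using by omega
        have hn0 : n ≠ 0 := by omega
        obtain ⟨t, ht0, ht⟩ := decomp A hAp n hn0
        rw [Int.toNat_natCast, muSiegel_single q χ β α A hAp n hn0 _ rfl t ht]
        have h := rep_eq β (NeZero.ne q) hX A hAp hqA n hn0 _ rfl t ht
        have hc : χ (t : ZMod q) = ((ch X t : ℝ) : ℂ) := by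
          have := hXχ (t : ℤ)
          rw [Int.cast_natCast] at this
          rw [this, ch_apply]
        rw [Int.cast_natCast, h, hc]
        congr 1
        push_cast
        split_ifs <;> simp)
    (fun n hn => by
      by_contra h
      exact hn (by simp only [Vf, h, if_false, zero_mul]))
  have hkN : k + 1 ≤ N' := by
    refine Nat.le_floor ?_
    rw [← hexpN]
    push_cast
    have h1 : u ≤ u ^ 10 := le_self_pow₀ (by linarith) (by norm_num)
    linarith [Real.add_one_le_exp (u ^ 10)]
  have hden := gowers_den k N hNpos.le hkN
  rw [← hN'] at hden
  have hN'0 : (0 : ℝ) < N' := by exact_mod_cast hN1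
  have hB0 : (0 : ℝ) < ((N' : ℝ) / (2 * (k + 1))) ^ (k + 1) := by positivity
  unfold gowersUN
  have hqpos : (0 : ℝ) < q := by exact_mod_cast NeZero.pos q
  rw [div_le_iff₀ ((Real.rpow_pos_of_pos hB0 _).trans_le hden)]
  have hCq : (0 : ℝ) ≤ K ^ ((1 : ℝ) / 2 ^ k) * (q : ℝ) ^ (-(1 / (4 * 2 ^ k)) : ℝ) := by positivity
  refine le_trans ?_ (mul_le_mul_of_nonneg_left hden hCq)
  refine hnum.trans ?_
  have he : (q : ℝ) ^ (-(1 / (4 * 2 ^ k)) : ℝ) = ((q : ℝ) ^ (-(1/4) : ℝ)) ^ ((1 : ℝ) / 2 ^ k) := by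
    rw [← Real.rpow_mul hqpos.le]
    congr 1
    field_simp
  rw [he, ← Real.mul_rpow hK0.le (by positivity), ← Real.mul_rpow (by positivity) hB0.le]
  refine Real.rpow_le_rpow (by positivity) ?_ (by positivity)
  calc _ ≤ 32 ^ (2 ^ k) * (C1 * N' ^ (k + 1) * (q : ℝ) ^ (-(1/4) : ℝ)) := by gcongr
    _ = _ := by
      rw [hK, div_pow]
      field_simp
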